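/- arXiv:1905.06223 — 4 statements merged into one kernel-verified Lean document; each statement's English description precedes it below -/
import Mathlib

section
/- Let n, k, k', d be positive integers with k ≤ k' and 2(n+k') ≤ d. Define B₁ := max(0, (6n+2k+2k'−2d)/d)·S₂(1), B₂ := (2n/d)·S₂(1) + ({0}×{0}×[0, k/d]), and B₃ := max(0, 2(n+k−k')/d)·S₂(1) + {(0, min(n, k'−k)/d, (min(n, k'−k) + k)/d)}. Then S_d(n, n+k, n+k') ⊆ co{B₁, B₂, B₃}. -/
open Matrix
open scoped Pointwise ComplexOrder

/-- `P` is an orthogonal projection matrix: `P = P† = P²`. -/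
def IsProjn {d : ℕ} (P : Matrix (Fin d) (Fin d) ℂ) : Prop :=
  P.IsHermitian ∧ P * P = P

/-- `corrSet d n₁ n₂ n₃` is the set `S_d(n₁,n₂,n₃) ⊆ ℝ³` of triples of normalized
traces of pairwise products of orthogonal projections of the prescribed ranks. -/
def corrSet (d n₁ n₂ n₃ : ℕ) : Set (ℝ × ℝ × ℝ) :=
  { x | ∃ P₁ P₂ P₃ : Matrix (Fin d) (Fin d) ℂ,
      IsProjn P₁ ∧ IsProjn P₂ ∧ IsProjn P₃ ∧
      P₁.rank = n₁ ∧ P₂.rank = n₂ ∧ P₃.rank = n₃ ∧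
      x = ((1 / (d : ℝ)) * ((P₁ * P₂).trace).re,
           (1 / (d : ℝ)) * ((P₁ * P₃).trace).re,
           (1 / (d : ℝ)) * ((P₂ * P₃).trace).re) }

/-- The cone of quadruples `(W, X, Y, Z)` for which `W` times the Gram matrix with off-diagonal
entries `2 * X / W - 1`, `2 * Y / W - 1`, `2 * Z / W - 1` is positive semidefinite. Its slice at
`W = 1` is the set of pairwise overlaps of three rank-one projections on a qubit. -/
def GramCone (W X Y Z : ℝ) : Prop :=
  ∀ s t r : ℝ, 0 ≤ W * (s ^ 2 + t ^ 2 + r ^ 2) + 2 * (2 * X - W) * (s * t)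
    + 2 * (2 * Y - W) * (s * r) + 2 * (2 * Z - W) * (t * r)

namespace GramCone

theorem nonneg {W X Y Z : ℝ} (h : GramCone W X Y Z) : 0 ≤ W := by
  have := h 1 0 0
  linarith

theorem add {W X Y Z W' X' Y' Z' : ℝ} (h : GramCone W X Y Z) (h' : GramCone W' X' Y' Z') :
    GramCone (W + W') (X + X') (Y + Y') (Z + Z') := fun s t r => by
  linarith [h s t r, h' s t r]

theorem smul {W X Y Z : ℝ} (h : GramCone W X Y Z) {l : ℝ} (hl : 0 ≤ l) :
    GramCone (l * W) (l * X) (l * Y) (l * Z) := fun s t r => by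
  linarith [mul_nonneg hl (h s t r)]

theorem one_one_one : GramCone 1 1 1 1 := fun s t r => by linarith [sq_nonneg (s + t + r)]
theorem one_zero_zero : GramCone 1 1 0 0 := fun s t r => by linarith [sq_nonneg (s + t - r)]
theorem zero_one_zero : GramCone 1 0 1 0 := fun s t r => by linarith [sq_nonneg (s - t + r)]
theorem zero_zero_one : GramCone 1 0 0 1 := fun s t r => by linarith [sq_nonneg (s - t - r)]
theorem half : GramCone 1 (1 / 2) (1 / 2) (1 / 2) := fun s t r => by
  linarith [sq_nonneg s, sq_nonneg t, sq_nonneg r]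

theorem abs_le {X Y Z : ℝ} (h : GramCone 1 X Y Z) : (0 ≤ X ∧ X ≤ 1) ∧ (0 ≤ Y ∧ Y ≤ 1) := by
  have h1 := h 1 1 0
  have h2 := h 1 (-1) 0
  have h3 := h 1 0 1
  have h4 := h 1 0 (-1)
  refine ⟨⟨?_, ?_⟩, ?_, ?_⟩ <;> linarith

theorem det_nonneg {X Y Z : ℝ} (h : GramCone 1 X Y Z) :
    (Z - (X * Y + (1 - X) * (1 - Y))) ^ 2 ≤ 4 * (X * (1 - X)) * (Y * (1 - Y)) := by
  obtain ⟨⟨h0, h1⟩, -⟩ := h.abs_le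
  rcases eq_or_lt_of_le (mul_nonneg h0 (sub_nonneg.2 h1)) with he | hlt
  · have key : ∀ s : ℝ, 0 ≤ 1 + 2 * s * ((2 * Y - 1) - (2 * X - 1) * (2 * Z - 1)) := fun s => by
      have := h s (-(2 * X - 1) * s) 1
      linear_combination this - 4 * s ^ 2 * he
    have hz : (2 * Y - 1) - (2 * X - 1) * (2 * Z - 1) = 0 := by
      by_contra hne
      have := key (-1 / ((2 * Y - 1) - (2 * X - 1) * (2 * Z - 1)))
      field_simp at this
      linarith
    have : Z - (X * Y + (1 - X) * (1 - Y)) = 0 := by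
      linear_combination (-(2 * X - 1) / 2) * hz - 2 * (2 * Z - 1) * he
    rw [this, ← he]; simp
  · have := h ((2 * X - 1) * (2 * Z - 1) - (2 * Y - 1)) ((2 * X - 1) * (2 * Y - 1) - (2 * Z - 1))
      (1 - (2 * X - 1) ^ 2)
    have h2 : 0 ≤ (X * (1 - X)) * (4 * (X * (1 - X)) * (Y * (1 - Y))
        - (Z - (X * Y + (1 - X) * (1 - Y))) ^ 2) := by
      linear_combination (1/16) * this
    linarith [nonneg_of_mul_nonneg_right h2 hlt]

end GramCone

theorem IsProjn.eigenvalues_eq {d : ℕ} {P : Matrix (Fin d) (Fin d) ℂ} (h : IsProjn P) (i : Fin d) :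
    h.1.eigenvalues i = 0 ∨ h.1.eigenvalues i = 1 := by
  have hi : IsIdempotentElem P := h.2
  have := hi.spectrum_subset ℝ (h.1.eigenvalues_mem_spectrum_real i)
  simpa using this

theorem IsProjn.trace_eq_rank {d : ℕ} {P : Matrix (Fin d) (Fin d) ℂ} (h : IsProjn P) :
    P.trace = P.rank := by
  rw [h.1.trace_eq_sum_eigenvalues, h.1.rank_eq_card_non_zero_eigs, Fintype.card_subtype,
    Finset.card_filter, Nat.cast_sum]
  refine Finset.sum_congr rfl fun i _ => ?_
  rcases h.eigenvalues_eq i with h | h <;> simp [h]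

theorem isProjn_qubit {x : ℝ} {z : ℂ} (h : z * star z = x * (1 - x)) :
    IsProjn !![(x : ℂ), z; star z, 1 - x] := by
  constructor
  · ext i j
    fin_cases i <;> fin_cases j <;> simp
  · ext i j
    have h' : star z * z = x * (1 - x) := by rw [mul_comm, h]
    fin_cases i <;> fin_cases j <;> simp [Matrix.mul_apply, Fin.sum_univ_two] at h h' ⊢
    · linear_combination h
    · ring
    · ring
    · linear_combination h'

theorem rank_qubit {x : ℝ} {z : ℂ} (h : z * star z = x * (1 - x)) :
    (!![(x : ℂ), z; star z, 1 - x]).rank = 1 := by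
  have := (isProjn_qubit h).trace_eq_rank
  simp [Matrix.trace_fin_two] at this
  exact_mod_cast this.symm

theorem GramCone.mem_corrSet {X Y Z : ℝ} (h : GramCone 1 X Y Z) :
    ((1 / 2) * X, (1 / 2) * Y, (1 / 2) * Z) ∈ corrSet 2 1 1 1 := by
  obtain ⟨⟨hX0, hX1⟩, hY0, hY1⟩ := h.abs_le
  have hdet := h.det_nonneg
  have hX := mul_nonneg hX0 (sub_nonneg.2 hX1)
  have hY := mul_nonneg hY0 (sub_nonneg.2 hY1)
  obtain ⟨e, he⟩ : ∃ e, e ^ 2 = X * (1 - X) := ⟨√(X * (1 - X)), Real.sq_sqrt hX⟩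
  obtain ⟨a, ha, hae⟩ : ∃ a, a ^ 2 ≤ Y * (1 - Y) ∧
      Z = X * Y + (1 - X) * (1 - Y) + 2 * e * a := by
    rcases eq_or_ne e 0 with h0 | h0
    · have hX' : X * (1 - X) = 0 := by rw [← he, h0]; ring
      refine ⟨0, by simpa using hY, ?_⟩
      rw [hX'] at hdet
      have : Z - (X * Y + (1 - X) * (1 - Y)) = 0 := by simpa using hdet
      linarith
    · refine ⟨(Z - (X * Y + (1 - X) * (1 - Y))) / (2 * e), ?_, by field_simp; ring⟩
      rw [← he] at hdet
      rw [div_pow, div_le_iff₀ (by positivity)]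
      linarith
  obtain ⟨b, hb⟩ : ∃ b, b ^ 2 = Y * (1 - Y) - a ^ 2 :=
    ⟨√(Y * (1 - Y) - a ^ 2), Real.sq_sqrt (by linarith)⟩
  have h1 : (0 : ℂ) * star 0 = (1 : ℝ) * (1 - (1 : ℝ)) := by simp
  have h2 : (e : ℂ) * star (e : ℂ) = X * (1 - X) := by
    simp [← sq]; exact_mod_cast he
  have h3 : (⟨a, b⟩ : ℂ) * star (⟨a, b⟩ : ℂ) = Y * (1 - Y) := by
    apply Complex.ext
    · simp; linarith
    · simp; ring
  refine ⟨_, _, _, isProjn_qubit h1, isProjn_qubit h2, isProjn_qubit h3, rank_qubit h1,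
    rank_qubit h2, rank_qubit h3, ?_⟩
  simp [Matrix.trace_fin_two]
  linarith

theorem GramCone.eq_zero {X Y Z : ℝ} (h : GramCone 0 X Y Z) : X = 0 ∧ Y = 0 ∧ Z = 0 := by
  have h1 := h 1 1 0
  have h2 := h 1 (-1) 0
  have h3 := h 1 0 1
  have h4 := h 1 0 (-1)
  have h5 := h 0 1 1
  have h6 := h 0 1 (-1)
  refine ⟨?_, ?_, ?_⟩ <;> linarith

theorem GramCone.exists_smul_eq {W X Y Z : ℝ} (h : GramCone W X Y Z) :
    ∃ t ∈ corrSet 2 1 1 1, (X, Y, Z) = (2 * W) • t := by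
  rcases h.nonneg.eq_or_lt with h0 | h0
  · subst h0
    obtain ⟨rfl, rfl, rfl⟩ := h.eq_zero
    exact ⟨_, half.mem_corrSet, by simp⟩
  · have := h.smul (inv_nonneg.2 h0.le)
    rw [inv_mul_cancel₀ h0.ne'] at this
    refine ⟨_, this.mem_corrSet, ?_⟩
    simp
    field_simp
    simp

theorem GramCone.of_bloch {S c e z v : ℝ} (hS : 0 ≤ S) (he : e ^ 2 = c * (1 - c))
    (h : 4 * z ^ 2 + v ^ 2 ≤ S ^ 2) :
    GramCone S (S * c) ((v + S) / 2) (((2 * c - 1) * v + 4 * e * z + S) / 2) := fun s t r => by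
  have key : 0 ≤ S * (S * (s ^ 2 + t ^ 2 + r ^ 2) + 2 * (2 * (S * c) - S) * (s * t)
      + 2 * (2 * ((v + S) / 2) - S) * (s * r)
      + 2 * (2 * (((2 * c - 1) * v + 4 * e * z + S) / 2) - S) * (t * r)) := by
    linear_combination sq_nonneg (S * (t * (2 * e)) + r * (2 * z))
      + sq_nonneg (S * (s + t * (2 * c - 1)) + r * v) + r ^ 2 * h + 4 * S ^ 2 * t ^ 2 * he
  rcases hS.eq_or_lt with rfl | hS
  · have hz : z ^ 2 = 0 := le_antisymm (by nlinarith [sq_nonneg v]) (sq_nonneg z)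
    have hv : v ^ 2 = 0 := le_antisymm (by nlinarith [sq_nonneg z]) (sq_nonneg v)
    simp at hz hv
    simp [hz, hv]
  · exact nonneg_of_mul_nonneg_right key hS

/-- `(X, Y, Z)` is a sum of overlap triples of total size `N`: a `GramCone` part together with
deterministic parts of weights `p`, `p'`, `a`, `b`, where `D` records the signed weight
`a + p - b - p'`. -/
def BlockSum (N D X Y Z : ℝ) : Prop :=
  ∃ W X₁ Y₁ Z₁ p p' a b : ℝ, GramCone W X₁ Y₁ Z₁ ∧ 0 ≤ p ∧ 0 ≤ p' ∧ 0 ≤ a ∧ 0 ≤ b ∧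
    W + p + p' + a + b = N ∧ a + p - b - p' = D ∧
    X = X₁ + p + p' ∧ Y = Y₁ + p' + b ∧ Z = Z₁ + p' + b

namespace BlockSum

theorem zero : BlockSum 0 0 0 0 0 :=
  ⟨0, 0, 0, 0, 0, 0, 0, 0, fun s t r => by simp, by simp⟩

theorem add {N D X Y Z N' D' X' Y' Z' : ℝ} (h : BlockSum N D X Y Z)
    (h' : BlockSum N' D' X' Y' Z') : BlockSum (N + N') (D + D') (X + X') (Y + Y') (Z + Z') := by
  obtain ⟨W, X₁, Y₁, Z₁, p, p', a, b, h1, h2, h3, h4, h5, h6, h7, h8, h9, h10⟩ := h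
  obtain ⟨V, X₂, Y₂, Z₂, o, o', u, v, g1, g2, g3, g4, g5, g6, g7, g8, g9, g10⟩ := h'
  refine ⟨_, _, _, _, p + o, p' + o', a + u, b + v, h1.add g1, ?_⟩
  refine ⟨?_, ?_, ?_, ?_, ?_, ?_, ?_, ?_, ?_⟩ <;> linarith

theorem sum {ι : Type*} (s : Finset ι) {D X Y Z : ι → ℝ}
    (h : ∀ i, BlockSum 1 (D i) (X i) (Y i) (Z i)) :
    BlockSum s.card (∑ i ∈ s, D i) (∑ i ∈ s, X i) (∑ i ∈ s, Y i) (∑ i ∈ s, Z i) := by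
  classical
  induction s using Finset.induction_on with
  | empty => simpa using zero
  | insert i s hi ih =>
    simp only [Finset.sum_insert hi, Finset.card_insert_of_notMem hi, Nat.cast_add, Nat.cast_one]
    rw [add_comm (s.card : ℝ)]
    exact (h i).add ih

theorem of_block {c x w z e : ℝ} (hc0 : 0 ≤ c) (hc1 : c ≤ 1) (hx0 : 0 ≤ x) (hx1 : x ≤ 1)
    (hw0 : 0 ≤ w) (hw1 : w ≤ 1) (he : e ^ 2 = c * (1 - c)) (hz : z ^ 2 ≤ x * w)
    (hz' : z ^ 2 ≤ (1 - x) * (1 - w)) :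
    BlockSum 1 (1 - (x + w)) c x (c * x + (1 - c) * w + 2 * e * z) := by
  rcases le_total (x + w) 1 with hs | hs
  · refine ⟨_, _, _, _, (1 - (x + w)) * c, 0, (1 - (x + w)) * (1 - c), 0,
      GramCone.of_bloch (S := x + w) (c := c) (z := z) (v := x - w) (by linarith) he
        (by linarith), mul_nonneg (by linarith) hc0, le_rfl,
      mul_nonneg (by linarith) (by linarith), le_rfl, ?_⟩
    refine ⟨?_, ?_, ?_, ?_, ?_⟩ <;> ring
  · refine ⟨_, _, _, _, 0, (x + w - 1) * c, 0, (x + w - 1) * (1 - c),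
      GramCone.of_bloch (S := 2 - (x + w)) (c := c) (z := z) (v := x - w) (by linarith) he
        (by linarith), le_rfl, mul_nonneg (by linarith) hc0, le_rfl,
      mul_nonneg (by linarith) (by linarith), ?_⟩
    refine ⟨?_, ?_, ?_, ?_, ?_⟩ <;> ring

/-- Absorbing the deterministic parts of a `BlockSum` into its cone part leaves at most one of
three kinds of defect. -/
theorem normalForm {n k k' D X Y Z q r : ℝ} (h : BlockSum n D X Y (Z - q)) (hq0 : 0 ≤ q)
    (hqk : q ≤ k) (hkk : k ≤ k') (hr0 : 0 ≤ r) (hD : D = q + r - k') {E : ℝ} (hE : 0 ≤ E)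
    (hrE : r ≤ k' + E) :
    ∃ W X₁ Y₁ Z₁ : ℝ, GramCone W X₁ Y₁ Z₁ ∧ W ≤ n ∧
      ((W = n ∧ ∃ q', 0 ≤ q' ∧ q' ≤ k ∧ X = X₁ ∧ Y = Y₁ ∧ Z = Z₁ + q') ∨
       (n - W ≤ E ∧ X = X₁ ∧ Y = Y₁ ∧ Z = Z₁) ∨
       (n - W ≤ k' - k ∧ X = X₁ ∧ Y = Y₁ + (n - W) ∧ Z = Z₁ + (n - W) + k)) := by
  obtain ⟨W, X₁, Y₁, Z₁, p, p', a, b, h1, h2, h3, h4, h5, h6, h7, h8, h9, h10⟩ := h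
  have hW := h1.nonneg
  have hadd : ∀ {x₀ x₁ x₂ x₃ x₄ : ℝ}, 0 ≤ x₀ → 0 ≤ x₁ → 0 ≤ x₂ → 0 ≤ x₃ → 0 ≤ x₄ →
      GramCone (W + x₀ * 1 + x₁ * 1 + x₂ * 1 + x₃ * 1 + x₄ * 1)
        (X₁ + x₀ * 1 + x₁ * 1 + x₂ * 0 + x₃ * 0 + x₄ * (1 / 2))
        (Y₁ + x₀ * 1 + x₁ * 0 + x₂ * 1 + x₃ * 0 + x₄ * (1 / 2))
        (Z₁ + x₀ * 1 + x₁ * 0 + x₂ * 0 + x₃ * 1 + x₄ * (1 / 2)) := fun h₀ h₁ h₂ h₃ h₄ =>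
    ((((h1.add (GramCone.one_one_one.smul h₀)).add (GramCone.one_zero_zero.smul h₁)).add
      (GramCone.zero_one_zero.smul h₂)).add (GramCone.zero_zero_one.smul h₃)).add
      (GramCone.half.smul h₄)
  rcases le_total b a with hab | hab
  · rcases le_total (a - b) q with haq | haq
    · refine ⟨_, _, _, _, hadd h3 h2 h5 (x₃ := a) h4 le_rfl, by linarith, Or.inl ⟨by linarith,
        q - (a - b), ?_⟩⟩
      refine ⟨?_, ?_, ?_, ?_, ?_⟩ <;> linarith
    · rcases le_total (a - b - q) E with hE' | hE'
      · refine ⟨_, _, _, _, hadd h3 h2 h5 (x₃ := b + q) (by linarith) le_rfl, by linarith,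
          Or.inr (Or.inl ?_)⟩
        refine ⟨?_, ?_, ?_, ?_⟩ <;> linarith
      · refine ⟨_, _, _, _, hadd (x₀ := p' - (a - b - q - E)) (x₄ := 2 * (a - b - q - E))
          (by linarith) h2 h5 (x₃ := b + q) (by linarith) (by linarith), by linarith,
          Or.inr (Or.inl ?_)⟩
        refine ⟨?_, ?_, ?_, ?_⟩ <;> linarith
  · rcases le_total (b - a + q) k with haq | haq
    · refine ⟨_, _, _, _, hadd h3 h2 h5 (x₃ := a) h4 le_rfl, by linarith, Or.inl ⟨by linarith,
        q + (b - a), ?_⟩⟩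
      refine ⟨?_, ?_, ?_, ?_, ?_⟩ <;> linarith
    · rcases le_total (b - a + q - k) (k' - k) with hE' | hE'
      · refine ⟨_, _, _, _, hadd h3 h2 (x₂ := a + (k - q)) (by linarith) (x₃ := a) h4 le_rfl,
          by linarith, Or.inr (Or.inr ?_)⟩
        refine ⟨?_, ?_, ?_, ?_⟩ <;> linarith
      · refine ⟨_, _, _, _, hadd (x₁ := p - (b - a + q - k')) (x₄ := 2 * (b - a + q - k')) h3
          (by linarith) (x₂ := a + (k - q)) (by linarith) (x₃ := a) h4 (by linarith),
          by linarith, Or.inr (Or.inr ?_)⟩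
        refine ⟨?_, ?_, ?_, ?_⟩ <;> linarith

end BlockSum

theorem BlockSum.mem_convexHull {n k k' d : ℕ} (hn : 0 < n) (hd : 0 < d) (hkk : k ≤ k')
    (h : 2 * (n + k') ≤ d) {D X Y Z q r : ℝ} (hB : BlockSum n D X Y (Z - q)) (hq0 : 0 ≤ q)
    (hqk : q ≤ k) (hr0 : 0 ≤ r) (hr : r ≤ d - 2 * n - k) (hD : D = q + r - k') :
    ((1 / (d : ℝ)) * X, (1 / (d : ℝ)) * Y, (1 / (d : ℝ)) * Z) ∈
      convexHull ℝ
        (((max 0 ((6 * (n : ℝ) + 2 * (k : ℝ) + 2 * (k' : ℝ) - 2 * (d : ℝ)) / (d : ℝ))) •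
            corrSet 2 1 1 1) ∪
          (((2 * (n : ℝ)) / (d : ℝ)) • corrSet 2 1 1 1 +
            ({(0 : ℝ)} ×ˢ ({(0 : ℝ)} ×ˢ Set.Icc (0 : ℝ) ((k : ℝ) / (d : ℝ))))) ∪
          ((max 0 (2 * ((n : ℝ) + (k : ℝ) - (k' : ℝ)) / (d : ℝ))) • corrSet 2 1 1 1 +
            {((0 : ℝ), ((min n (k' - k) : ℕ) : ℝ) / (d : ℝ),
              (((min n (k' - k) : ℕ) : ℝ) + (k : ℝ)) / (d : ℝ))})) := by
  have hd' : (0 : ℝ) < d := by exact_mod_cast hd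
  have hn' : (0 : ℝ) < n := by exact_mod_cast hn
  have hkk' : (k : ℝ) ≤ k' := by exact_mod_cast hkk
  have hdn : 2 * ((n : ℝ) + k') ≤ d := by exact_mod_cast h
  have hk0 : (0 : ℝ) ≤ k := k.cast_nonneg
  obtain ⟨W, X₁, Y₁, Z₁, hC, hWn, hcase⟩ := hB.normalForm hq0 hqk hkk' hr0 hD
    (E := d - 2 * n - k - k') (by linarith) (by linarith)
  obtain ⟨⟨t₁, t₂, t₃⟩, ht, hXYZ⟩ := hC.exists_smul_eq
  simp only [Prod.smul_mk, smul_eq_mul, Prod.mk.injEq] at hXYZ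
  obtain ⟨hX₁, hY₁, hZ₁⟩ := hXYZ
  have hW := hC.nonneg
  have mem₂ : ∀ q', 0 ≤ q' → q' ≤ (k : ℝ) →
      ((2 * (n : ℝ)) / (d : ℝ) * t₁, (2 * (n : ℝ)) / (d : ℝ) * t₂,
        (2 * (n : ℝ)) / (d : ℝ) * t₃ + q' / d) ∈
      (((2 * (n : ℝ)) / (d : ℝ)) • corrSet 2 1 1 1 +
            ({(0 : ℝ)} ×ˢ ({(0 : ℝ)} ×ˢ Set.Icc (0 : ℝ) ((k : ℝ) / (d : ℝ)))) :
            Set (ℝ × ℝ × ℝ)) := fun q' h0 h1 => by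
    refine Set.mem_add.2 ⟨_, Set.smul_mem_smul_set ht, (0, 0, q' / d), ?_, by simp⟩
    simp only [Set.mem_prod, Set.mem_singleton_iff, Set.mem_Icc, true_and]
    exact ⟨by positivity, by gcongr⟩
  have segment : ∀ {m : ℝ}, 0 ≤ m → m ≤ n → n - W ≤ n - m →
      ∃ l, 0 ≤ l ∧ l ≤ 1 ∧ n - W = l * (n - m) := fun {m} h0 h1 h2 => by
    rcases h1.eq_or_lt with rfl | h1
    · exact ⟨0, le_rfl, zero_le_one, by linarith⟩
    · have : 0 < (n : ℝ) - m := by linarith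
      refine ⟨(n - W) / (n - m), by apply div_nonneg <;> linarith, ?_, by field_simp⟩
      rwa [div_le_one this]
  rcases hcase with ⟨hWn, q', hq'0, hq'k, hX, hY, hZ⟩ | ⟨hWE, hX, hY, hZ⟩ | ⟨hWE, hX, hY, hZ⟩
  · apply subset_convexHull
    refine Or.inl (Or.inr ?_)
    convert mem₂ q' hq'0 hq'k using 2
    · rw [hX, hX₁, hWn]; ring
    · congr 1
      · rw [hY, hY₁, hWn]; ring
      · rw [hZ, hZ₁, hWn]; ring
  · obtain ⟨l, hl0, hl1, hl⟩ := segment (m := max 0 (3 * n + k + k' - d)) (le_max_left _ _)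
      (max_le hn'.le (by linarith)) (by
        rcases max_cases (0 : ℝ) (3 * n + k + k' - d) with h | h <;> linarith)
    have hm : max 0 ((6 * (n : ℝ) + 2 * (k : ℝ) + 2 * (k' : ℝ) - 2 * (d : ℝ)) / (d : ℝ))
        = (2 / d) * max 0 (3 * (n : ℝ) + k + k' - d) := by
      rw [mul_max_of_nonneg _ _ (by positivity)]
      congr 1 <;> ring
    rw [hm]
    refine (convex_convexHull ℝ _).segment_subset
      (subset_convexHull ℝ _
        (Set.mem_union_left _ (Set.mem_union_left _ (Set.smul_mem_smul_set ht))))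
      (subset_convexHull ℝ _
        (Set.mem_union_left _ (Set.mem_union_right _ (mem₂ 0 le_rfl hk0))))
      ⟨l, 1 - l, hl0, by linarith, by ring, ?_⟩
    generalize max 0 (3 * (n : ℝ) + k + k' - d) = m at hl ⊢
    obtain rfl : W = n - l * (n - m) := by linarith
    simp only [Prod.smul_mk, smul_eq_mul, Prod.mk_add_mk, Prod.mk.injEq]
    refine ⟨?_, ?_, ?_⟩
    · rw [hX, hX₁]; ring
    · rw [hY, hY₁]; ring
    · rw [hZ, hZ₁]; ring
  · have hj : ((min n (k' - k) : ℕ) : ℝ) = min (n : ℝ) (k' - k) := by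
      rw [Nat.cast_min, Nat.cast_sub hkk]
    have hm : max 0 (2 * ((n : ℝ) + (k : ℝ) - (k' : ℝ)) / (d : ℝ))
        = (2 / d) * (n - min (n : ℝ) (k' - k)) := by
      rw [← max_sub_sub_left, mul_max_of_nonneg _ _ (by positivity)]
      congr 1 <;> ring
    obtain ⟨l, hl0, hl1, hl⟩ := segment (m := n - min (n : ℝ) (k' - k))
      (by linarith [min_le_left (n : ℝ) (k' - k)])
      (by linarith [le_min hn'.le (by linarith : (0 : ℝ) ≤ k' - k)])
      (by rw [sub_sub_cancel]; exact le_min (by linarith) hWE)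
    rw [hm, hj]
    refine (convex_convexHull ℝ _).segment_subset (subset_convexHull ℝ _
      (Set.mem_union_right _ (Set.add_mem_add
        (Set.smul_mem_smul_set (a := 2 / (d : ℝ) * (n - min (n : ℝ) (k' - k))) ht)
        (Set.mem_singleton _)))) (subset_convexHull ℝ _
      (Set.mem_union_left _ (Set.mem_union_right _ (mem₂ k hk0 le_rfl))))
      ⟨l, 1 - l, hl0, by linarith, by ring, ?_⟩
    generalize min (n : ℝ) (k' - k) = m at hl ⊢
    obtain rfl : W = n - l * m := by linarith
    simp only [Prod.smul_mk, smul_eq_mul, Prod.mk_add_mk, Prod.mk.injEq]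
    refine ⟨?_, ?_, ?_⟩
    · rw [hX, hX₁]; ring
    · rw [hY, hY₁]; ring
    · rw [hZ, hZ₁]; ring

theorem IsProjn.one_sub {d : ℕ} {P : Matrix (Fin d) (Fin d) ℂ} (h : IsProjn P) :
    IsProjn (1 - P) := by
  refine ⟨Matrix.isHermitian_one.sub h.1, ?_⟩
  simp [mul_sub, sub_mul, h.2]

theorem IsProjn.posSemidef {d : ℕ} {P : Matrix (Fin d) (Fin d) ℂ} (h : IsProjn P) :
    P.PosSemidef := by
  have := Matrix.posSemidef_conjTranspose_mul_self P
  rwa [h.1.eq, h.2] at this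

theorem Matrix.IsHermitian.exists_unitary_diagonal {m : ℕ} {A : Matrix (Fin m) (Fin m) ℂ}
    (hA : A.IsHermitian) : ∃ U : Matrix (Fin m) (Fin m) ℂ, Uᴴ * U = 1 ∧ U * Uᴴ = 1 ∧
      A = U * Matrix.diagonal (fun i => (hA.eigenvalues i : ℂ)) * Uᴴ :=
  ⟨hA.eigenvectorUnitary, Unitary.coe_star_mul_self hA.eigenvectorUnitary,
    Unitary.coe_mul_star_self hA.eigenvectorUnitary, by
      conv_lhs => rw [hA.spectral_theorem, Unitary.conjStarAlgAut_apply]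
      rfl⟩

theorem IsProjn.exists_isometry {d n : ℕ} {P : Matrix (Fin d) (Fin d) ℂ} (h : IsProjn P)
    (hn : P.rank = n) : ∃ V : Matrix (Fin d) (Fin n) ℂ, Vᴴ * V = 1 ∧ V * Vᴴ = P := by
  rw [h.1.rank_eq_card_non_zero_eigs] at hn
  obtain ⟨U, hU, -, hP⟩ := h.1.exists_unitary_diagonal
  have hl := h.eigenvalues_eq
  generalize h.1.eigenvalues = l at hn hP hl
  let e := Fintype.equivFinOfCardEq hn
  refine ⟨U.submatrix id (fun i => (e.symm i).1), ?_, ?_⟩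
  · ext i j
    have := congrFun (congrFun hU (e.symm i).1) (e.symm j).1
    simpa [Matrix.mul_apply, Matrix.one_apply, Subtype.val_inj] using this
  · rw [hP]
    ext a b
    rw [Matrix.mul_apply, Matrix.mul_apply]
    simp only [Matrix.submatrix_apply, Matrix.conjTranspose_apply, id, Matrix.mul_diagonal]
    rw [Equiv.sum_comp e.symm (fun i : {i // l i ≠ 0} => U a i.1 * star (U b i.1)),
      ← Finset.sum_subtype (Finset.univ.filter fun i => l i ≠ 0) (by simp)
        (fun i => U a i * star (U b i)), Finset.sum_filter]
    refine Finset.sum_congr rfl fun i _ => ?_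
    rcases hl i with h | h <;> simp [h]

theorem IsProjn.exists_isometry_diagonal {d n : ℕ} {P Q : Matrix (Fin d) (Fin d) ℂ}
    (h : IsProjn P) (hn : P.rank = n) (hQ : IsProjn Q) :
    ∃ (V : Matrix (Fin d) (Fin n) ℂ) (c : Fin n → ℝ), Vᴴ * V = 1 ∧ V * Vᴴ = P ∧
      Vᴴ * Q * V = Matrix.diagonal (fun i => (c i : ℂ)) := by
  obtain ⟨V, hV, hV'⟩ := h.exists_isometry hn
  have hM : (Vᴴ * Q * V).IsHermitian := by
    simp [Matrix.IsHermitian, Matrix.conjTranspose_mul, hQ.1.eq, Matrix.mul_assoc]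
  obtain ⟨U, hU, hU', hd⟩ := hM.exists_unitary_diagonal
  generalize hM.eigenvalues = c at hd
  refine ⟨V * U, c, ?_, ?_, ?_⟩
  · rw [Matrix.conjTranspose_mul, Matrix.mul_assoc, ← Matrix.mul_assoc Vᴴ, hV, Matrix.one_mul, hU]
  · rw [Matrix.conjTranspose_mul, Matrix.mul_assoc, ← Matrix.mul_assoc U, hU', Matrix.one_mul, hV']
  · calc (V * U)ᴴ * Q * (V * U) = Uᴴ * (Vᴴ * Q * V) * U := by
          simp only [Matrix.conjTranspose_mul, Matrix.mul_assoc]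
      _ = (Uᴴ * U) * Matrix.diagonal (fun i => (c i : ℂ)) * (Uᴴ * U) := by
          rw [hd]; simp only [Matrix.mul_assoc]
      _ = _ := by rw [hU, Matrix.one_mul, Matrix.mul_one]

theorem exists_mul_eq {a b : ℝ} (h0 : 0 ≤ a) (h1 : a ≤ b) :
    ∃ g, 0 ≤ g ∧ g ≤ 1 ∧ a = g * b := by
  rcases (h0.trans h1).eq_or_lt with rfl | hb
  · exact ⟨0, le_rfl, zero_le_one, by linarith⟩
  · exact ⟨a / b, by positivity, (div_le_one hb).2 h1, by field_simp⟩

theorem Matrix.PosSemidef.sq_re_le {ι κ : Type*} [Fintype ι] [Finite κ] {R : Matrix ι ι ℂ}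
    (hR : R.PosSemidef) (V F : Matrix ι κ ℂ) (i : κ) :
    ((Vᴴ * R * F) i i).re ^ 2 ≤ ((Vᴴ * R * V) i i).re * ((Fᴴ * R * F) i i).re := by
  have hsymm : ((Fᴴ * R * V) i i).re = ((Vᴴ * R * F) i i).re := by
    have : Fᴴ * R * V = (Vᴴ * R * F)ᴴ := by
      simp [Matrix.conjTranspose_mul, hR.1.eq, Matrix.mul_assoc]
    rw [this]; simp
  have key : ∀ t : ℝ, 0 ≤ ((Fᴴ * R * F) i i).re * (t * t) + (2 * ((Vᴴ * R * F) i i).re) * t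
      + ((Vᴴ * R * V) i i).re := fun t => by
    have h := (hR.conjTranspose_mul_mul_same (V + (t : ℂ) • F)).diag_nonneg (i := i)
    have h := (Complex.le_def.1 h).1
    have e : (V + (t : ℂ) • F)ᴴ * R * (V + (t : ℂ) • F) = Vᴴ * R * V + (t : ℂ) • (Vᴴ * R * F)
        + (t : ℂ) • (Fᴴ * R * V) + (t : ℂ) • (t : ℂ) • (Fᴴ * R * F) := by
      simp only [Matrix.conjTranspose_add, Matrix.conjTranspose_smul, Matrix.add_mul,
        Matrix.mul_add, Matrix.smul_mul, Matrix.mul_smul, smul_add]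
      simp
      abel
    rw [e] at h
    simp at h
    rw [hsymm] at h
    linarith
  have := discrim_le_zero key
  rw [discrim] at this
  linarith

theorem IsProjn.trace_mul_nonneg {d : ℕ} {P Q : Matrix (Fin d) (Fin d) ℂ} (hP : IsProjn P)
    (hQ : IsProjn Q) : 0 ≤ (P * Q).trace.re := by
  have h := (hP.posSemidef.conjTranspose_mul_mul_same Q).trace_nonneg
  rw [hQ.1.eq, Matrix.trace_mul_comm, ← Matrix.mul_assoc, hQ.2, Matrix.trace_mul_comm] at h
  exact (Complex.le_def.1 h).1

theorem IsProjn.trace_mul_le {d : ℕ} {P Q : Matrix (Fin d) (Fin d) ℂ} (hP : IsProjn P)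
    (hQ : IsProjn Q) : (P * Q).trace.re ≤ Q.trace.re := by
  have h := hP.one_sub.trace_mul_nonneg hQ
  rw [Matrix.sub_mul, Matrix.one_mul, Matrix.trace_sub, Complex.sub_re] at h
  linarith

theorem IsProjn.diag_mem_Icc {d n : ℕ} {Q : Matrix (Fin d) (Fin d) ℂ} (hQ : IsProjn Q)
    {V : Matrix (Fin d) (Fin n) ℂ} (hV : Vᴴ * V = 1) (i : Fin n) :
    ((Vᴴ * Q * V) i i).re ∈ Set.Icc (0 : ℝ) 1 := by
  have h0 := (hQ.posSemidef.conjTranspose_mul_mul_same V).diag_nonneg (i := i)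
  have h1 := (hQ.one_sub.posSemidef.conjTranspose_mul_mul_same V).diag_nonneg (i := i)
  rw [Matrix.mul_sub, Matrix.sub_mul, Matrix.mul_one, hV] at h1
  have h0 := (Complex.le_def.1 h0).1
  have h1 := (Complex.le_def.1 h1).1
  simp at h0 h1
  exact ⟨h0, h1⟩

theorem col_eq_zero {d n : ℕ} {N : Matrix (Fin d) (Fin n) ℂ} {i : Fin n}
    (h : (Nᴴ * N) i i = 0) (a : Fin d) : N a i = 0 := by
  have h' : star (fun a => N a i) ⬝ᵥ (fun a => N a i) = 0 := h
  exact congrFun (dotProduct_star_self_eq_zero.1 h') a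

/-- Principal vectors of a pair of projections: `V` has as columns an orthonormal basis of the range
of `P` diagonalizing `Q`, the columns of `F` are the partners of the columns of `V`, and `G`, `H`
are the projections onto the remaining parts of the range and the kernel of `Q`. -/
theorem IsProjn.exists_frame {d n : ℕ} {P Q : Matrix (Fin d) (Fin d) ℂ}
    (hP : IsProjn P) (hn : P.rank = n) (hQ : IsProjn Q) :
    ∃ (V F : Matrix (Fin d) (Fin n) ℂ) (c : Fin n → ℝ) (G H : Matrix (Fin d) (Fin d) ℂ),
      (∀ i, 0 ≤ c i ∧ c i ≤ 1) ∧ Vᴴ * V = 1 ∧ V * Vᴴ = P ∧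
      Vᴴ * Q * V = Matrix.diagonal (fun i => (c i : ℂ)) ∧ Vᴴ * F = 0 ∧
      Fᴴ * F = Matrix.diagonal (fun i => if c i = 0 ∨ c i = 1 then 0 else 1) ∧
      IsProjn G ∧ IsProjn H ∧
      Q = (V * Matrix.diagonal (fun i => (√(c i) : ℂ))
          + F * Matrix.diagonal (fun i => (√(1 - c i) : ℂ))) *
        (V * Matrix.diagonal (fun i => (√(c i) : ℂ))
          + F * Matrix.diagonal (fun i => (√(1 - c i) : ℂ)))ᴴ + G ∧
      1 = V * Vᴴ + F * Fᴴ + G + H := by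
  obtain ⟨V, c, hV, hVP, hVQ⟩ := hP.exists_isometry_diagonal hn hQ
  have hc : ∀ i, 0 ≤ c i ∧ c i ≤ 1 := fun i => by
    simpa [hVQ] using hQ.diag_mem_Icc hV i
  have hs0 : ∀ i, 0 ≤ c i * (1 - c i) := fun i => mul_nonneg (hc i).1 (sub_nonneg.2 (hc i).2)
  set C := Matrix.diagonal (fun i => (c i : ℂ)) with hC
  obtain ⟨N, hN⟩ : ∃ N, N = Q * V - V * C := ⟨_, rfl⟩
  have hVN : Vᴴ * N = 0 := by
    rw [hN, Matrix.mul_sub, ← Matrix.mul_assoc, ← Matrix.mul_assoc, hVQ, hV, Matrix.one_mul,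
      sub_self]
  have hNN : Nᴴ * N = Matrix.diagonal (fun i => ((c i * (1 - c i) : ℝ) : ℂ)) := by
    have h1 : Nᴴ * N = Vᴴ * Q * N := by
      conv_lhs => enter [1]; rw [hN]
      rw [Matrix.conjTranspose_sub, Matrix.sub_mul, Matrix.conjTranspose_mul V C,
        Matrix.mul_assoc _ Vᴴ, hVN, Matrix.mul_zero, sub_zero, Matrix.conjTranspose_mul, hQ.1.eq]
    rw [h1, hN, Matrix.mul_sub, ← Matrix.mul_assoc (Vᴴ * Q), ← Matrix.mul_assoc (Vᴴ * Q),
      Matrix.mul_assoc Vᴴ Q Q, hQ.2, hVQ, hC, Matrix.diagonal_mul_diagonal, Matrix.diagonal_sub]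
    congr 1; ext i; push_cast; ring
  obtain ⟨F, hF⟩ : ∃ F, F = N * Matrix.diagonal (fun i => (((√(c i * (1 - c i)))⁻¹ : ℝ) : ℂ)) :=
    ⟨_, rfl⟩
  have hVF : Vᴴ * F = 0 := by rw [hF, ← Matrix.mul_assoc, hVN, Matrix.zero_mul]
  have hFF : Fᴴ * F = Matrix.diagonal (fun i => if c i = 0 ∨ c i = 1 then 0 else 1) := by
    rw [hF, Matrix.conjTranspose_mul, Matrix.mul_assoc, ← Matrix.mul_assoc Nᴴ, hNN,
      Matrix.diagonal_conjTranspose, Matrix.diagonal_mul_diagonal, Matrix.diagonal_mul_diagonal]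
    congr 1; ext i
    simp only [Pi.star_apply, RCLike.star_def, Complex.conj_ofReal]
    split_ifs with h
    · rcases h with h | h <;> simp [h]
    · push Not at h
      have hne : c i * (1 - c i) ≠ 0 := mul_ne_zero h.1 (sub_ne_zero.2 h.2.symm)
      have := Real.mul_self_sqrt (hs0 i)
      have h2 : √(c i * (1 - c i)) ≠ 0 := fun h0 => hne (by rw [← this, h0, zero_mul])
      norm_cast
      nth_rw 2 [← this]
      field_simp
  have hNF : N = F * Matrix.diagonal (fun i => (√(c i * (1 - c i)) : ℂ)) := by
    ext a i
    rw [hF, Matrix.mul_assoc, Matrix.diagonal_mul_diagonal, Matrix.mul_diagonal]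
    by_cases h : c i * (1 - c i) = 0
    · have : N a i = 0 := col_eq_zero (by rw [hNN, Matrix.diagonal_apply_eq, h,
        Complex.ofReal_zero]) a
      rw [this, zero_mul]
    · have : (√(c i * (1 - c i)) : ℂ) ≠ 0 := by
        exact_mod_cast fun h0 => h ((Real.sqrt_eq_zero (hs0 i)).1 h0)
      rw [Complex.ofReal_inv, inv_mul_cancel₀ this, mul_one]
  have hF0 : ∀ i, c i = 0 ∨ c i = 1 → ∀ a, F a i = 0 := fun i hi a =>
    col_eq_zero (by rw [hFF]; simp [hi]) a
  obtain ⟨U, hU⟩ : ∃ U, U = V * Matrix.diagonal (fun i => (√(c i) : ℂ))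
          + F * Matrix.diagonal (fun i => (√(1 - c i) : ℂ)) := ⟨_, rfl⟩
  have hUQ : U * Matrix.diagonal (fun i => (√(c i) : ℂ)) = Q * V := by
    have hQV : Q * V = V * C + N := by rw [hN]; abel
    rw [hU, Matrix.add_mul, Matrix.mul_assoc, Matrix.mul_assoc, Matrix.diagonal_mul_diagonal,
      Matrix.diagonal_mul_diagonal, hQV, hNF]
    congr 3
    · ext i; rw [← Complex.ofReal_mul, Real.mul_self_sqrt (hc i).1]
    · ext i; rw [← Complex.ofReal_mul, mul_comm, Real.sqrt_mul (hc i).1]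
  have hU0 : ∀ i, c i = 0 → ∀ a, U a i = 0 := fun i hi a => by
    rw [hU]; simp [hi, hF0 i (Or.inl hi) a]
  have hUV : U = Q * V * Matrix.diagonal (fun i => (((√(c i))⁻¹ : ℝ) : ℂ)) := by
    ext a i
    rw [← hUQ, Matrix.mul_assoc, Matrix.diagonal_mul_diagonal, Matrix.mul_diagonal]
    by_cases h : c i = 0
    · rw [hU0 i h, zero_mul]
    · have : (√(c i) : ℂ) ≠ 0 := by
        exact_mod_cast fun h0 => h ((Real.sqrt_eq_zero (hc i).1).1 h0)
      rw [Complex.ofReal_inv, mul_inv_cancel₀ this, mul_one]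
  have hQU : Q * U = U := by
    rw [hUV, ← Matrix.mul_assoc, ← Matrix.mul_assoc, hQ.2]
  have hUHQ : Uᴴ * Q = Uᴴ := by
    rw [← hQ.1.eq, ← Matrix.conjTranspose_mul, hQU]
  have hFV : Fᴴ * V = 0 := by
    simpa using congrArg Matrix.conjTranspose hVF
  have hVU : Vᴴ * U = Matrix.diagonal (fun i => (√(c i) : ℂ)) := by
    rw [hU, Matrix.mul_add, ← Matrix.mul_assoc, ← Matrix.mul_assoc, hV, hVF, Matrix.one_mul,
      Matrix.zero_mul, add_zero]
  have hUU : Uᴴ * U = Matrix.diagonal (fun i => if c i = 0 then 0 else 1) := by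
    conv_lhs => enter [2]; rw [hUV]
    rw [← Matrix.mul_assoc, ← Matrix.mul_assoc, hUHQ]
    have : Uᴴ * V = Matrix.diagonal (fun i => (√(c i) : ℂ)) := by
      have := congrArg Matrix.conjTranspose hVU
      rw [Matrix.conjTranspose_mul, Matrix.conjTranspose_conjTranspose] at this
      rw [this, Matrix.diagonal_conjTranspose]
      congr 1; ext i; simp
    rw [this, Matrix.diagonal_mul_diagonal]
    congr 1; ext i
    split_ifs with h
    · simp [h]
    · have : (√(c i) : ℂ) ≠ 0 := by
        exact_mod_cast fun h0 => h ((Real.sqrt_eq_zero (hc i).1).1 h0)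
      rw [Complex.ofReal_inv, mul_inv_cancel₀ this]
  have hUUU : U * (Uᴴ * U) = U := by
    ext a i
    rw [hUU, Matrix.mul_diagonal]
    split_ifs with h
    · rw [hU0 i h, zero_mul]
    · rw [mul_one]
  have hFFF : F * (Fᴴ * F) = F := by
    ext a i
    rw [hFF, Matrix.mul_diagonal]
    split_ifs with h
    · rw [hF0 i h, zero_mul]
    · rw [mul_one]
  obtain ⟨G, hG⟩ : ∃ G, G = Q - U * Uᴴ := ⟨_, rfl⟩
  have hGQ : G * Q = G := by rw [hG, Matrix.sub_mul, hQ.2, Matrix.mul_assoc, hUHQ]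
  have hGU : G * U = 0 := by
    rw [hG, Matrix.sub_mul, hQU, Matrix.mul_assoc, hUUU, sub_self]
  have hGp : IsProjn G := by
    refine ⟨?_, ?_⟩
    · rw [hG]; exact hQ.1.sub (Matrix.isHermitian_mul_conjTranspose_self U)
    · conv_lhs => enter [2]; rw [hG]
      rw [Matrix.mul_sub, hGQ, ← Matrix.mul_assoc, hGU, Matrix.zero_mul, sub_zero]
  have hGV : G * V = 0 := by
    rw [← hGQ, Matrix.mul_assoc, ← hUQ, ← Matrix.mul_assoc, hGU, Matrix.zero_mul]
  have hGF : G * F = 0 := by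
    rw [hF, ← Matrix.mul_assoc, hN, Matrix.mul_sub, ← Matrix.mul_assoc, ← Matrix.mul_assoc, hGQ,
      hGV]
    simp
  have hVG : Vᴴ * G = 0 := by
    have := congrArg Matrix.conjTranspose hGV
    rwa [Matrix.conjTranspose_mul, hGp.1.eq, Matrix.conjTranspose_zero] at this
  have hFG : Fᴴ * G = 0 := by
    have := congrArg Matrix.conjTranspose hGF
    rwa [Matrix.conjTranspose_mul, hGp.1.eq, Matrix.conjTranspose_zero] at this
  have hK : IsProjn (V * Vᴴ + F * Fᴴ + G) := by
    refine ⟨((Matrix.isHermitian_mul_conjTranspose_self V).add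
      (Matrix.isHermitian_mul_conjTranspose_self F)).add hGp.1, ?_⟩
    have e1 : V * Vᴴ * (V * Vᴴ + F * Fᴴ + G) = V * Vᴴ := by
      simp only [Matrix.mul_add, Matrix.mul_assoc, hVG, ← Matrix.mul_assoc Vᴴ V,
        ← Matrix.mul_assoc Vᴴ F, hV, hVF]
      simp
    have e2 : F * Fᴴ * (V * Vᴴ + F * Fᴴ + G) = F * Fᴴ := by
      rw [Matrix.mul_add, Matrix.mul_add, Matrix.mul_assoc F Fᴴ G, hFG, Matrix.mul_assoc F Fᴴ,
        ← Matrix.mul_assoc Fᴴ V, hFV, ← Matrix.mul_assoc (F * Fᴴ), Matrix.mul_assoc F Fᴴ F, hFFF]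
      simp
    have e3 : G * (V * Vᴴ + F * Fᴴ + G) = G := by
      simp only [Matrix.mul_add, ← Matrix.mul_assoc, hGV, hGF, hGp.2]
      simp
    rw [Matrix.add_mul, Matrix.add_mul, e1, e2, e3]
  refine ⟨V, F, c, G, 1 - (V * Vᴴ + F * Fᴴ + G), hc, hV, hVP, hVQ, hVF, hFF, hGp, hK.one_sub,
    ?_, ?_⟩
  · rw [← hU, hG]; abel
  · abel

theorem re_trace_eq {n : ℕ} (A : Matrix (Fin n) (Fin n) ℂ) : A.trace.re = ∑ i, (A i i).re := by
  simp [Matrix.trace]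

theorem trace_mul_self_conjTranspose {d n : ℕ} (A : Matrix (Fin d) (Fin n) ℂ)
    (R : Matrix (Fin d) (Fin d) ℂ) : (A * Aᴴ * R).trace = (Aᴴ * R * A).trace := by
  rw [Matrix.mul_assoc, Matrix.trace_mul_comm]

/-- The overlaps of three projections decompose along the principal vectors of the first two. -/
theorem exists_blockSum {n k k' d : ℕ} {P Q R : Matrix (Fin d) (Fin d) ℂ} (hP : IsProjn P)
    (hQ : IsProjn Q) (hR : IsProjn R) (hPn : P.rank = n) (hQn : Q.rank = n + k)
    (hRn : R.rank = n + k') (hd : 2 * n + k ≤ d) :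
    ∃ D q r : ℝ, BlockSum n D (P * Q).trace.re (P * R).trace.re ((Q * R).trace.re - q) ∧
      0 ≤ q ∧ q ≤ k ∧ 0 ≤ r ∧ r ≤ d - 2 * n - k ∧ D = q + r - k' := by
  have hd' : 2 * (n : ℝ) + k ≤ d := by exact_mod_cast hd
  obtain ⟨V, F, c, G, H, hc, hV, hVP, hVQ, hVF, hFF, hG, hH, hQG, hone⟩ := hP.exists_frame hPn hQ
  obtain ⟨g, hg0, hg1, hg⟩ := exists_mul_eq (hR.trace_mul_nonneg hG) (hR.trace_mul_le hG)
  obtain ⟨h, hh0, hh1, hh⟩ := exists_mul_eq (hR.trace_mul_nonneg hH) (hR.trace_mul_le hH)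
  obtain ⟨U, hU⟩ : ∃ U, U = V * Matrix.diagonal (fun i => (√(c i) : ℂ))
          + F * Matrix.diagonal (fun i => (√(1 - c i) : ℂ)) := ⟨_, rfl⟩
  rw [← hU] at hQG
  have hUM : ∀ (M : Matrix (Fin d) (Fin d) ℂ), M.IsHermitian → ∀ i, ((Uᴴ * M * U) i i).re =
      c i * ((Vᴴ * M * V) i i).re + (1 - c i) * ((Fᴴ * M * F) i i).re
        + 2 * (√(c i) * √(1 - c i)) * ((Vᴴ * M * F) i i).re := fun M hM i => by
    have hsymm : ((Fᴴ * M * V) i i).re = ((Vᴴ * M * F) i i).re := by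
      have : Fᴴ * M * V = (Vᴴ * M * F)ᴴ := by
        simp [Matrix.conjTranspose_mul, hM.eq, Matrix.mul_assoc]
      rw [this]; simp
    have e : Uᴴ * M * U =
        Matrix.diagonal (fun i => (√(c i) : ℂ)) * (Vᴴ * M * V)
          * Matrix.diagonal (fun i => (√(c i) : ℂ))
        + Matrix.diagonal (fun i => (√(1 - c i) : ℂ)) * (Fᴴ * M * V)
          * Matrix.diagonal (fun i => (√(c i) : ℂ))
        + (Matrix.diagonal (fun i => (√(c i) : ℂ)) * (Vᴴ * M * F)
          * Matrix.diagonal (fun i => (√(1 - c i) : ℂ))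
        + Matrix.diagonal (fun i => (√(1 - c i) : ℂ)) * (Fᴴ * M * F)
          * Matrix.diagonal (fun i => (√(1 - c i) : ℂ))) := by
      have e1 : ∀ f : Fin n → ℝ, (Matrix.diagonal (fun i => (f i : ℂ)))ᴴ
          = Matrix.diagonal (fun i => (f i : ℂ)) := fun f => by
        rw [Matrix.diagonal_conjTranspose]; congr 1; ext i; simp
      rw [hU, Matrix.conjTranspose_add, Matrix.conjTranspose_mul, Matrix.conjTranspose_mul,
        e1 (fun i => √(c i)), e1 (fun i => √(1 - c i))]
      simp only [Matrix.add_mul, Matrix.mul_add, Matrix.mul_assoc]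
    rw [e]
    simp only [Matrix.add_apply, Matrix.mul_diagonal, Matrix.diagonal_mul, Complex.add_re,
      Complex.re_mul_ofReal, Complex.re_ofReal_mul, hsymm]
    linear_combination ((Vᴴ * M * V) i i).re * Real.mul_self_sqrt (hc i).1
      + ((Fᴴ * M * F) i i).re * Real.mul_self_sqrt (sub_nonneg.2 (hc i).2)
  have hF0 : ∀ i, c i = 0 ∨ c i = 1 → ∀ a, F a i = 0 := fun i hi a =>
    col_eq_zero (by rw [hFF]; simp [hi]) a
  have hFR0 : ∀ i, c i = 0 ∨ c i = 1 → ∀ (A : Matrix (Fin d) (Fin n) ℂ), (Aᴴ * R * F) i i = 0 :=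
    fun i hi A => by
      rw [Matrix.mul_apply]
      exact Finset.sum_eq_zero fun a _ => by rw [hF0 i hi a, mul_zero]
  obtain ⟨x, hx⟩ : ∃ x : Fin n → ℝ, x = fun i => ((Vᴴ * R * V) i i).re := ⟨_, rfl⟩
  obtain ⟨y, hy⟩ : ∃ y : Fin n → ℝ, y = fun i => ((Fᴴ * R * F) i i).re := ⟨_, rfl⟩
  obtain ⟨z, hz⟩ : ∃ z : Fin n → ℝ, z = fun i => ((Vᴴ * R * F) i i).re := ⟨_, rfl⟩
  have hx01 : ∀ i, x i ∈ Set.Icc (0 : ℝ) 1 := fun i => by rw [hx]; exact hR.diag_mem_Icc hV i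
  have hxy : ∀ i, z i ^ 2 ≤ x i * y i := fun i => by
    rw [hx, hy, hz]; exact hR.posSemidef.sq_re_le V F i
  have hy0 : ∀ i, 0 ≤ y i := fun i => by
    rw [hy]
    exact (Complex.le_def.1 (hR.posSemidef.conjTranspose_mul_mul_same F).diag_nonneg).1
  have hdeg : ∀ i, c i = 0 ∨ c i = 1 → y i = 0 ∧ z i = 0 := fun i hi => by
    rw [hy, hz]
    simp only [hFR0 i hi, Complex.zero_re, and_self]
  have hFF1 : ∀ i, ¬ (c i = 0 ∨ c i = 1) → (Fᴴ * F) i i = 1 := fun i hi => by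
    rw [hFF]; simp [hi]
  have hy1 : ∀ i, ¬ (c i = 0 ∨ c i = 1) → y i ≤ 1 := fun i hi => by
    have := (Complex.le_def.1
      ((hR.one_sub.posSemidef.conjTranspose_mul_mul_same F).diag_nonneg (i := i))).1
    rw [Matrix.mul_sub, Matrix.sub_mul, Matrix.mul_one, Matrix.sub_apply, hFF1 i hi] at this
    rw [hy]
    simpa using this
  have hxy1 : ∀ i, ¬ (c i = 0 ∨ c i = 1) → z i ^ 2 ≤ (1 - x i) * (1 - y i) := fun i hi => by
    have := hR.one_sub.posSemidef.sq_re_le V F i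
    simp only [Matrix.mul_sub, Matrix.sub_mul, Matrix.mul_one, Matrix.sub_apply, hFF1 i hi, hV,
      hVF, Matrix.one_apply_eq, Complex.sub_re, Complex.one_re, Matrix.zero_apply,
      Complex.zero_re] at this
    rw [hx, hy, hz]
    linarith
  obtain ⟨w, hw⟩ : ∃ w : Fin n → ℝ, w = fun i =>
      y i + ((if c i = 0 then g else 0) + (if c i = 1 then h else 0)) := ⟨_, rfl⟩
  have hblock : ∀ i, BlockSum 1 (1 - (x i + w i)) (c i) (x i)
      (c i * x i + (1 - c i) * w i + 2 * (√(c i) * √(1 - c i)) * z i) := fun i => by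
    have he : (√(c i) * √(1 - c i)) ^ 2 = c i * (1 - c i) := by
      rw [mul_pow, Real.sq_sqrt (hc i).1, Real.sq_sqrt (sub_nonneg.2 (hc i).2)]
    by_cases hi : c i = 0 ∨ c i = 1
    · obtain ⟨h1, h2⟩ := hdeg i hi
      have hw01 : 0 ≤ w i ∧ w i ≤ 1 := by
        rw [hw]
        rcases hi with hi | hi <;> simp [hi, h1, hg0, hg1, hh0, hh1]
      refine BlockSum.of_block (hc i).1 (hc i).2 (hx01 i).1 (hx01 i).2 hw01.1 hw01.2 he ?_ ?_
      · rw [h2]; simpa using mul_nonneg (hx01 i).1 hw01.1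
      · rw [h2]
        simpa using mul_nonneg (sub_nonneg.2 (hx01 i).2) (sub_nonneg.2 hw01.2)
    · have hwi : w i = y i := by
        rw [hw]; push Not at hi; simp [hi.1, hi.2]
      rw [hwi]
      exact BlockSum.of_block (hc i).1 (hc i).2 (hx01 i).1 (hx01 i).2 (hy0 i) (hy1 i hi) he
        (hxy i) (hxy1 i hi)
  have hsum := BlockSum.sum Finset.univ hblock
  rw [Finset.card_univ, Fintype.card_fin] at hsum
  have tP : ∀ M, (P * M).trace.re = ∑ i, ((Vᴴ * M * V) i i).re := fun M => by
    rw [← hVP, trace_mul_self_conjTranspose, re_trace_eq]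
  have tQ : ∀ M, (Q * M).trace.re = ∑ i, ((Uᴴ * M * U) i i).re + (M * G).trace.re := fun M => by
    conv_lhs => rw [hQG]
    rw [Matrix.add_mul, Matrix.trace_add, Complex.add_re, trace_mul_self_conjTranspose,
      re_trace_eq, Matrix.trace_mul_comm G]
  have tone : ∀ M, M.trace.re = ∑ i, ((Vᴴ * M * V) i i).re + ∑ i, ((Fᴴ * M * F) i i).re
      + (M * G).trace.re + (M * H).trace.re := fun M => by
    conv_lhs => rw [← Matrix.one_mul M, hone]
    simp only [Matrix.add_mul, Matrix.trace_add, Complex.add_re, trace_mul_self_conjTranspose,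
      Matrix.trace_mul_comm G, Matrix.trace_mul_comm H]
    rw [re_trace_eq (Vᴴ * M * V), re_trace_eq (Fᴴ * M * F)]
  have hrank : ∀ {M : Matrix (Fin d) (Fin d) ℂ}, IsProjn M → M.trace.re = M.rank := fun hM => by
    rw [hM.trace_eq_rank, Complex.natCast_re]
  have hχ : ∑ i, ((Fᴴ * F) i i).re
      = n - ∑ i, (if c i = 0 then (1 : ℝ) else 0) - ∑ i, (if c i = 1 then (1 : ℝ) else 0) := by
    rw [eq_sub_iff_add_eq, eq_sub_iff_add_eq, ← Finset.sum_add_distrib, ← Finset.sum_add_distrib]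
    rw [Finset.sum_congr rfl (g := fun _ => (1 : ℝ)), Finset.sum_const, Finset.card_univ,
      Fintype.card_fin, nsmul_eq_mul, mul_one]
    intro i _
    rw [hFF, Matrix.diagonal_apply_eq]
    by_cases h0 : c i = 0
    · simp [h0]
    · by_cases h1 : c i = 1 <;> simp [h0, h1]
  have hGtr : G.trace.re = k + ∑ i, (if c i = 0 then (1 : ℝ) else 0) := by
    have := tQ 1
    rw [Matrix.mul_one, Matrix.one_mul, hrank hQ, hQn] at this
    have h2 : ∑ i, ((Uᴴ * (1 : Matrix (Fin d) (Fin d) ℂ) * U) i i).re = n - ∑ i, (if c i = 0 then (1 : ℝ) else 0) := by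
      rw [eq_sub_iff_add_eq, ← Finset.sum_add_distrib]
      rw [Finset.sum_congr rfl (g := fun _ => (1 : ℝ)), Finset.sum_const, Finset.card_univ,
        Fintype.card_fin, nsmul_eq_mul, mul_one]
      intro i _
      rw [hUM 1 Matrix.isHermitian_one, Matrix.mul_one, Matrix.mul_one, hV, hVF, hFF]
      simp only [Matrix.one_apply_eq, Matrix.diagonal_apply_eq, Matrix.zero_apply]
      by_cases h0 : c i = 0
      · simp [h0]
      · by_cases h1 : c i = 1 <;> simp [h0, h1]
    push_cast at this
    linarith
  have hHtr : H.trace.re = d - 2 * n - k + ∑ i, (if c i = 1 then (1 : ℝ) else 0) := by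
    have := tone 1
    rw [Matrix.one_mul, Matrix.one_mul, Matrix.mul_one, Matrix.mul_one, hV, hχ, hGtr] at this
    simp at this
    simp
    linarith
  have hwsum : ∑ i, w i = ∑ i, y i + g * ∑ i, (if c i = 0 then (1 : ℝ) else 0)
      + h * ∑ i, (if c i = 1 then (1 : ℝ) else 0) := by
    rw [hw, Finset.sum_add_distrib, Finset.sum_add_distrib, Finset.mul_sum, Finset.mul_sum]
    simp only [mul_ite, mul_one, mul_zero, add_assoc]
  refine ⟨∑ i, (1 - (x i + w i)), k * g, (d - 2 * n - k) * h, ?_, by positivity,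
    mul_le_of_le_one_right k.cast_nonneg hg1, mul_nonneg (by linarith) hh0,
    mul_le_of_le_one_right (by linarith) hh1, ?_⟩
  · convert hsum using 1
    · rw [tP, hVQ]; simp
    · rw [tP, hx]
    · rw [tQ, hg, hGtr, mul_add, Finset.mul_sum, ← add_assoc, add_sub_right_comm, mul_comm g,
        add_sub_cancel_right, ← Finset.sum_add_distrib]
      refine Finset.sum_congr rfl fun i _ => ?_
      rw [hUM R hR.1]
      simp only [hx, hw, hy, hz]
      by_cases h0 : c i = 0
      · simp [h0]
      · by_cases h1 : c i = 1 <;> simp [h0, h1]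
  · have := tone R
    rw [hrank hR, hRn, hg, hh, hGtr, hHtr] at this
    rw [Finset.sum_sub_distrib, Finset.sum_add_distrib, hwsum, hx, hy]
    push_cast at this
    simp only [Finset.sum_const, Finset.card_univ, Fintype.card_fin, nsmul_eq_mul, mul_one]
    linarith

/-- Proposition 3.15 (type III slices from above): if `k ≤ k'` and `2(n+k') ≤ d`, then
`S_d(n, n+k, n+k') ⊆ co(B₁ ∪ B₂ ∪ B₃)` where `B₁ = max(0,(6n+2k+2k'−2d)/d)·S₂(1)`,
`B₂ = (2n/d)·S₂(1) + {0}×{0}×[0, k/d]`, and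
`B₃ = max(0, 2(n+k−k')/d)·S₂(1) + {(0, min(n,k'−k)/d, (min(n,k'−k)+k)/d)}`. -/
theorem corrSet_typeIII (n k k' d : ℕ) (hn : 0 < n) (hk : 0 < k) (hk' : 0 < k')
    (hd : 0 < d) (hkk : k ≤ k') (h : 2 * (n + k') ≤ d) :
    corrSet d n (n + k) (n + k') ⊆
      convexHull ℝ
        (((max 0 ((6 * (n : ℝ) + 2 * (k : ℝ) + 2 * (k' : ℝ) - 2 * (d : ℝ)) / (d : ℝ))) •
            corrSet 2 1 1 1) ∪
          (((2 * (n : ℝ)) / (d : ℝ)) • corrSet 2 1 1 1 +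
            ({(0 : ℝ)} ×ˢ ({(0 : ℝ)} ×ˢ Set.Icc (0 : ℝ) ((k : ℝ) / (d : ℝ))))) ∪
          ((max 0 (2 * ((n : ℝ) + (k : ℝ) - (k' : ℝ)) / (d : ℝ))) • corrSet 2 1 1 1 +
            {((0 : ℝ), ((min n (k' - k) : ℕ) : ℝ) / (d : ℝ),
              (((min n (k' - k) : ℕ) : ℝ) + (k : ℝ)) / (d : ℝ))})) := by
  rintro _ ⟨P, Q, R, hP, hQ, hR, hPn, hQn, hRn, rfl⟩
  obtain ⟨D, q, r, hB, hq0, hqk, hr0, hr, hD⟩ :=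
    exists_blockSum hP hQ hR hPn hQn hRn (by omega)
  exact hB.mem_convexHull hn hd hkk h hq0 hqk hr0 hr hD
end

section
/- Let (r₁, r₂, r₃) ∈ ℝ³ with 0 ≤ r₁ ≤ r₂ ≤ r₃ ≤ 1/2. Define D₁ := 2·max(0, r₁+r₂+r₃−1)·S₂(1), D₂ := 2r₁·S₂(1) + ({0}×{0}×[0, r₂−r₁]), and D₃ := 2·max(0, r₁+r₂−r₃)·S₂(1) + {(0, min(r₁, r₃−r₂), min(r₂, r₃−r₁))}. Then the set of synchronous quantum correlation triples with marginals (r₁, r₂, r₃) is exactly the convex hull co{D₁, D₂, D₃} in ℝ³. -/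
open Matrix
open scoped Pointwise ComplexOrder

/-- `(w₁₂, w₁₃, w₂₃)` is a synchronous quantum correlation triple with marginals
`(r₁, r₂, r₃)`. -/
def SyncTriple (r₁ r₂ r₃ : ℝ) (w : ℝ × ℝ × ℝ) : Prop :=
  ∃ (d : ℕ) (_ : 0 < d) (P₁ P₂ P₃ ρ : Matrix (Fin d) (Fin d) ℂ),
    IsProjn P₁ ∧ IsProjn P₂ ∧ IsProjn P₃ ∧
    ρ.PosSemidef ∧ ρ.trace = 1 ∧
    Commute ρ P₁ ∧ Commute ρ P₂ ∧ Commute ρ P₃ ∧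
    ((ρ * P₁).trace).re = r₁ ∧ ((ρ * P₂).trace).re = r₂ ∧ ((ρ * P₃).trace).re = r₃ ∧
    w = (((ρ * (P₁ * P₂)).trace).re, ((ρ * (P₁ * P₃)).trace).re,
         ((ρ * (P₂ * P₃)).trace).re)

namespace SyncSlice

/-- The real part of the expectation of `A` in the state with density matrix `ρ`. -/
noncomputable def expect {d : ℕ} (ρ A : Matrix (Fin d) (Fin d) ℂ) : ℝ := ((ρ * A).trace).re

section expect

variable {d : ℕ} {ρ A B C P Q : Matrix (Fin d) (Fin d) ℂ}

lemma expect_add : expect ρ (A + B) = expect ρ A + expect ρ B := by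
  simp [expect, mul_add]

lemma expect_sub : expect ρ (A - B) = expect ρ A - expect ρ B := by
  simp [expect, mul_sub]

lemma expect_neg : expect ρ (-A) = -expect ρ A := by
  simp [expect]

lemma expect_smul (c : ℝ) : expect ρ (c • A) = c * expect ρ A := by
  simp [expect]

lemma expect_comm (h : Commute ρ A) : expect ρ (A * B) = expect ρ (B * A) := by
  rw [expect, expect, ← mul_assoc, h.eq, mul_assoc, trace_mul_comm, mul_assoc]

lemma trace_mul_re_nonneg (hA : A.PosSemidef) (hB : B.PosSemidef) : 0 ≤ ((A * B).trace).re := by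
  obtain ⟨S, rfl⟩ : ∃ S : Matrix (Fin d) (Fin d) ℂ, A = Sᴴ * S := by
    open scoped MatrixOrder in
    exact CStarAlgebra.nonneg_iff_eq_star_mul_self.mp hA.nonneg
  rw [mul_assoc, trace_mul_comm]
  exact (Complex.le_def.mp (hB.mul_mul_conjTranspose_same S).trace_nonneg).1

lemma posSemidef_mul_of_commute (hρ : ρ.PosSemidef) (hP : IsProjn P) (h : Commute ρ P) :
    (ρ * P).PosSemidef := by
  have := hρ.conjTranspose_mul_mul_same P
  rwa [hP.1.eq, ← h.eq, mul_assoc, hP.2] at this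

lemma expect_mul_nonneg (hρ : ρ.PosSemidef) (hP : IsProjn P) (h : Commute ρ P)
    (hA : A.PosSemidef) : 0 ≤ expect ρ (P * A) := by
  rw [expect, ← mul_assoc]
  exact trace_mul_re_nonneg (posSemidef_mul_of_commute hρ hP h) hA

lemma posSemidef_of_isProjn (hP : IsProjn P) : P.PosSemidef := by
  have := posSemidef_conjTranspose_mul_self P
  rwa [hP.1.eq, hP.2] at this

lemma isProjn_one_sub (hP : IsProjn P) : IsProjn (1 - P) := by
  refine ⟨isHermitian_one.sub hP.1, ?_⟩
  simp [mul_sub, sub_mul, hP.2]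

end expect

section spectral

variable {d : ℕ} {Z : Matrix (Fin d) (Fin d) ℂ}

lemma aeval_posSemidef_iff (hZ : Z.IsHermitian) (p : Polynomial ℝ) :
    (Polynomial.aeval Z p).PosSemidef ↔ ∀ i, 0 ≤ p.eval (hZ.eigenvalues i) := by
  have key : Polynomial.aeval Z p = Unitary.conjStarAlgAut ℂ _ hZ.eigenvectorUnitary
      (diagonal (fun i => ((p.eval (hZ.eigenvalues i) : ℝ) : ℂ))) := by
    have h1 := hZ.spectral_theorem
    have h2 : Polynomial.aeval (diagonal (RCLike.ofReal ∘ hZ.eigenvalues) :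
        Matrix (Fin d) (Fin d) ℂ) p =
        diagonal (fun i => ((p.eval (hZ.eigenvalues i) : ℝ) : ℂ)) := by
      have h3 := Polynomial.aeval_algHom_apply (Matrix.diagonalAlgHom (n := Fin d) (α := ℂ) ℝ)
        (fun i => (hZ.eigenvalues i : ℂ)) p
      have h4 : (Polynomial.aeval (fun i => (hZ.eigenvalues i : ℂ)) p : Fin d → ℂ) =
          fun i => ((p.eval (hZ.eigenvalues i) : ℝ) : ℂ) := by
        ext i
        have := Polynomial.aeval_algHom_apply (Pi.evalAlgHom ℝ (fun _ : Fin d => ℂ) i)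
          (fun i => (hZ.eigenvalues i : ℂ)) p
        simp only [Pi.evalAlgHom_apply] at this
        rw [← this]
        simpa using Polynomial.aeval_algebraMap_apply ℂ (hZ.eigenvalues i) p
      rw [h4] at h3
      exact h3
    conv_lhs => rw [h1]
    rw [← h2]
    exact Polynomial.aeval_algHom_apply
      ((Unitary.conjStarAlgAut ℂ _ hZ.eigenvectorUnitary).toAlgEquiv.toAlgHom.restrictScalars ℝ)
      _ p
  rw [key]
  simp [Unitary.isUnit_coe.posSemidef_star_right_conjugate_iff, posSemidef_diagonal_iff]

end spectral

section rank

lemma trace_eq_rank_of_isProjn {d : ℕ} {P : Matrix (Fin d) (Fin d) ℂ} (hP : IsProjn P) :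
    P.trace = P.rank := by
  have hid : IsIdempotentElem (toLin' P) := by
    rw [IsIdempotentElem, Module.End.mul_eq_comp, ← Matrix.toLin'_mul, hP.2]
  rw [← Matrix.trace_toLin'_eq, (LinearMap.IsIdempotentElem.isProj_range _ hid).trace]
  rfl

end rank

/-- The convex hull of a compact set in a finite-dimensional space is compact. -/
lemma isCompact_convexHull_of_isCompact {E : Type*} [NormedAddCommGroup E] [NormedSpace ℝ E]
    [FiniteDimensional ℝ E] {K : Set E} (hK : IsCompact K) : IsCompact (convexHull ℝ K) := by
  have h : convexHull ℝ K = ⋃ n ∈ Set.Iic (Module.finrank ℝ E + 1),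
      (fun x : (Fin n → ℝ) × (Fin n → E) => ∑ i, x.1 i • x.2 i) ''
        (stdSimplex ℝ (Fin n) ×ˢ Set.univ.pi fun _ => K) := by
    ext x
    simp only [Set.mem_iUnion, Set.mem_image, Set.mem_prod, Prod.exists, exists_prop]
    constructor
    · intro hx
      obtain ⟨ι, _, z, w, hz, hi, hw, hw1, rfl⟩ := eq_pos_convex_span_of_mem_convexHull hx
      refine ⟨Fintype.card ι, hi.card_le_finrank_succ.trans ?_, ?_⟩
      · exact Nat.succ_le_succ (Submodule.finrank_le _)
      · let e := Fintype.equivFin ι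
        refine ⟨w ∘ e.symm, z ∘ e.symm, ⟨⟨fun i => (hw _).le, ?_⟩, fun i _ => hz ⟨_, rfl⟩⟩, ?_⟩
        · rw [← hw1]; exact e.symm.sum_comp w
        · exact e.symm.sum_comp fun i => w i • z i
    · rintro ⟨n, -, w, z, ⟨hw, hz⟩, rfl⟩
      exact (convex_convexHull ℝ K).sum_mem (fun i _ => hw.1 i) hw.2
        fun i _ => subset_convexHull ℝ K (hz i trivial)
  rw [h]
  refine (Set.finite_Iic _).isCompact_biUnion fun n _ => ?_
  refine ((isCompact_stdSimplex ℝ (Fin n)).prod (isCompact_univ_pi fun _ => hK)).image ?_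
  fun_prop

section anticommuting

variable {d : ℕ} {ρ U V : Matrix (Fin d) (Fin d) ℂ}

lemma commute_sq_of_anticommute (hUV : U * V = -(V * U)) : Commute U (V ^ 2) := by
  rw [Commute, SemiconjBy, sq, ← mul_assoc, hUV, neg_mul, mul_assoc, hUV, mul_neg, neg_neg,
    mul_assoc]

lemma expect_odd_pow (hU : Commute ρ U) (hUV : U * V = -(V * U)) (hsq : U ^ 2 + V ^ 2 = 1)
    (n : ℕ) : expect ρ (V * (V ^ 2) ^ n) = expect ρ V := by
  induction n with
  | zero => simp
  | succ n ih =>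
    have hc := commute_sq_of_anticommute hUV
    have h1 : expect ρ (U * (V * (V ^ 2) ^ n * U)) = expect ρ (V * (V ^ 2) ^ n * U * U) :=
      expect_comm hU
    have h2 : U * (V * (V ^ 2) ^ n * U) = -(V * (V ^ 2) ^ n * U * U) := by
      rw [mul_assoc V, ← (hc.pow_right n).eq, ← mul_assoc U V, hUV, (hc.pow_right n).eq]
      rw [neg_mul, mul_assoc V U, ← mul_assoc U ((V ^ 2) ^ n), (hc.pow_right n).eq]
      simp only [mul_assoc]
    have h3 : V * (V ^ 2) ^ n * U * U = V * (V ^ 2) ^ n - V * (V ^ 2) ^ (n + 1) := by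
      rw [mul_assoc _ U U, ← sq, eq_sub_of_add_eq hsq, mul_sub, mul_one, mul_assoc, ← pow_succ]
    rw [h2, expect_neg, h3, expect_sub, ih] at h1
    linarith

lemma expect_mul_pow_eq_zero (hV : Commute ρ V) (hUV : U * V = -(V * U)) (n : ℕ) :
    expect ρ (V ^ 2 * U * (V ^ 2) ^ n) = 0 := by
  have hc := commute_sq_of_anticommute hUV
  have h1 : expect ρ (V * (V * U * (V ^ 2) ^ n)) = expect ρ (V * U * (V ^ 2) ^ n * V) :=
    expect_comm hV
  have h2 : V * U * (V ^ 2) ^ n * V = -(V * (V * U * (V ^ 2) ^ n)) := by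
    have : Commute V ((V ^ 2) ^ n) := ((Commute.refl V).pow_right 2).pow_right n
    rw [mul_assoc _ _ V, ← this.eq, mul_assoc V U, ← mul_assoc U V, hUV]
    simp only [mul_assoc, neg_mul, mul_neg]
  have h3 : V * (V * U * (V ^ 2) ^ n) = V ^ 2 * U * (V ^ 2) ^ n := by
    simp only [sq, mul_assoc]
  rw [h2, expect_neg, h3] at h1
  linarith

lemma expect_aeval_sq (hU : Commute ρ U) (hV : Commute ρ V) (hUV : U * V = -(V * U))
    (hsq : U ^ 2 + V ^ 2 = 1) (m δ : ℝ) (p : Polynomial ℝ) :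
    expect ρ (V ^ 2 * (m • V + δ • U) * Polynomial.aeval (V ^ 2) p) =
      m * p.eval 1 * expect ρ V := by
  induction p using Polynomial.induction_on' with
  | add p q hp hq =>
    rw [map_add, mul_add, expect_add, hp, hq, Polynomial.eval_add]
    ring
  | monomial n a =>
    have h1 := expect_odd_pow hU hUV hsq (n + 1)
    have h2 := expect_mul_pow_eq_zero hV hUV n
    have h3 : V ^ 2 * (m • V + δ • U) * Polynomial.aeval (V ^ 2) (Polynomial.monomial n a) =
        (a * m) • (V * (V ^ 2) ^ (n + 1)) + (a * δ) • (V ^ 2 * U * (V ^ 2) ^ n) := by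
      rw [Polynomial.aeval_monomial, mul_add, add_mul, Algebra.algebraMap_eq_smul_one]
      simp only [mul_smul_comm, smul_mul_assoc, one_mul, smul_smul]
      congr 2
      rw [pow_succ' (V ^ 2) n, ← mul_assoc, ((Commute.refl V).pow_right 2).eq]
    rw [h3, expect_add, expect_smul, expect_smul, h1, h2, Polynomial.eval_monomial, one_pow]
    ring

end anticommuting

section projections

variable {d : ℕ} {ρ P Q R : Matrix (Fin d) (Fin d) ℂ}

/-- A trace inequality for three projections: a bound of an affine function by the function
`F z = (z² - δ²) (1 + sgn z · φ |z|) / 2` on the possible spectrum of `b P + c Q - (b + c) / 2`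
gives a bound of expectations. -/
lemma expect_le_of_forall_le (hρ : ρ.PosSemidef) (hR : IsProjn R) (hP : IsProjn P)
    (hQ : IsProjn Q) (hρR : Commute ρ R) (hρP : Commute ρ P) (hρQ : Commute ρ Q)
    {b c : ℝ} (hb : 0 < b) (hc : 0 < c) (φ : ℝ → ℝ) (w₀ w₁ : ℝ)
    (h : ∀ z : ℝ, ((b - c) / 2) ^ 2 ≤ z ^ 2 → z ^ 2 ≤ ((b + c) / 2) ^ 2 →
      0 ≤ (z ^ 2 - ((b - c) / 2) ^ 2) / 2 * (1 + z * (φ |z| / |z|)) ∧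
      w₀ + w₁ * z ≤ (z ^ 2 - ((b - c) / 2) ^ 2) / 2 * (1 + z * (φ |z| / |z|))) :
    w₀ * expect ρ R + w₁ * (b * expect ρ (R * P) + c * expect ρ (R * Q)
        - (b + c) / 2 * expect ρ R) ≤
      b * c / 2 * (2 * expect ρ (P * Q) +
        (φ ((b + c) / 2) - 1) * (expect ρ P + expect ρ Q - expect ρ 1)) := by
  obtain ⟨m, hm⟩ : ∃ m, m = (b + c) / 2 := ⟨_, rfl⟩
  obtain ⟨δ, hδ⟩ : ∃ δ, δ = (b - c) / 2 := ⟨_, rfl⟩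
  obtain ⟨k, hk⟩ : ∃ k, k = b * c := ⟨_, rfl⟩
  have hmpos : 0 < m := by rw [hm]; positivity
  have hkpos : 0 < k := by rw [hk]; positivity
  have hmk : m ^ 2 = δ ^ 2 + k := by rw [hm, hδ, hk]; ring
  rw [← hm, ← hk]
  simp only [← hm, ← hδ] at h
  obtain ⟨V, hV⟩ : ∃ V, V = P + Q - 1 := ⟨_, rfl⟩
  obtain ⟨U, hU⟩ : ∃ U, U = P - Q := ⟨_, rfl⟩
  have hρU : Commute ρ U := by rw [hU]; exact hρP.sub_right hρQ
  have hρV : Commute ρ V := by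
    rw [hV]; exact (hρP.add_right hρQ).sub_right (Commute.one_right ρ)
  have hUV : U * V = -(V * U) := by
    rw [hU, hV]
    simp only [mul_sub, mul_add, sub_mul, add_mul, hP.2, hQ.2, mul_one, one_mul]
    abel
  have hVV : V ^ 2 = P * Q + Q * P - V := by
    rw [hV, sq]
    simp only [mul_sub, mul_add, sub_mul, add_mul, hP.2, hQ.2, mul_one, one_mul]
    abel
  have hsq : U ^ 2 + V ^ 2 = 1 := by
    rw [hVV, hU, hV, sq]
    simp only [mul_sub, sub_mul, hP.2, hQ.2]
    abel
  have hVherm : V.IsHermitian := by rw [hV]; exact (hP.1.add hQ.1).sub isHermitian_one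
  have hUherm : U.IsHermitian := by rw [hU]; exact hP.1.sub hQ.1
  obtain ⟨Z, hZ⟩ : ∃ Z, Z = m • V + δ • U := ⟨_, rfl⟩
  have hZherm : Z.IsHermitian := by
    have e (r : ℝ) (A : Matrix (Fin d) (Fin d) ℂ) (hA : A.IsHermitian) : (r • A).IsHermitian := by
      rw [IsHermitian, conjTranspose_smul, hA.eq]; simp
    rw [hZ]; exact (e _ _ hVherm).add (e _ _ hUherm)
  have hZPQ : Z = b • P + c • Q - m • (1 : Matrix (Fin d) (Fin d) ℂ) := by
    rw [hZ, hV, hU, hm, hδ]; module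
  have hZ2 : Z ^ 2 = (δ ^ 2) • (1 : Matrix (Fin d) (Fin d) ℂ) + k • V ^ 2 := by
    have : Z ^ 2 = m ^ 2 • V ^ 2 + δ ^ 2 • U ^ 2 := by
      rw [hZ, sq, sq V, sq U]
      simp only [mul_add, add_mul, smul_mul_smul_comm, hUV]
      module
    rw [this, eq_sub_of_add_eq hsq, hmk]
    module
  let q : Polynomial ℝ := Polynomial.C k⁻¹ * (Polynomial.X ^ 2 - Polynomial.C (δ ^ 2))
  have hq : Polynomial.aeval Z q = V ^ 2 := by
    simp only [q, map_mul, map_sub, map_pow, Polynomial.aeval_C, Polynomial.aeval_X, hZ2,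
      Algebra.algebraMap_eq_smul_one, smul_one_mul, smul_pow, one_pow, add_sub_cancel_left,
      smul_smul, inv_mul_cancel₀ hkpos.ne', one_smul]
  have hspec (i : Fin d) : δ ^ 2 ≤ hZherm.eigenvalues i ^ 2 ∧ hZherm.eigenvalues i ^ 2 ≤ m ^ 2 := by
    have h1 := (aeval_posSemidef_iff hZherm q).1 (by
      rw [hq, sq]; nth_rw 1 [← hVherm.eq]; exact posSemidef_conjTranspose_mul_self V) i
    have h2 := (aeval_posSemidef_iff hZherm (1 - q)).1 (by
      rw [map_sub, map_one, hq, ← eq_sub_of_add_eq hsq, sq]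
      nth_rw 1 [← hUherm.eq]; exact posSemidef_conjTranspose_mul_self U) i
    simp only [q, Polynomial.eval_mul, Polynomial.eval_sub, Polynomial.eval_C, Polynomial.eval_pow,
      Polynomial.eval_X, Polynomial.eval_one, sub_nonneg, inv_mul_le_iff₀ hkpos] at h1 h2
    have h3 := nonneg_of_mul_nonneg_right h1 (inv_pos.2 hkpos)
    exact ⟨by linarith, by linarith⟩
  let f : ℝ → ℝ := fun x => φ (√(δ ^ 2 + k * x)) / √(δ ^ 2 + k * x)
  let nodes : Finset ℝ :=
    insert 1 (Finset.univ.image fun i => k⁻¹ * (hZherm.eigenvalues i ^ 2 - δ ^ 2))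
  let o : Polynomial ℝ := Lagrange.interpolate nodes id f
  have ho : ∀ x ∈ nodes, o.eval x = f x := fun x hx =>
    Lagrange.eval_interpolate_at_node f Function.injective_id.injOn hx
  have ho1 : m * o.eval 1 = φ m := by
    rw [ho 1 (Finset.mem_insert_self _ _)]
    simp only [f, mul_one, ← hmk, Real.sqrt_sq hmpos.le]
    field_simp
  let pM : Polynomial ℝ := Polynomial.C (k / 2) * (q + q * Polynomial.X * o.comp q)
  have hpM : Polynomial.aeval Z pM =
      (k / 2) • (V ^ 2 + V ^ 2 * (m • V + δ • U) * Polynomial.aeval (V ^ 2) o) := by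
    simp only [pM, map_mul, map_add, Polynomial.aeval_C, Polynomial.aeval_X,
      Polynomial.aeval_comp, hq, Algebra.algebraMap_eq_smul_one, ← hZ]
    rw [smul_one_mul]
  have hpMeval (i : Fin d) : pM.eval (hZherm.eigenvalues i) =
      (hZherm.eigenvalues i ^ 2 - δ ^ 2) / 2 *
        (1 + hZherm.eigenvalues i * (φ |hZherm.eigenvalues i| / |hZherm.eigenvalues i|)) := by
    have h1 : o.eval (k⁻¹ * (hZherm.eigenvalues i ^ 2 - δ ^ 2)) =
        φ |hZherm.eigenvalues i| / |hZherm.eigenvalues i| := by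
      rw [ho _ (Finset.mem_insert_of_mem (Finset.mem_image_of_mem _ (Finset.mem_univ i)))]
      simp only [f, mul_inv_cancel_left₀ hkpos.ne', add_sub_cancel, Real.sqrt_sq_eq_abs]
    simp only [pM, q, Polynomial.eval_mul, Polynomial.eval_add, Polynomial.eval_sub,
      Polynomial.eval_C, Polynomial.eval_pow, Polynomial.eval_X, Polynomial.eval_comp, h1]
    field_simp
  have hM : (Polynomial.aeval Z pM).PosSemidef := by
    rw [aeval_posSemidef_iff hZherm]
    intro i
    rw [hpMeval]
    exact (h _ (hspec i).1 (hspec i).2).1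
  have hMW : (Polynomial.aeval Z
      (pM - (Polynomial.C w₀ + Polynomial.C w₁ * Polynomial.X))).PosSemidef := by
    rw [aeval_posSemidef_iff hZherm]
    intro i
    simp only [Polynomial.eval_sub, Polynomial.eval_mul, Polynomial.eval_add, Polynomial.eval_C,
      Polynomial.eval_X, hpMeval]
    exact sub_nonneg.2 (h _ (hspec i).1 (hspec i).2).2
  have h1 := expect_mul_nonneg hρ hR hρR hMW
  have h2 := expect_mul_nonneg hρ (isProjn_one_sub hR) ((Commute.one_right ρ).sub_right hρR) hM
  have h3 : Polynomial.aeval Z (pM - (Polynomial.C w₀ + Polynomial.C w₁ * Polynomial.X)) =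
      Polynomial.aeval Z pM - (w₀ • (1 : Matrix (Fin d) (Fin d) ℂ) +
        w₁ • (b • P + c • Q - m • (1 : Matrix (Fin d) (Fin d) ℂ))) := by
    simp only [map_sub, map_add, map_mul, Polynomial.aeval_C, Polynomial.aeval_X,
      Algebra.algebraMap_eq_smul_one, smul_one_mul, ← hZPQ]
  have h4 : expect ρ (Polynomial.aeval Z pM) = k / 2 * (2 * expect ρ (P * Q) +
        (φ m - 1) * (expect ρ P + expect ρ Q - expect ρ 1)) := by
    rw [hpM, expect_smul, expect_add, expect_aeval_sq hρU hρV hUV hsq, ho1, hVV, expect_sub,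
      expect_add, ← expect_comm hρP, hV, expect_sub, expect_add]
    ring
  rw [h3, mul_sub, expect_sub] at h1
  rw [sub_mul, one_mul, expect_sub, h4] at h2
  simp only [mul_add, mul_sub, mul_smul_comm, mul_one, expect_add, expect_sub, expect_smul] at h1
  linarith

end projections

section inequalities

variable {r₁ r₂ r₃ x y z : ℝ}

lemma syncTriple_swap₁₂ (h : SyncTriple r₁ r₂ r₃ (x, y, z)) : SyncTriple r₂ r₁ r₃ (x, z, y) := by
  obtain ⟨d, hd, P₁, P₂, P₃, ρ, hP₁, hP₂, hP₃, hρ, htr, c₁, c₂, c₃, e₁, e₂, e₃, hw⟩ := h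
  simp only [Prod.mk.injEq] at hw
  refine ⟨d, hd, P₂, P₁, P₃, ρ, hP₂, hP₁, hP₃, hρ, htr, c₂, c₁, c₃, e₂, e₁, e₃, ?_⟩
  rw [hw.1, hw.2.1, hw.2.2]
  exact Prod.ext (expect_comm c₁) rfl

lemma syncTriple_swap₂₃ (h : SyncTriple r₁ r₂ r₃ (x, y, z)) : SyncTriple r₁ r₃ r₂ (y, x, z) := by
  obtain ⟨d, hd, P₁, P₂, P₃, ρ, hP₁, hP₂, hP₃, hρ, htr, c₁, c₂, c₃, e₁, e₂, e₃, hw⟩ := h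
  simp only [Prod.mk.injEq] at hw
  refine ⟨d, hd, P₁, P₃, P₂, ρ, hP₁, hP₃, hP₂, hρ, htr, c₁, c₃, c₂, e₁, e₃, e₂, ?_⟩
  rw [hw.1, hw.2.1, hw.2.2]
  exact Prod.ext rfl (Prod.ext rfl (expect_comm c₂))

lemma syncTriple_compl₃ (h : SyncTriple r₁ r₂ r₃ (x, y, z)) :
    SyncTriple r₁ r₂ (1 - r₃) (x, r₁ - y, r₂ - z) := by
  obtain ⟨d, hd, P₁, P₂, P₃, ρ, hP₁, hP₂, hP₃, hρ, htr, c₁, c₂, c₃, e₁, e₂, e₃, hw⟩ := h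
  simp only [Prod.mk.injEq] at hw
  refine ⟨d, hd, P₁, P₂, 1 - P₃, ρ, hP₁, hP₂, isProjn_one_sub hP₃, hρ, htr, c₁, c₂,
    (Commute.one_right ρ).sub_right c₃, e₁, e₂, ?_, ?_⟩
  · simp [mul_sub, htr, e₃]
  · simp [mul_sub, hw, e₁, e₂]

lemma syncTriple_bounds (h : SyncTriple r₁ r₂ r₃ (x, y, z)) : 0 ≤ x ∧ x ≤ r₁ := by
  obtain ⟨d, hd, P₁, P₂, P₃, ρ, hP₁, hP₂, hP₃, hρ, htr, c₁, c₂, c₃, e₁, e₂, e₃, hw⟩ := h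
  simp only [Prod.mk.injEq] at hw
  have h1 := expect_mul_nonneg hρ hP₁ c₁ (posSemidef_of_isProjn hP₂)
  have h2 := expect_mul_nonneg hρ hP₁ c₁ (posSemidef_of_isProjn (isProjn_one_sub hP₂))
  rw [mul_sub, mul_one, expect_sub] at h2
  rw [← e₁, hw.1]
  exact ⟨h1, sub_nonneg.1 h2⟩

lemma syncTriple_affine_bound (h : SyncTriple r₁ r₂ r₃ (x, y, z)) {b c : ℝ} (hb : 0 < b)
    (hc : 0 < c) (φ : ℝ → ℝ) (w₀ w₁ : ℝ)
    (hF : ∀ z : ℝ, ((b - c) / 2) ^ 2 ≤ z ^ 2 → z ^ 2 ≤ ((b + c) / 2) ^ 2 →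
      0 ≤ (z ^ 2 - ((b - c) / 2) ^ 2) / 2 * (1 + z * (φ |z| / |z|)) ∧
      w₀ + w₁ * z ≤ (z ^ 2 - ((b - c) / 2) ^ 2) / 2 * (1 + z * (φ |z| / |z|))) :
    w₀ * r₁ + w₁ * (b * x + c * y - (b + c) / 2 * r₁) ≤
      b * c / 2 * (2 * z + (φ ((b + c) / 2) - 1) * (r₂ + r₃ - 1)) := by
  obtain ⟨d, hd, P₁, P₂, P₃, ρ, hP₁, hP₂, hP₃, hρ, htr, c₁, c₂, c₃, e₁, e₂, e₃, hw⟩ := h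
  simp only [Prod.mk.injEq] at hw
  have := expect_le_of_forall_le hρ hP₁ hP₂ hP₃ c₁ c₂ c₃ hb hc φ w₀ w₁ hF
  have h1 : expect ρ 1 = 1 := by simp [expect, htr]
  rw [h1] at this
  rw [← e₁, ← e₂, ← e₃, hw.1, hw.2.1, hw.2.2]
  exact this

lemma syncTriple_upper (h : SyncTriple r₁ r₂ r₃ (x, y, z)) {a b c : ℝ} (ha : 0 ≤ a) (hb : 0 < b)
    (hc : 0 < c) :
    a * b * x + a * c * y - b * c * z ≤
      r₁ * ((a ^ 2 + b ^ 2 + c ^ 2 + 2 * a * (b + c) - 2 * b * c) / 4) := by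
  have key := syncTriple_affine_bound h hb hc (fun _ => 1) (-(a ^ 2 / 4 + ((b - c) / 2) ^ 2)) a (by
    intro t ht1 ht2
    rcases lt_trichotomy t 0 with ht | rfl | ht
    · have ht0 : t ≠ 0 := ht.ne
      have e : t * (1 / |t|) = -1 := by rw [abs_of_neg ht]; field_simp
      rw [e]
      constructor
      · simp
      · nlinarith [sq_nonneg a, sq_nonneg ((b - c) / 2), mul_nonneg ha (neg_nonneg.2 ht.le)]
    · have : ((b - c) / 2) ^ 2 = 0 := le_antisymm (by simpa using ht1) (sq_nonneg _)
      simp only [this]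
      constructor
      · simp
      · nlinarith [sq_nonneg a]
    · have e : t * (1 / |t|) = 1 := by rw [abs_of_pos ht]; field_simp
      rw [e]
      constructor
      · linarith
      · nlinarith [sq_nonneg (t - a / 2)])
  nlinarith [key]

lemma syncTriple_lower (h : SyncTriple r₁ r₂ r₃ (x, y, z)) {a b c : ℝ} (ha : 0 ≤ a) (hb : 0 < b)
    (hc : 0 < c) (hS : 0 ≤ 2 * (a * b + a * c + b * c) - (a ^ 2 + b ^ 2 + c ^ 2)) :
    (2 * (a * b + a * c + b * c) - (a ^ 2 + b ^ 2 + c ^ 2)) / 4 * (r₁ + r₂ + r₃ - 1) ≤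
      a * b * x + a * c * y + b * c * z := by
  obtain ⟨S, hSdef⟩ : ∃ S, S = (2 * (a * b + a * c + b * c) - (a ^ 2 + b ^ 2 + c ^ 2)) / 4 :=
    ⟨_, rfl⟩
  have hbc : 0 < b * c := mul_pos hb hc
  have hS0 : 0 ≤ S := by rw [hSdef]; linarith
  have hS1 : S ≤ b * c := by rw [hSdef]; nlinarith [sq_nonneg (a - b - c)]
  have key := syncTriple_affine_bound h hb hc
    (fun t => if t = (b + c) / 2 then 1 - 2 * S / (b * c) else -1)
    (-(a ^ 2 / 4 + ((b - c) / 2) ^ 2)) (-a) (by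
    intro t ht1 ht2
    have hm : ((b + c) / 2) ^ 2 - ((b - c) / 2) ^ 2 = b * c := by ring
    rcases lt_trichotomy t 0 with ht | rfl | ht
    · have ht0 : t ≠ 0 := ht.ne
      simp only [abs_of_neg ht]
      split_ifs with he
      · have e : t * ((1 - 2 * S / (b * c)) / -t) = 2 * S / (b * c) - 1 := by
          field_simp
          ring
        rw [e, ← neg_sq t, he, hm]
        have e2 : b * c / 2 * (1 + (2 * S / (b * c) - 1)) = S := by field_simp; ring
        rw [e2]
        exact ⟨hS0, by rw [show t = -((b + c) / 2) by linarith, hSdef]; apply le_of_eq; ring⟩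
      · have e : t * (-1 / -t) = 1 := by field_simp
        rw [e]
        exact ⟨by linarith, by nlinarith [sq_nonneg (t + a / 2)]⟩
    · have : ((b - c) / 2) ^ 2 = 0 := le_antisymm (by simpa using ht1) (sq_nonneg _)
      simp only [this, zero_mul]
      exact ⟨by simp, by nlinarith [sq_nonneg a]⟩
    · simp only [abs_of_pos ht]
      split_ifs with he
      · have e : t * ((1 - 2 * S / (b * c)) / t) = 1 - 2 * S / (b * c) := by
          field_simp
        rw [e, he, hm]
        have e2 : b * c / 2 * (1 + (1 - 2 * S / (b * c))) = b * c - S := by field_simp; ring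
        rw [e2]
        refine ⟨by linarith, ?_⟩
        nlinarith [sq_nonneg a, sq_nonneg b, sq_nonneg c, mul_nonneg ha hb.le, mul_nonneg ha hc.le]
      · have e : t * (-1 / t) = -1 := by field_simp
        rw [e]
        exact ⟨by simp, by nlinarith [sq_nonneg a, sq_nonneg ((b - c) / 2), mul_nonneg ha ht.le]⟩)
  simp only [if_true] at key
  have e3 : b * c / 2 * (2 * z + (1 - 2 * S / (b * c) - 1) * (r₂ + r₃ - 1)) =
      b * c * z - S * (r₂ + r₃ - 1) := by field_simp; ring
  rw [e3] at key
  rw [← hSdef]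
  have e4 : -(a ^ 2 / 4 + ((b - c) / 2) ^ 2) + a * ((b + c) / 2) = S := by rw [hSdef]; ring
  linear_combination key - r₁ * e4

end inequalities

section directSum

variable {d e : ℕ}

/-- The block-diagonal sum of two square matrices. -/
def directSum (A : Matrix (Fin d) (Fin d) ℂ) (B : Matrix (Fin e) (Fin e) ℂ) :
    Matrix (Fin (d + e)) (Fin (d + e)) ℂ :=
  (fromBlocks A 0 0 B).submatrix finSumFinEquiv.symm finSumFinEquiv.symm

variable {A A' : Matrix (Fin d) (Fin d) ℂ} {B B' : Matrix (Fin e) (Fin e) ℂ}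

lemma directSum_mul : directSum A B * directSum A' B' = directSum (A * A') (B * B') := by
  simp [directSum, submatrix_mul_equiv, fromBlocks_multiply]

lemma directSum_conjTranspose : (directSum A B)ᴴ = directSum Aᴴ Bᴴ := by
  simp [directSum, fromBlocks_conjTranspose]

lemma directSum_trace : (directSum A B).trace = A.trace + B.trace := by
  simp [directSum, trace, Fin.sum_univ_add]

lemma isProjn_directSum (hA : IsProjn A) (hB : IsProjn B) : IsProjn (directSum A B) := by
  refine ⟨?_, by rw [directSum_mul, hA.2, hB.2]⟩
  rw [IsHermitian, directSum_conjTranspose, hA.1.eq, hB.1.eq]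

lemma posSemidef_directSum (hA : A.PosSemidef) (hB : B.PosSemidef) :
    (directSum A B).PosSemidef := by
  have sqrt {n : ℕ} {M : Matrix (Fin n) (Fin n) ℂ} (hM : M.PosSemidef) :
      ∃ S : Matrix (Fin n) (Fin n) ℂ, M = Sᴴ * S := by
    open scoped MatrixOrder in
    exact CStarAlgebra.nonneg_iff_eq_star_mul_self.mp hM.nonneg
  obtain ⟨S, rfl⟩ := sqrt hA
  obtain ⟨T, rfl⟩ := sqrt hB
  rw [← directSum_mul, ← directSum_conjTranspose]
  exact posSemidef_conjTranspose_mul_self _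

lemma commute_directSum (hA : Commute A A') (hB : Commute B B') :
    Commute (directSum A B) (directSum A' B') := by
  rw [Commute, SemiconjBy, directSum_mul, directSum_mul, hA.eq, hB.eq]

end directSum

/-- The set of pairs of marginals and correlation triples is convex. -/
lemma convex_syncTriple :
    Convex ℝ {p : (ℝ × ℝ × ℝ) × (ℝ × ℝ × ℝ) | SyncTriple p.1.1 p.1.2.1 p.1.2.2 p.2} := by
  rintro ⟨⟨r₁, r₂, r₃⟩, w⟩ h ⟨⟨r₁', r₂', r₃'⟩, w'⟩ h' s t hs ht hst
  obtain ⟨d, hd, P₁, P₂, P₃, ρ, hP₁, hP₂, hP₃, hρ, htr, c₁, c₂, c₃, e₁, e₂, e₃, hw⟩ := h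
  obtain ⟨e, he, Q₁, Q₂, Q₃, σ, hQ₁, hQ₂, hQ₃, hσ, htr', c₁', c₂', c₃', e₁', e₂', e₃', hw'⟩ := h'
  refine ⟨d + e, by omega, directSum P₁ Q₁, directSum P₂ Q₂, directSum P₃ Q₃,
    directSum ((s : ℂ) • ρ) ((t : ℂ) • σ), isProjn_directSum hP₁ hQ₁, isProjn_directSum hP₂ hQ₂,
    isProjn_directSum hP₃ hQ₃, posSemidef_directSum (hρ.smul ?_) (hσ.smul ?_), ?_,
    commute_directSum (c₁.smul_left _) (c₁'.smul_left _),
    commute_directSum (c₂.smul_left _) (c₂'.smul_left _),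
    commute_directSum (c₃.smul_left _) (c₃'.smul_left _), ?_⟩
  · exact_mod_cast hs
  · exact_mod_cast ht
  · rw [directSum_trace, trace_smul, trace_smul, htr, htr']
    simp only [smul_eq_mul, mul_one]
    exact_mod_cast hst
  · simp only at e₁ e₂ e₃ hw e₁' e₂' e₃' hw'
    subst hw hw' e₁ e₂ e₃ e₁' e₂' e₃'
    simp [directSum_mul, directSum_trace]

lemma syncTriple_classical {e₁ e₂ e₃ : ℝ} (h₁ : e₁ * e₁ = e₁) (h₂ : e₂ * e₂ = e₂)
    (h₃ : e₃ * e₃ = e₃) : SyncTriple e₁ e₂ e₃ (e₁ * e₂, e₁ * e₃, e₂ * e₃) := by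
  have hp {e : ℝ} (h : e * e = e) : IsProjn ((e : ℂ) • (1 : Matrix (Fin 1) (Fin 1) ℂ)) := by
    constructor
    · rw [IsHermitian, conjTranspose_smul]; simp
    · rw [smul_mul_smul_comm, one_mul, ← Complex.ofReal_mul, h]
  refine ⟨1, one_pos, _, _, _, 1, hp h₁, hp h₂, hp h₃, PosSemidef.one, by simp,
    Commute.one_left _, Commute.one_left _, Commute.one_left _, ?_⟩
  simp [mul_comm]

lemma syncTriple_of_mem_corrSet {s : ℝ × ℝ × ℝ} (hs : s ∈ corrSet 2 1 1 1) :
    SyncTriple (1 / 2) (1 / 2) (1 / 2) s := by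
  obtain ⟨P₁, P₂, P₃, h₁, h₂, h₃, k₁, k₂, k₃, rfl⟩ := hs
  have ht {P : Matrix (Fin 2) (Fin 2) ℂ} (h : IsProjn P) (k : P.rank = 1) : P.trace = 1 := by
    rw [trace_eq_rank_of_isProjn h, k, Nat.cast_one]
  refine ⟨2, two_pos, P₁, P₂, P₃, (1 / 2 : ℝ) • 1, h₁, h₂, h₃,
    PosSemidef.one.smul (by norm_num), ?_, (Commute.one_left _).smul_left _,
    (Commute.one_left _).smul_left _, (Commute.one_left _).smul_left _, ?_⟩
  · simp [trace_smul]
  · simp [ht h₁ k₁, ht h₂ k₂, ht h₃ k₃]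

lemma syncTriple_mixture {q p₀ p₁ p₂ p₃ p₁₃ p₂₃ : ℝ} (hq : 0 ≤ q) (h₀ : 0 ≤ p₀) (h₁ : 0 ≤ p₁)
    (h₂ : 0 ≤ p₂) (h₃ : 0 ≤ p₃) (h₁₃ : 0 ≤ p₁₃) (h₂₃ : 0 ≤ p₂₃)
    (hsum : q + p₀ + p₁ + p₂ + p₃ + p₁₃ + p₂₃ = 1) {s : ℝ × ℝ × ℝ} (hs : s ∈ corrSet 2 1 1 1)
    {r₁ r₂ r₃ x y z : ℝ} (hr₁ : r₁ = q / 2 + p₁ + p₁₃) (hr₂ : r₂ = q / 2 + p₂ + p₂₃)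
    (hr₃ : r₃ = q / 2 + p₃ + p₁₃ + p₂₃) (hx : x = q * s.1) (hy : y = q * s.2.1 + p₁₃)
    (hz : z = q * s.2.2 + p₂₃) : SyncTriple r₁ r₂ r₃ (x, y, z) := by
  have c (e₁ e₂ e₃ : ℝ) (h₁ : e₁ * e₁ = e₁) (h₂ : e₂ * e₂ = e₂) (h₃ : e₃ * e₃ = e₃) :
      ((e₁, e₂, e₃), (e₁ * e₂, e₁ * e₃, e₂ * e₃)) ∈
        {p : (ℝ × ℝ × ℝ) × (ℝ × ℝ × ℝ) | SyncTriple p.1.1 p.1.2.1 p.1.2.2 p.2} :=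
    syncTriple_classical h₁ h₂ h₃
  have hc := convex_syncTriple.sum_mem (t := Finset.univ) (w := ![q, p₀, p₁, p₂, p₃, p₁₃, p₂₃])
    (z := ![((1 / 2, 1 / 2, 1 / 2), s), ((0, 0, 0), (0 * 0, 0 * 0, 0 * 0)),
      ((1, 0, 0), (1 * 0, 1 * 0, 0 * 0)), ((0, 1, 0), (0 * 1, 0 * 0, 1 * 0)),
      ((0, 0, 1), (0 * 0, 0 * 1, 0 * 1)), ((1, 0, 1), (1 * 0, 1 * 1, 0 * 1)),
      ((0, 1, 1), (0 * 1, 0 * 1, 1 * 1))])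
    (by intro i _; fin_cases i <;> assumption)
    (by simp only [Fin.sum_univ_succ]; simp; linarith)
    (by
      intro i _
      fin_cases i
      · exact syncTriple_of_mem_corrSet hs
      all_goals exact c _ _ _ (by norm_num) (by norm_num) (by norm_num))
  simp only [Fin.sum_univ_succ] at hc
  simp at hc
  convert hc using 1
  · rw [hr₁]; ring
  · rw [hr₂]; ring
  · rw [hr₃]; ring
  · rw [hx, hy, hz]
    refine Prod.ext ?_ (Prod.ext ?_ ?_)
    all_goals simp

section corrSet

/-- The real rank-one projection with Bloch vector `(y, 0, -x)`. -/
noncomputable def blochProj (x y : ℝ) : Matrix (Fin 2) (Fin 2) ℂ :=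
  !![(((1 - x) / 2 : ℝ) : ℂ), ((y / 2 : ℝ) : ℂ); ((y / 2 : ℝ) : ℂ), (((1 + x) / 2 : ℝ) : ℂ)]

lemma isProjn_blochProj {x y : ℝ} (h : x ^ 2 + y ^ 2 = 1) : IsProjn (blochProj x y) := by
  constructor
  · ext i j
    fin_cases i <;> fin_cases j <;> simp [blochProj]
  · have hC : (x : ℂ) ^ 2 + (y : ℂ) ^ 2 = 1 := by exact_mod_cast h
    rw [blochProj, Matrix.mul_fin_two]
    push_cast
    congr 1
    refine congrArg₂ _ ?_ (congrArg₂ _ ?_ rfl)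
    all_goals refine congrArg₂ _ ?_ (congrArg₂ _ ?_ rfl)
    · linear_combination hC / 4
    · ring
    · ring
    · linear_combination hC / 4

lemma rank_eq_one_of_trace {P : Matrix (Fin 2) (Fin 2) ℂ} (h : IsProjn P) (ht : P.trace = 1) :
    P.rank = 1 := by
  rw [trace_eq_rank_of_isProjn h] at ht
  exact_mod_cast ht

lemma trace_blochProj (x y : ℝ) : (blochProj x y).trace = 1 := by
  simp only [blochProj, trace_fin_two_of]
  push_cast
  ring

lemma trace_blochProj_mul (x y x' y' : ℝ) :
    1 / ((2 : ℕ) : ℝ) * ((blochProj x y * blochProj x' y').trace).re =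
      (1 + x * x' + y * y') / 4 := by
  simp only [blochProj, Matrix.mul_fin_two, trace_fin_two_of, ← Complex.ofReal_mul,
    ← Complex.ofReal_add, Complex.ofReal_re]
  push_cast
  ring

lemma mem_corrSet_of_unit {x₁ y₁ x₂ y₂ x₃ y₃ : ℝ} (h₁ : x₁ ^ 2 + y₁ ^ 2 = 1)
    (h₂ : x₂ ^ 2 + y₂ ^ 2 = 1) (h₃ : x₃ ^ 2 + y₃ ^ 2 = 1) :
    ((1 + x₁ * x₂ + y₁ * y₂) / 4, (1 + x₁ * x₃ + y₁ * y₃) / 4, (1 + x₂ * x₃ + y₂ * y₃) / 4) ∈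
      corrSet 2 1 1 1 := by
  refine ⟨blochProj x₁ y₁, blochProj x₂ y₂, blochProj x₃ y₃, isProjn_blochProj h₁,
    isProjn_blochProj h₂, isProjn_blochProj h₃, ?_, ?_, ?_, ?_⟩
  · exact rank_eq_one_of_trace (isProjn_blochProj h₁) (trace_blochProj _ _)
  · exact rank_eq_one_of_trace (isProjn_blochProj h₂) (trace_blochProj _ _)
  · exact rank_eq_one_of_trace (isProjn_blochProj h₃) (trace_blochProj _ _)
  · rw [trace_blochProj_mul, trace_blochProj_mul, trace_blochProj_mul]

lemma mem_corrSet_all : ((1 / 2, 1 / 2, 1 / 2) : ℝ × ℝ × ℝ) ∈ corrSet 2 1 1 1 := by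
  have h := mem_corrSet_of_unit (x₁ := 1) (y₁ := 0) (x₂ := 1) (y₂ := 0) (x₃ := 1) (y₃ := 0)
    (by norm_num) (by norm_num) (by norm_num)
  norm_num at h ⊢
  exact h

lemma mem_corrSet_fst : ((1 / 2, 0, 0) : ℝ × ℝ × ℝ) ∈ corrSet 2 1 1 1 := by
  have h := mem_corrSet_of_unit (x₁ := 1) (y₁ := 0) (x₂ := 1) (y₂ := 0) (x₃ := -1) (y₃ := 0)
    (by norm_num) (by norm_num) (by norm_num)
  norm_num at h ⊢
  exact h

lemma mem_corrSet_snd : ((0, 1 / 2, 0) : ℝ × ℝ × ℝ) ∈ corrSet 2 1 1 1 := by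
  have h := mem_corrSet_of_unit (x₁ := 1) (y₁ := 0) (x₂ := -1) (y₂ := 0) (x₃ := 1) (y₃ := 0)
    (by norm_num) (by norm_num) (by norm_num)
  norm_num at h ⊢
  exact h

lemma mem_corrSet_trd : ((0, 0, 1 / 2) : ℝ × ℝ × ℝ) ∈ corrSet 2 1 1 1 := by
  have h := mem_corrSet_of_unit (x₁ := -1) (y₁ := 0) (x₂ := 1) (y₂ := 0) (x₃ := 1) (y₃ := 0)
    (by norm_num) (by norm_num) (by norm_num)
  norm_num at h ⊢
  exact h

lemma corrSet_compl₃ {s : ℝ × ℝ × ℝ} (hs : s ∈ corrSet 2 1 1 1) :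
    (s.1, 1 / 2 - s.2.1, 1 / 2 - s.2.2) ∈ corrSet 2 1 1 1 := by
  obtain ⟨P₁, P₂, P₃, h₁, h₂, h₃, k₁, k₂, k₃, rfl⟩ := hs
  have ht {P : Matrix (Fin 2) (Fin 2) ℂ} (h : IsProjn P) (k : P.rank = 1) : P.trace = 1 := by
    rw [trace_eq_rank_of_isProjn h, k, Nat.cast_one]
  refine ⟨P₁, P₂, 1 - P₃, h₁, h₂, isProjn_one_sub h₃, k₁, k₂,
    rank_eq_one_of_trace (isProjn_one_sub h₃) ?_, ?_⟩
  · rw [trace_sub, ht h₃ k₃, trace_one]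
    norm_num
  · simp [mul_sub, ht h₁ k₁, ht h₂ k₂]

/-- Unit vectors `u₁, u₂, u₃` with `a u₁ + b u₂ + c u₃ = 0` give a point of `corrSet 2 1 1 1`. -/
lemma exists_mem_corrSet_of_triangle {a b c : ℝ} (ha : a ≠ 0) (hb : b ≠ 0) (hc : c ≠ 0)
    (h : (c ^ 2 - a ^ 2 - b ^ 2) ^ 2 ≤ (2 * a * b) ^ 2) :
    ∃ s ∈ corrSet 2 1 1 1, a * b * s.1 = (c ^ 2 - (a - b) ^ 2) / 8 ∧
      a * c * s.2.1 = (b ^ 2 - (a - c) ^ 2) / 8 ∧ b * c * s.2.2 = (a ^ 2 - (b - c) ^ 2) / 8 := by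
  obtain ⟨t, ht⟩ : ∃ t, t = (c ^ 2 - a ^ 2 - b ^ 2) / (2 * a * b) := ⟨_, rfl⟩
  have hab : 2 * a * b * t = c ^ 2 - a ^ 2 - b ^ 2 := by rw [ht]; field_simp
  have ht1 : t ^ 2 ≤ 1 := by
    rw [ht, div_pow, div_le_one (by positivity)]
    exact h
  obtain ⟨u, hu⟩ : ∃ u, u = √(1 - t ^ 2) := ⟨_, rfl⟩
  have hu2 : u ^ 2 = 1 - t ^ 2 := by rw [hu, Real.sq_sqrt (by linarith)]
  refine ⟨_, mem_corrSet_of_unit (x₁ := 1) (y₁ := 0) (x₂ := t) (y₂ := u) (x₃ := -(a + b * t) / c)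
    (y₃ := -(b * u) / c) (by norm_num) (by rw [hu2]; ring) ?_, ?_, ?_, ?_⟩
  · field_simp
    linear_combination b ^ 2 * hu2 + hab
  · linear_combination hab / 8
  · field_simp
    linear_combination -4 * hab
  · field_simp
    linear_combination -8 * b ^ 2 * hu2 - 4 * hab

lemma isCompact_corrSet : IsCompact (corrSet 2 1 1 1) := by
  let K : Set (Matrix (Fin 2) (Fin 2) ℂ) := {P | IsProjn P ∧ P.trace = 1}
  have hclosed : IsClosed K := by
    have h1 : IsClosed {P : Matrix (Fin 2) (Fin 2) ℂ | Pᴴ = P} :=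
      isClosed_eq (by fun_prop) continuous_id
    have h2 : IsClosed {P : Matrix (Fin 2) (Fin 2) ℂ | P * P = P} :=
      isClosed_eq (by fun_prop) continuous_id
    have h3 : IsClosed {P : Matrix (Fin 2) (Fin 2) ℂ | P.trace = 1} :=
      isClosed_eq (by fun_prop) continuous_const
    exact (h1.inter h2).inter h3
  have hsub : K ⊆ Set.univ.pi fun _ => Set.univ.pi fun _ => Metric.closedBall (0 : ℂ) 1 := by
    rintro P ⟨hP, -⟩ i - j -
    rw [mem_closedBall_zero_iff]
    have hdiag (i : Fin 2) : ∑ j, ‖P i j‖ ^ 2 = (P i i).re := by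
      have h1 : (P * Pᴴ) i i = P i i := by rw [hP.1.eq, hP.2]
      rw [← h1, Matrix.mul_apply, Complex.re_sum]
      refine Finset.sum_congr rfl fun j _ => ?_
      rw [conjTranspose_apply, Complex.star_def, Complex.mul_conj, Complex.normSq_eq_norm_sq,
        Complex.ofReal_re]
    have hle (j : Fin 2) : ‖P i j‖ ^ 2 ≤ (P i i).re := by
      rw [← hdiag i]
      exact Finset.single_le_sum (f := fun j => ‖P i j‖ ^ 2) (fun _ _ => sq_nonneg _)
        (Finset.mem_univ j)
    have h1 := hle i
    have h2 := hle j
    have h3 := Complex.re_le_norm (P i i)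
    have h4 : (P i i).re ≤ 1 := by nlinarith [sq_nonneg (‖P i i‖ - 1)]
    nlinarith [norm_nonneg (P i j)]
  have hK : IsCompact K :=
    (isCompact_univ_pi fun _ => isCompact_univ_pi fun _ => isCompact_closedBall 0 1).of_isClosed_subset
      hclosed hsub
  have himage : corrSet 2 1 1 1 =
      (fun p : Matrix (Fin 2) (Fin 2) ℂ × Matrix (Fin 2) (Fin 2) ℂ × Matrix (Fin 2) (Fin 2) ℂ =>
        ((1 / ((2 : ℕ) : ℝ)) * ((p.1 * p.2.1).trace).re,
          (1 / ((2 : ℕ) : ℝ)) * ((p.1 * p.2.2).trace).re,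
          (1 / ((2 : ℕ) : ℝ)) * ((p.2.1 * p.2.2).trace).re)) '' (K ×ˢ K ×ˢ K) := by
    ext x
    constructor
    · rintro ⟨P₁, P₂, P₃, h₁, h₂, h₃, k₁, k₂, k₃, rfl⟩
      have ht {P : Matrix (Fin 2) (Fin 2) ℂ} (h : IsProjn P) (k : P.rank = 1) : P ∈ K :=
        ⟨h, by rw [trace_eq_rank_of_isProjn h, k, Nat.cast_one]⟩
      exact ⟨(P₁, P₂, P₃), ⟨ht h₁ k₁, ht h₂ k₂, ht h₃ k₃⟩, rfl⟩
    · rintro ⟨⟨P₁, P₂, P₃⟩, ⟨h₁, h₂, h₃⟩, rfl⟩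
      exact ⟨P₁, P₂, P₃, h₁.1, h₂.1, h₃.1, rank_eq_one_of_trace h₁.1 h₁.2,
        rank_eq_one_of_trace h₂.1 h₂.2, rank_eq_one_of_trace h₃.1 h₃.2, rfl⟩
  rw [himage]
  refine (hK.prod (hK.prod hK)).image ?_
  have hre : Continuous Complex.re := Complex.continuous_re
  fun_prop

end corrSet

section support

variable {r₁ r₂ r₃ x y z : ℝ}

lemma sq_le_sq_of_triangle {a b c : ℝ} (ha : 0 < a) (hb : 0 < b) (hc : 0 < c)
    (h₁ : a ≤ b + c) (h₂ : b ≤ a + c) (h₃ : c ≤ a + b) :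
    (c ^ 2 - a ^ 2 - b ^ 2) ^ 2 ≤ (2 * a * b) ^ 2 := by
  have := mul_nonneg (mul_nonneg (add_pos (add_pos ha hb) hc).le (sub_nonneg.2 h₃))
    (mul_nonneg (sub_nonneg.2 h₂) (sub_nonneg.2 h₁))
  linear_combination this

lemma exists_corrSet_upper (h : SyncTriple r₁ r₂ r₃ (x, y, z)) {a b c : ℝ} (ha : 0 < a)
    (hb : 0 < b) (hc : 0 < c) : ∃ s ∈ corrSet 2 1 1 1,
      a * b * x + a * c * y - b * c * z ≤
        2 * r₁ * (a * b * s.1 + a * c * s.2.1 - b * c * s.2.2) := by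
  have hx := syncTriple_bounds h
  have hy := syncTriple_bounds (syncTriple_swap₂₃ h)
  have hab := mul_pos ha hb
  have hac := mul_pos ha hc
  have hbc := mul_pos hb hc
  rcases le_total a (b + c) with h₁ | h₁
  swap
  · refine ⟨_, mem_corrSet_all, ?_⟩
    have := syncTriple_upper h (add_pos hb hc).le hb hc
    have h2 := mul_nonneg (sub_nonneg.2 h₁)
      (add_nonneg (mul_nonneg hb.le (sub_nonneg.2 hx.2)) (mul_nonneg hc.le (sub_nonneg.2 hy.2)))
    linear_combination this + h2
  rcases le_total b (a + c) with h₂ | h₂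
  swap
  · refine ⟨_, mem_corrSet_fst, ?_⟩
    have := syncTriple_upper h ha.le (add_pos ha hc) hc
    have hz := (syncTriple_bounds (syncTriple_swap₂₃ (syncTriple_swap₁₂ h))).1
    have h2 := mul_nonneg (sub_nonneg.2 h₂)
      (add_nonneg (mul_nonneg ha.le (sub_nonneg.2 hx.2)) (mul_nonneg hc.le hz))
    linear_combination this + h2
  rcases le_total c (a + b) with h₃ | h₃
  swap
  · refine ⟨_, mem_corrSet_snd, ?_⟩
    have := syncTriple_upper h ha.le hb (add_pos ha hb)
    have hz := (syncTriple_bounds (syncTriple_swap₂₃ (syncTriple_swap₁₂ h))).1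
    have h2 := mul_nonneg (sub_nonneg.2 h₃)
      (add_nonneg (mul_nonneg ha.le (sub_nonneg.2 hy.2)) (mul_nonneg hb.le hz))
    linear_combination this + h2
  obtain ⟨s, hs, e₁, e₂, e₃⟩ := exists_mem_corrSet_of_triangle (neg_ne_zero.2 ha.ne') hb.ne' hc.ne'
    (by linear_combination sq_le_sq_of_triangle ha hb hc h₁ h₂ h₃)
  refine ⟨s, hs, ?_⟩
  have := syncTriple_upper h ha.le hb hc
  linear_combination this + 2 * r₁ * (e₁ + e₂ + e₃)

lemma exists_corrSet_lower (h : SyncTriple r₁ r₂ r₃ (x, y, z)) {a b c : ℝ} (ha : 0 < a)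
    (hb : 0 < b) (hc : 0 < c) : ∃ s ∈ corrSet 2 1 1 1,
      2 * (r₁ + r₂ + r₃ - 1) * (a * b * s.1 + a * c * s.2.1 + b * c * s.2.2) ≤
        a * b * x + a * c * y + b * c * z := by
  have hx := (syncTriple_bounds h).1
  have hy := (syncTriple_bounds (syncTriple_swap₂₃ h)).1
  have hz := (syncTriple_bounds (syncTriple_swap₂₃ (syncTriple_swap₁₂ h))).1
  have hab := mul_pos ha hb
  have hac := mul_pos ha hc
  have hbc := mul_pos hb hc
  rcases le_total a (b + c) with h₁ | h₁
  swap
  · refine ⟨_, mem_corrSet_trd, ?_⟩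
    have := syncTriple_lower h (add_pos hb hc).le hb hc (by nlinarith)
    have h2 := mul_nonneg (sub_nonneg.2 h₁) (add_nonneg (mul_nonneg hb.le hx) (mul_nonneg hc.le hy))
    linear_combination this + h2
  rcases le_total b (a + c) with h₂ | h₂
  swap
  · refine ⟨_, mem_corrSet_snd, ?_⟩
    have := syncTriple_lower h ha.le (add_pos ha hc) hc (by nlinarith)
    have h2 := mul_nonneg (sub_nonneg.2 h₂) (add_nonneg (mul_nonneg ha.le hx) (mul_nonneg hc.le hz))
    linear_combination this + h2
  rcases le_total c (a + b) with h₃ | h₃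
  swap
  · refine ⟨_, mem_corrSet_fst, ?_⟩
    have := syncTriple_lower h ha.le hb (add_pos ha hb) (by nlinarith)
    have h2 := mul_nonneg (sub_nonneg.2 h₃) (add_nonneg (mul_nonneg ha.le hy) (mul_nonneg hb.le hz))
    linear_combination this + h2
  obtain ⟨s, hs, e₁, e₂, e₃⟩ := exists_mem_corrSet_of_triangle ha.ne' hb.ne' hc.ne'
    (sq_le_sq_of_triangle ha hb hc h₁ h₂ h₃)
  refine ⟨s, hs, ?_⟩
  have := syncTriple_lower h ha.le hb hc (by
    nlinarith [mul_nonneg (sub_nonneg.2 h₁) (sub_nonneg.2 h₂),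
      mul_nonneg (sub_nonneg.2 h₁) (sub_nonneg.2 h₃),
      mul_nonneg (sub_nonneg.2 h₂) (sub_nonneg.2 h₃)])
  linear_combination this + 2 * (r₁ + r₂ + r₃ - 1) * (e₁ + e₂ + e₃)

lemma exists_corrSet_le (h : SyncTriple r₁ r₂ r₃ (x, y, z)) {α β γ : ℝ} (hα : 0 < α)
    (hβ : 0 < β) (hγ : 0 < γ) : ∃ s ∈ corrSet 2 1 1 1,
      α * x + β * y - γ * z ≤ 2 * r₁ * (α * s.1 + β * s.2.1 - γ * s.2.2) := by
  obtain ⟨s, hs, h⟩ := exists_corrSet_upper h (mul_pos hα hβ) (mul_pos hα hγ) (mul_pos hβ hγ)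
  refine ⟨s, hs, le_of_mul_le_mul_left ?_ (mul_pos (mul_pos hα hβ) hγ)⟩
  linear_combination h

lemma exists_le_corrSet (h : SyncTriple r₁ r₂ r₃ (x, y, z)) {α β γ : ℝ} (hα : 0 < α)
    (hβ : 0 < β) (hγ : 0 < γ) : ∃ s ∈ corrSet 2 1 1 1,
      2 * (r₁ + r₂ + r₃ - 1) * (α * s.1 + β * s.2.1 + γ * s.2.2) ≤ α * x + β * y + γ * z := by
  obtain ⟨s, hs, h⟩ := exists_corrSet_lower h (mul_pos hα hβ) (mul_pos hα hγ) (mul_pos hβ hγ)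
  refine ⟨s, hs, le_of_mul_le_mul_left ?_ (mul_pos (mul_pos hα hβ) hγ)⟩
  linear_combination h

end support

section slice

variable (r₁ r₂ r₃ : ℝ)

/-- The union of the three pieces generating the slice with marginals `(r₁, r₂, r₃)`. -/
def slicePieces : Set (ℝ × ℝ × ℝ) :=
  ((2 * max 0 (r₁ + r₂ + r₃ - 1)) • corrSet 2 1 1 1) ∪
    ((2 * r₁) • corrSet 2 1 1 1 +
      ({(0 : ℝ)} ×ˢ ({(0 : ℝ)} ×ˢ Set.Icc (0 : ℝ) (r₂ - r₁)))) ∪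
    ((2 * max 0 (r₁ + r₂ - r₃)) • corrSet 2 1 1 1 +
      {((0 : ℝ), min r₁ (r₃ - r₂), min r₂ (r₃ - r₁))})

variable {r₁ r₂ r₃}

lemma mem_slicePieces_iff {v : ℝ × ℝ × ℝ} : v ∈ slicePieces r₁ r₂ r₃ ↔
    (∃ s ∈ corrSet 2 1 1 1, (2 * max 0 (r₁ + r₂ + r₃ - 1)) • s = v) ∨
    (∃ s ∈ corrSet 2 1 1 1, ∃ p ∈ Set.Icc 0 (r₂ - r₁), (2 * r₁) • s + (0, 0, p) = v) ∨
    (∃ s ∈ corrSet 2 1 1 1, (2 * max 0 (r₁ + r₂ - r₃)) • s +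
      (0, min r₁ (r₃ - r₂), min r₂ (r₃ - r₁)) = v) := by
  simp only [slicePieces, Set.mem_union, or_assoc, Set.mem_add, Set.mem_smul_set, Set.mem_prod,
    Set.mem_singleton_iff, Prod.exists, exists_eq_left, and_assoc]
  aesop

lemma isCompact_slicePieces : IsCompact (slicePieces r₁ r₂ r₃) :=
  ((isCompact_corrSet.smul _).union ((isCompact_corrSet.smul _).add
    (isCompact_singleton.prod (isCompact_singleton.prod isCompact_Icc)))).union
    ((isCompact_corrSet.smul _).add isCompact_singleton)

lemma slicePieces_subset (h0 : 0 ≤ r₁) (h12 : r₁ ≤ r₂) (h23 : r₂ ≤ r₃) (h3 : r₃ ≤ 1 / 2) :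
    slicePieces r₁ r₂ r₃ ⊆ {w | SyncTriple r₁ r₂ r₃ w} := by
  intro v hv
  rcases mem_slicePieces_iff.1 hv with ⟨s, hs, rfl⟩ | ⟨s, hs, p, ⟨hp, hp'⟩, rfl⟩ | ⟨s, hs, rfl⟩
  · rcases le_total (r₁ + r₂ + r₃ - 1) 0 with hR | hR
    · refine syncTriple_mixture (q := 0) (p₀ := 1 - (r₁ + r₂ + r₃)) (p₁ := r₁) (p₂ := r₂)
        (p₃ := r₃) (p₁₃ := 0) (p₂₃ := 0) ?_ ?_ ?_ ?_ ?_ ?_ ?_ ?_ hs ?_ ?_ ?_ ?_ ?_ ?_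
      all_goals try simp [max_eq_left hR]
      all_goals linarith
    · refine syncTriple_mixture (q := 2 * (r₁ + r₂ + r₃ - 1)) (p₀ := 0) (p₁ := 1 - r₂ - r₃)
        (p₂ := 1 - r₁ - r₃) (p₃ := 1 - r₁ - r₂) (p₁₃ := 0) (p₂₃ := 0)
        ?_ ?_ ?_ ?_ ?_ ?_ ?_ ?_ hs ?_ ?_ ?_ ?_ ?_ ?_
      all_goals try simp [max_eq_right hR]
      all_goals linarith
  · refine syncTriple_mixture (q := 2 * r₁) (p₀ := 1 - r₂ - r₃ + p) (p₁ := 0) (p₂ := r₂ - r₁ - p)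
      (p₃ := r₃ - r₁ - p) (p₁₃ := 0) (p₂₃ := p) ?_ ?_ ?_ ?_ ?_ ?_ ?_ ?_ hs ?_ ?_ ?_ ?_ ?_ ?_
    all_goals try simp
    all_goals linarith
  · rcases le_total (r₁ + r₂ - r₃) 0 with hR | hR
    · refine syncTriple_mixture (q := 0) (p₀ := 1 - r₃) (p₁ := 0) (p₂ := 0)
        (p₃ := r₃ - r₁ - r₂) (p₁₃ := r₁) (p₂₃ := r₂) ?_ ?_ ?_ ?_ ?_ ?_ ?_ ?_ hs ?_ ?_ ?_ ?_ ?_ ?_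
      all_goals try simp [max_eq_left hR]
      all_goals linarith
    · refine syncTriple_mixture (q := 2 * (r₁ + r₂ - r₃)) (p₀ := 1 - r₁ - r₂) (p₁ := 0) (p₂ := 0)
        (p₃ := 0) (p₁₃ := r₃ - r₂) (p₂₃ := r₃ - r₁)
        ?_ ?_ ?_ ?_ ?_ ?_ ?_ ?_ hs ?_ ?_ ?_ ?_ ?_ ?_
      all_goals try
        simp [max_eq_right hR, min_eq_right (show r₃ - r₂ ≤ r₁ by linarith),
          min_eq_right (show r₃ - r₁ ≤ r₂ by linarith)]
      all_goals linarith

lemma exists_slicePieces_le (h12 : r₁ ≤ r₂) {x y z : ℝ}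
    (h : SyncTriple r₁ r₂ r₃ (x, y, z)) (α β γ : ℝ) :
    ∃ v ∈ slicePieces r₁ r₂ r₃, α * x + β * y + γ * z ≤ α * v.1 + β * v.2.1 + γ * v.2.2 := by
  have hx := syncTriple_bounds h
  have hy := syncTriple_bounds (syncTriple_swap₂₃ h)
  have hz := syncTriple_bounds (syncTriple_swap₂₃ (syncTriple_swap₁₂ h))
  have hall (hα : 0 ≤ α) (hβ : 0 ≤ β) (hγ : 0 ≤ γ) : ∃ v ∈ slicePieces r₁ r₂ r₃,
      α * x + β * y + γ * z ≤ α * v.1 + β * v.2.1 + γ * v.2.2 := by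
    refine ⟨_, mem_slicePieces_iff.2 (.inr (.inl ⟨_, mem_corrSet_all, r₂ - r₁,
      ⟨by linarith, le_rfl⟩, rfl⟩)), ?_⟩
    simp
    nlinarith
  have hfst (hα : 0 ≤ α) (hβ : β ≤ 0) (hγ : γ ≤ 0) : ∃ v ∈ slicePieces r₁ r₂ r₃,
      α * x + β * y + γ * z ≤ α * v.1 + β * v.2.1 + γ * v.2.2 := by
    refine ⟨_, mem_slicePieces_iff.2 (.inr (.inl ⟨_, mem_corrSet_fst, 0,
      ⟨le_rfl, by linarith⟩, rfl⟩)), ?_⟩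
    simp
    nlinarith
  have hsnd (hα : α ≤ 0) (hβ : 0 ≤ β) (hγ : γ ≤ 0) : ∃ v ∈ slicePieces r₁ r₂ r₃,
      α * x + β * y + γ * z ≤ α * v.1 + β * v.2.1 + γ * v.2.2 := by
    refine ⟨_, mem_slicePieces_iff.2 (.inr (.inl ⟨_, mem_corrSet_snd, 0,
      ⟨le_rfl, by linarith⟩, rfl⟩)), ?_⟩
    simp
    nlinarith
  have htrd (hα : α ≤ 0) (hβ : β ≤ 0) (hγ : 0 ≤ γ) : ∃ v ∈ slicePieces r₁ r₂ r₃,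
      α * x + β * y + γ * z ≤ α * v.1 + β * v.2.1 + γ * v.2.2 := by
    refine ⟨_, mem_slicePieces_iff.2 (.inr (.inl ⟨_, mem_corrSet_trd, r₂ - r₁,
      ⟨by linarith, le_rfl⟩, rfl⟩)), ?_⟩
    simp
    nlinarith
  rcases lt_trichotomy α 0 with hα | hα | hα <;> rcases lt_trichotomy β 0 with hβ | hβ | hβ <;>
    rcases lt_trichotomy γ 0 with hγ | hγ | hγ
  all_goals first
    | exact hall (by linarith) (by linarith) (by linarith)
    | exact hfst (by linarith) (by linarith) (by linarith)
    | exact hsnd (by linarith) (by linarith) (by linarith)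
    | exact htrd (by linarith) (by linarith) (by linarith)
    | skip
  · rcases le_total (r₁ + r₂ + r₃ - 1) 0 with hR | hR
    · refine ⟨_, mem_slicePieces_iff.2 (.inl ⟨_, mem_corrSet_all, rfl⟩), ?_⟩
      simp [max_eq_left hR]
      nlinarith
    · obtain ⟨s, hs, hle⟩ := exists_le_corrSet h (neg_pos.2 hα) (neg_pos.2 hβ) (neg_pos.2 hγ)
      refine ⟨_, mem_slicePieces_iff.2 (.inl ⟨s, hs, rfl⟩), ?_⟩
      simp [max_eq_right hR]
      linarith
  · rcases le_total (r₁ + r₂ - r₃) 0 with hR | hR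
    · refine ⟨_, mem_slicePieces_iff.2 (.inr (.inr ⟨_, mem_corrSet_all, rfl⟩)), ?_⟩
      simp [max_eq_left hR, min_eq_left (show r₁ ≤ r₃ - r₂ by linarith),
        min_eq_left (show r₂ ≤ r₃ - r₁ by linarith)]
      nlinarith
    · obtain ⟨s, hs, hle⟩ := exists_le_corrSet (syncTriple_compl₃ h) (neg_pos.2 hα) hβ hγ
      refine ⟨_, mem_slicePieces_iff.2 (.inr (.inr ⟨_, corrSet_compl₃ hs, rfl⟩)), ?_⟩
      simp [max_eq_right hR, min_eq_right (show r₃ - r₂ ≤ r₁ by linarith),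
        min_eq_right (show r₃ - r₁ ≤ r₂ by linarith)]
      linarith
  · obtain ⟨s, hs, hle⟩ := exists_corrSet_le (syncTriple_compl₃ h) hα (neg_pos.2 hβ) hγ
    refine ⟨_, mem_slicePieces_iff.2 (.inr (.inl ⟨_, corrSet_compl₃ hs, r₂ - r₁,
      ⟨by linarith, le_rfl⟩, rfl⟩)), ?_⟩
    simp
    linarith
  · obtain ⟨s, hs, hle⟩ := exists_corrSet_le h hα hβ (neg_pos.2 hγ)
    refine ⟨_, mem_slicePieces_iff.2 (.inr (.inl ⟨s, hs, 0, ⟨le_rfl, by linarith⟩, rfl⟩)), ?_⟩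
    simp
    linarith

lemma convex_slice : Convex ℝ {w | SyncTriple r₁ r₂ r₃ w} := by
  intro w hw w' hw' s t hs ht hst
  have := convex_syncTriple (x := ((r₁, r₂, r₃), w)) hw (y := ((r₁, r₂, r₃), w')) hw' hs ht hst
  simpa [← add_mul, hst] using this

lemma slice_subset (h12 : r₁ ≤ r₂) :
    {w | SyncTriple r₁ r₂ r₃ w} ⊆ convexHull ℝ (slicePieces r₁ r₂ r₃) := by
  rintro ⟨x, y, z⟩ hw
  by_contra hnot
  obtain ⟨f, u, hf, hu⟩ := geometric_hahn_banach_closed_point (convex_convexHull ℝ _)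
    (isCompact_convexHull_of_isCompact isCompact_slicePieces).isClosed hnot
  have hfv (v : ℝ × ℝ × ℝ) : f v = f (1, 0, 0) * v.1 + f (0, 1, 0) * v.2.1 + f (0, 0, 1) * v.2.2 := by
    have : v = v.1 • (1, 0, 0) + v.2.1 • (0, 1, 0) + v.2.2 • (0, 0, 1) := by ext <;> simp
    conv_lhs => rw [this]
    simp only [map_add, map_smul, smul_eq_mul]
    ring
  obtain ⟨v, hv, hle⟩ := exists_slicePieces_le h12 hw (f (1, 0, 0)) (f (0, 1, 0))
    (f (0, 0, 1))
  have h1 := hf v (subset_convexHull ℝ _ hv)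
  rw [hfv] at h1 hu
  linarith

end slice

end SyncSlice

/-- Theorem 3.16 (main theorem): for `0 ≤ r₁ ≤ r₂ ≤ r₃ ≤ 1/2`, the set of synchronous
quantum correlation triples with marginals `(r₁, r₂, r₃)` is exactly
`co(D₁ ∪ D₂ ∪ D₃)` with `D₁ = 2·max(0, r₁+r₂+r₃−1)·S₂(1)`,
`D₂ = 2r₁·S₂(1) + {0}×{0}×[0, r₂−r₁]`, and
`D₃ = 2·max(0, r₁+r₂−r₃)·S₂(1) + {(0, min(r₁, r₃−r₂), min(r₂, r₃−r₁))}`. -/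
theorem syncTriple_slice_description (r₁ r₂ r₃ : ℝ)
    (h0 : 0 ≤ r₁) (h12 : r₁ ≤ r₂) (h23 : r₂ ≤ r₃) (h3 : r₃ ≤ 1 / 2) :
    {w : ℝ × ℝ × ℝ | SyncTriple r₁ r₂ r₃ w} =
      convexHull ℝ
        (((2 * max 0 (r₁ + r₂ + r₃ - 1)) • corrSet 2 1 1 1) ∪
          ((2 * r₁) • corrSet 2 1 1 1 +
            ({(0 : ℝ)} ×ˢ ({(0 : ℝ)} ×ˢ Set.Icc (0 : ℝ) (r₂ - r₁)))) ∪
          ((2 * max 0 (r₁ + r₂ - r₃)) • corrSet 2 1 1 1 +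
            {((0 : ℝ), min r₁ (r₃ - r₂), min r₂ (r₃ - r₁))})) := by
  exact Set.Subset.antisymm (SyncSlice.slice_subset h12)
    (convexHull_min (SyncSlice.slicePieces_subset h0 h12 h23 h3) SyncSlice.convex_slice)
end

section
/- The set C ⊆ ℝ⁶ consisting of all tuples (r₁, r₂, r₃, w₁₂, w₁₃, w₂₃) such that (w₁₂, w₁₃, w₂₃) is a synchronous quantum correlation triple with marginals (r₁, r₂, r₃) is a closed subset of ℝ⁶. -/
open Matrix
open scoped Pointwise ComplexOrder

theorem IsCompact.convexHull_of_finiteDimensional {E : Type*} [NormedAddCommGroup E]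
    [NormedSpace ℝ E] [FiniteDimensional ℝ E] {s : Set E} (hs : IsCompact s) :
    IsCompact (convexHull ℝ s) := by
  have h : convexHull ℝ s = ⋃ n ∈ Finset.range (Module.finrank ℝ E + 2),
      (fun p : (Fin n → ℝ) × (Fin n → E) ↦ ∑ i, p.1 i • p.2 i) ''
        (stdSimplex ℝ (Fin n) ×ˢ Set.univ.pi fun _ ↦ s) := by
    ext x
    simp only [Set.mem_iUnion, Set.mem_image, Set.mem_prod, Set.mem_univ_pi, Prod.exists,
      Finset.mem_range, exists_prop]
    constructor
    · intro hx
      obtain ⟨ι, _, z, w, hz, hind, hw, hsum, rfl⟩ := eq_pos_convex_span_of_mem_convexHull hx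
      let e := Fintype.equivFin ι
      refine ⟨Fintype.card ι, ?_, w ∘ e.symm, z ∘ e.symm, ⟨⟨fun i ↦ (hw _).le, ?_⟩, fun i ↦ ?_⟩, ?_⟩
      · have := hind.card_le_finrank_succ
        have h' := Submodule.finrank_le (vectorSpan ℝ (Set.range z))
        omega
      · rw [← hsum]; exact e.symm.sum_comp w
      · exact hz ⟨_, rfl⟩
      · exact e.symm.sum_comp fun i ↦ w i • z i
    · rintro ⟨n, -, w, z, ⟨hw, hz⟩, rfl⟩
      exact (convex_convexHull ℝ s).sum_mem (fun i _ ↦ hw.1 i) hw.2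
        fun i _ ↦ subset_convexHull ℝ s (hz i)
  rw [h]
  refine (Finset.range _).isCompact_biUnion fun n _ ↦ ?_
  exact ((isCompact_stdSimplex ℝ (Fin n)).prod (isCompact_univ_pi fun _ ↦ hs)).image (by fun_prop)

theorem IsProjn.norm_apply_le {d : ℕ} {P : Matrix (Fin d) (Fin d) ℂ} (hP : IsProjn P)
    (i j : Fin d) : ‖P i j‖ ≤ 1 := by
  have hU : (2 : ℕ) • P - 1 ∈ Matrix.unitaryGroup (Fin d) ℂ := by
    rw [Matrix.mem_unitaryGroup_iff, star_eq_conjTranspose, conjTranspose_sub, conjTranspose_smul,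
      hP.1, conjTranspose_one, star_trivial, sub_mul, mul_sub, smul_mul_smul_comm, hP.2]
    simp only [mul_one, one_mul]
    module
  have h := entry_norm_bound_of_unitary hU i j
  have h1 : ‖(1 : Matrix (Fin d) (Fin d) ℂ) i j‖ ≤ 1 := by
    rw [Matrix.one_apply]; split_ifs <;> simp
  have h2 : ((2 : ℕ) • P - 1) i j + (1 : Matrix (Fin d) (Fin d) ℂ) i j = 2 * P i j := by
    simp only [two_nsmul, Matrix.sub_apply, Matrix.add_apply]
    ring
  have h3 := norm_add_le (((2 : ℕ) • P - 1) i j) ((1 : Matrix (Fin d) (Fin d) ℂ) i j)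
  rw [h2, norm_mul, Complex.norm_ofNat] at h3
  linarith

theorem isCompact_setOf_isProjn (d : ℕ) :
    IsCompact {P : Matrix (Fin d) (Fin d) ℂ | IsProjn P} := by
  have hcl : IsClosed {P : Matrix (Fin d) (Fin d) ℂ | IsProjn P} := by
    refine (isClosed_eq ?_ ?_).inter (isClosed_eq ?_ ?_) <;> fun_prop
  refine (isCompact_univ_pi fun _ : Fin d ↦ isCompact_univ_pi fun _ : Fin d ↦
    isCompact_closedBall (0 : ℂ) 1).of_isClosed_subset hcl ?_
  exact fun P hP i _ j _ ↦ mem_closedBall_zero_iff.2 (IsProjn.norm_apply_le hP i j)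

theorem LinearMap.IsSymmetric.mem_orthogonal_of_invariant {V : Type*} [NormedAddCommGroup V]
    [InnerProductSpace ℂ V] {f : V →ₗ[ℂ] V} (hf : f.IsSymmetric) {W : Submodule ℂ V}
    (h : ∀ x ∈ W, f x ∈ W) : ∀ x ∈ Wᗮ, f x ∈ Wᗮ := fun x hx y hy ↦ by
  rw [← hf]; exact hx _ (h y hy)

section Compression

variable {V : Type*} [NormedAddCommGroup V] [InnerProductSpace ℂ V] [FiniteDimensional ℂ V]

/-- The compression of an operator to a subspace. -/
noncomputable def compression (W : Submodule ℂ V) (f : V →ₗ[ℂ] V) : W →ₗ[ℂ] W :=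
  (W.orthogonalProjectionOnto : V →ₗ[ℂ] W) ∘ₗ f ∘ₗ W.subtype

theorem inner_compression_left (W : Submodule ℂ V) (f : V →ₗ[ℂ] V) (x y : W) :
    inner ℂ (compression W f x) y = inner ℂ (f x) (y : V) := by
  simp [compression]

theorem inner_compression_right (W : Submodule ℂ V) (f : V →ₗ[ℂ] V) (x y : W) :
    inner ℂ x (compression W f y) = inner ℂ (x : V) (f y) := by
  simp [compression]

theorem compression_one (W : Submodule ℂ V) : compression W 1 = 1 := by
  ext x
  simp [compression]

theorem compression_sub (W : Submodule ℂ V) (f g : V →ₗ[ℂ] V) :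
    compression W (f - g) = compression W f - compression W g := by
  ext x
  simp [compression]

theorem compression_mul (W : Submodule ℂ V) (f g : V →ₗ[ℂ] V) (hf : ∀ x ∈ Wᗮ, f x ∈ Wᗮ) :
    compression W (f * g) = compression W f * compression W g := by
  ext x
  have h := hf _ (W.sub_starProjection_mem_orthogonal (g x))
  rw [map_sub, ← W.orthogonalProjectionOnto_eq_zero_iff, map_sub, sub_eq_zero] at h
  simpa [compression] using congrArg Subtype.val h

theorem LinearMap.IsSymmetric.compression {f : V →ₗ[ℂ] V} (hf : f.IsSymmetric)
    (W : Submodule ℂ V) : (compression W f).IsSymmetric := fun x y ↦ by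
  rw [inner_compression_left, inner_compression_right, hf]

theorem LinearMap.IsPositive.compression {f : V →ₗ[ℂ] V} (hf : f.IsPositive)
    (W : Submodule ℂ V) : (compression W f).IsPositive :=
  ⟨hf.isSymmetric.compression W, fun x ↦ by
    rw [inner_compression_left]; exact hf.re_inner_nonneg_left x⟩

theorem trace_compression_add_orthogonal (W : Submodule ℂ V) (f : V →ₗ[ℂ] V) :
    LinearMap.trace ℂ W (compression W f) + LinearMap.trace ℂ Wᗮ (compression Wᗮ f)
      = LinearMap.trace ℂ V f := by
  have h : f = f ∘ₗ W.subtype ∘ₗ (W.orthogonalProjectionOnto : V →ₗ[ℂ] W) +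
      f ∘ₗ Wᗮ.subtype ∘ₗ (Wᗮ.orthogonalProjectionOnto : V →ₗ[ℂ] Wᗮ) := by
    rw [← LinearMap.comp_add]
    ext x
    exact congrArg f (W.starProjection_add_starProjection_orthogonal x).symm
  conv_rhs => rw [h, map_add, ← LinearMap.comp_assoc, ← LinearMap.comp_assoc,
    LinearMap.trace_comp_comm', LinearMap.trace_comp_comm' _ (f ∘ₗ Wᗮ.subtype)]
  rfl

end Compression

/-- The marginals and correlations of `P`, `Q`, `T` with respect to the weight `ρ`. -/
noncomputable def corr {d : ℕ} (ρ P Q T : Matrix (Fin d) (Fin d) ℂ) : Fin 6 → ℝ :=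
  ![(ρ * P).trace.re, (ρ * Q).trace.re, (ρ * T).trace.re,
    (ρ * (P * Q)).trace.re, (ρ * (P * T)).trace.re, (ρ * (Q * T)).trace.re]

/-- The tuples realised by triples of projections with respect to the normalised trace. -/
def normalizedCorrSet (d : ℕ) : Set (Fin 6 → ℝ) :=
  {v | ∃ P Q R : Matrix (Fin d) (Fin d) ℂ, IsProjn P ∧ IsProjn Q ∧ IsProjn R ∧
    v = corr ((d : ℂ)⁻¹ • 1) P Q R}

theorem isCompact_normalizedCorrSet (d : ℕ) : IsCompact (normalizedCorrSet d) := by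
  have hK := isCompact_setOf_isProjn d
  have hf : Continuous fun p : Matrix (Fin d) (Fin d) ℂ × Matrix (Fin d) (Fin d) ℂ ×
      Matrix (Fin d) (Fin d) ℂ ↦ corr ((d : ℂ)⁻¹ • 1) p.1 p.2.1 p.2.2 := by
    refine continuous_pi fun i ↦ ?_
    fin_cases i <;> simp [corr] <;> fun_prop
  convert (hK.prod (hK.prod hK)).image hf using 1
  ext v
  simp [normalizedCorrSet, eq_comm, and_assoc]

theorem syncTriple_iff_exists_corr (v : Fin 6 → ℝ) :
    SyncTriple (v 0) (v 1) (v 2) (v 3, v 4, v 5) ↔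
      ∃ (d : ℕ) (P Q R ρ : Matrix (Fin d) (Fin d) ℂ), IsProjn P ∧ IsProjn Q ∧ IsProjn R ∧
        ρ.PosSemidef ∧ ρ.trace = 1 ∧ Commute ρ P ∧ Commute ρ Q ∧ Commute ρ R ∧
        v = corr ρ P Q R := by
  have key (d : ℕ) (ρ P Q R : Matrix (Fin d) (Fin d) ℂ) : v = corr ρ P Q R ↔
      (ρ * P).trace.re = v 0 ∧ (ρ * Q).trace.re = v 1 ∧ (ρ * R).trace.re = v 2 ∧
      (v 3, v 4, v 5) = ((ρ * (P * Q)).trace.re, (ρ * (P * R)).trace.re,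
        (ρ * (Q * R)).trace.re) := by
    simp [funext_iff, Fin.forall_fin_succ, corr, eq_comm]
  simp only [SyncTriple, key]
  constructor
  · rintro ⟨d, -, P, Q, R, ρ, h⟩
    exact ⟨d, P, Q, R, ρ, h⟩
  · rintro ⟨d, P, Q, R, ρ, h⟩
    refine ⟨d, Nat.pos_of_ne_zero ?_, P, Q, R, ρ, h⟩
    rintro rfl
    simpa using h.2.2.2.2.1

/-- The block-diagonal sum of two square matrices, indexed by `Fin (m + n)`. -/
def blockSum {m n : ℕ} (A : Matrix (Fin m) (Fin m) ℂ) (B : Matrix (Fin n) (Fin n) ℂ) :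
    Matrix (Fin (m + n)) (Fin (m + n)) ℂ :=
  Matrix.reindex finSumFinEquiv finSumFinEquiv (Matrix.fromBlocks A 0 0 B)

section BlockSum

variable {m n : ℕ} {A A' : Matrix (Fin m) (Fin m) ℂ} {B B' : Matrix (Fin n) (Fin n) ℂ}

theorem blockSum_mul_blockSum : blockSum A B * blockSum A' B' = blockSum (A * A') (B * B') := by
  simp [blockSum, Matrix.submatrix_mul_equiv, Matrix.fromBlocks_multiply]

theorem trace_blockSum : (blockSum A B).trace = A.trace + B.trace := by
  simp [blockSum, Matrix.trace, Fin.sum_univ_add]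

theorem IsProjn.blockSum (hA : IsProjn A) (hB : IsProjn B) : IsProjn (blockSum A B) := by
  refine ⟨?_, by rw [blockSum_mul_blockSum, hA.2, hB.2]⟩
  exact (hA.1.fromBlocks (by simp) hB.1).submatrix _

theorem Matrix.PosSemidef.blockSum (hA : A.PosSemidef) (hB : B.PosSemidef) :
    (_root_.blockSum A B).PosSemidef := by
  suffices h : (Matrix.fromBlocks A 0 0 B).PosSemidef from h.submatrix _
  rw [Matrix.posSemidef_iff_dotProduct_mulVec]
  refine ⟨hA.1.fromBlocks (by simp) hB.1, fun x ↦ ?_⟩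
  have h1 := hA.dotProduct_mulVec_nonneg (x ∘ Sum.inl)
  have h2 := hB.dotProduct_mulVec_nonneg (x ∘ Sum.inr)
  convert add_nonneg h1 h2
  simp [Matrix.fromBlocks_mulVec, dotProduct, Fintype.sum_sum_type]

theorem Commute.blockSum (hA : Commute A A') (hB : Commute B B') :
    Commute (blockSum A B) (blockSum A' B') := by
  rw [commute_iff_eq, blockSum_mul_blockSum, blockSum_mul_blockSum, hA.eq, hB.eq]

end BlockSum

theorem convex_setOf_syncTriple :
    Convex ℝ {v : Fin 6 → ℝ | SyncTriple (v 0) (v 1) (v 2) (v 3, v 4, v 5)} := by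
  simp only [syncTriple_iff_exists_corr]
  rintro _ ⟨m, P, Q, R, ρ, hP, hQ, hR, hρ, htr, hρP, hρQ, hρR, rfl⟩
    _ ⟨n, P', Q', R', ρ', hP', hQ', hR', hρ', htr', hρP', hρQ', hρR', rfl⟩ a b ha hb hab
  have ha' : (0 : ℂ) ≤ a := by exact_mod_cast ha
  have hb' : (0 : ℂ) ≤ b := by exact_mod_cast hb
  refine ⟨m + n, blockSum P P', blockSum Q Q', blockSum R R',
    blockSum ((a : ℂ) • ρ) ((b : ℂ) • ρ'), hP.blockSum hP', hQ.blockSum hQ', hR.blockSum hR',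
    (hρ.smul ha').blockSum (hρ'.smul hb'), ?_, (hρP.smul_left _).blockSum (hρP'.smul_left _),
    (hρQ.smul_left _).blockSum (hρQ'.smul_left _),
    (hρR.smul_left _).blockSum (hρR'.smul_left _), ?_⟩
  · rw [trace_blockSum, trace_smul, trace_smul, htr, htr']
    simpa using mod_cast hab
  · ext i
    fin_cases i <;> simp [corr, blockSum_mul_blockSum, trace_blockSum]

theorem normalizedCorrSet_subset {d : ℕ} (hd : d ≠ 0) :
    normalizedCorrSet d ⊆ {v | SyncTriple (v 0) (v 1) (v 2) (v 3, v 4, v 5)} := by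
  rintro v ⟨P, Q, R, hP, hQ, hR, hv⟩
  rw [Set.mem_ofPred_eq, syncTriple_iff_exists_corr]
  refine ⟨d, P, Q, R, (d : ℂ)⁻¹ • 1, hP, hQ, hR, Matrix.PosSemidef.one.smul (by simp), ?_,
    (Commute.one_left _).smul_left _, (Commute.one_left _).smul_left _,
    (Commute.one_left _).smul_left _, hv⟩
  simp [hd]

theorem diagonal_mem_convexHull_isProjn {d : ℕ} {a : Fin d → ℝ} (h0 : ∀ i, 0 ≤ a i)
    (h1 : ∀ i, a i ≤ 1) :
    Matrix.diagonal (fun i ↦ (a i : ℂ)) ∈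
      convexHull ℝ {P : Matrix (Fin d) (Fin d) ℂ | IsProjn P} := by
  let D : (Fin d → ℝ) →ₗ[ℝ] Matrix (Fin d) (Fin d) ℂ :=
    Matrix.diagonalLinearMap (Fin d) ℝ ℂ ∘ₗ Complex.ofRealCLM.toLinearMap.compLeft (Fin d)
  have ha : a ∈ convexHull ℝ (Set.univ.pi fun _ : Fin d ↦ ({0, 1} : Set ℝ)) := by
    rw [convexHull_pi]
    intro i _
    rw [convexHull_pair, segment_eq_Icc zero_le_one]
    exact ⟨h0 i, h1 i⟩
  have hD := Set.mem_image_of_mem D ha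
  rw [D.image_convexHull] at hD
  refine convexHull_mono ?_ hD
  rintro _ ⟨x, hx, rfl⟩
  have hx' : D x = Matrix.diagonal fun i ↦ (x i : ℂ) := rfl
  rw [Set.mem_ofPred_eq, hx', IsProjn]
  refine ⟨Matrix.isHermitian_diagonal_of_self_adjoint _ ?_, ?_⟩
  · ext i; simp
  · rw [Matrix.diagonal_mul_diagonal]
    congr 1
    ext i
    rcases hx i trivial with h | h <;> simp_all

theorem corr_add_smul {d : ℕ} (ρ P Q T T' : Matrix (Fin d) (Fin d) ℂ) {a b : ℝ} (hab : a + b = 1) :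
    corr ρ P Q (a • T + b • T') = a • corr ρ P Q T + b • corr ρ P Q T' := by
  have h (x : ℝ) : x = a * x + b * x := by rw [← add_mul, hab, one_mul]
  ext i
  fin_cases i <;> simp [corr, mul_add, ← h]

theorem corr_mem_convexHull_normalizedCorrSet {d : ℕ} {P Q T : Matrix (Fin d) (Fin d) ℂ}
    (hP : IsProjn P) (hQ : IsProjn Q)
    (hT : T ∈ convexHull ℝ {R : Matrix (Fin d) (Fin d) ℂ | IsProjn R}) :
    corr ((d : ℂ)⁻¹ • 1) P Q T ∈ convexHull ℝ (normalizedCorrSet d) := by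
  have hconv : Convex ℝ {R | corr ((d : ℂ)⁻¹ • 1) P Q R ∈ convexHull ℝ (normalizedCorrSet d)} := by
    intro R hR R' hR' a b ha hb hab
    rw [Set.mem_ofPred_eq, corr_add_smul _ _ _ _ _ hab]
    exact convex_convexHull ℝ _ hR hR' ha hb hab
  refine convexHull_min ?_ hconv hT
  exact fun R hR ↦ subset_convexHull ℝ _ ⟨P, Q, R, hP, hQ, hR, rfl⟩

section Operators

variable {V : Type*} [NormedAddCommGroup V] [InnerProductSpace ℂ V] [FiniteDimensional ℂ V]

/-- The operator version of `corr`. -/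
noncomputable def opCorr (ρ P Q T : V →ₗ[ℂ] V) : Fin 6 → ℝ :=
  ![(LinearMap.trace ℂ V (ρ * P)).re, (LinearMap.trace ℂ V (ρ * Q)).re,
    (LinearMap.trace ℂ V (ρ * T)).re, (LinearMap.trace ℂ V (ρ * (P * Q))).re,
    (LinearMap.trace ℂ V (ρ * (P * T))).re, (LinearMap.trace ℂ V (ρ * (Q * T))).re]

theorem trace_toMatrixOrthonormal {ι : Type*} [Fintype ι] [DecidableEq ι]
    (b : OrthonormalBasis ι ℂ V) (f : V →ₗ[ℂ] V) :
    (LinearMap.toMatrixOrthonormal b f).trace = LinearMap.trace ℂ V f :=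
  (LinearMap.trace_eq_matrix_trace ℂ b.toBasis f).symm

theorem corr_toMatrixOrthonormal {d : ℕ} (b : OrthonormalBasis (Fin d) ℂ V)
    (ρ P Q T : V →ₗ[ℂ] V) :
    corr (LinearMap.toMatrixOrthonormal b ρ) (LinearMap.toMatrixOrthonormal b P)
      (LinearMap.toMatrixOrthonormal b Q) (LinearMap.toMatrixOrthonormal b T) =
      opCorr ρ P Q T := by
  simp only [corr, opCorr, ← map_mul, trace_toMatrixOrthonormal]

theorem LinearMap.IsSymmetricProjection.isProjn_toMatrixOrthonormal {d : ℕ} {P : V →ₗ[ℂ] V}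
    (hP : P.IsSymmetricProjection) (b : OrthonormalBasis (Fin d) ℂ V) :
    IsProjn (LinearMap.toMatrixOrthonormal b P) := by
  constructor
  · have h : star P = P := (LinearMap.isSymmetric_iff_isSelfAdjoint P).1 hP.isSymmetric
    rw [Matrix.IsHermitian, ← star_eq_conjTranspose, ← map_star, h]
  · rw [← map_mul, hP.isIdempotentElem.eq]

theorem opCorr_smul_one_mem {P Q T : V →ₗ[ℂ] V} (hP : P.IsSymmetricProjection)
    (hQ : Q.IsSymmetricProjection) (hT : T.IsPositive) (hT' : (1 - T).IsPositive)
    (hV : Module.finrank ℂ V ≠ 0) (μ : ℝ) :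
    opCorr ((μ : ℂ) • 1) P Q T ∈ (LinearMap.trace ℂ V ((μ : ℂ) • 1)).re •
      convexHull ℝ (normalizedCorrSet (Module.finrank ℂ V)) := by
  set n := Module.finrank ℂ V with hn
  let b := hT.isSymmetric.eigenvectorBasis hn.symm
  have hdiag : LinearMap.toMatrixOrthonormal b T =
      Matrix.diagonal fun i ↦ (hT.isSymmetric.eigenvalues hn.symm i : ℂ) := by
    ext i j
    rw [LinearMap.toMatrixOrthonormal_apply_apply, hT.isSymmetric.apply_eigenvectorBasis,
      inner_smul_right, orthonormal_iff_ite.1 b.orthonormal, Matrix.diagonal_apply]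
    aesop
  have h1 (i : Fin n) : hT.isSymmetric.eigenvalues hn.symm i ≤ 1 := by
    have h := hT'.re_inner_nonneg_left (b i)
    rw [LinearMap.sub_apply, hT.isSymmetric.apply_eigenvectorBasis, Module.End.one_apply,
      inner_sub_left, inner_smul_left, orthonormal_iff_ite.1 b.orthonormal] at h
    simpa using h
  refine ⟨corr ((n : ℂ)⁻¹ • 1) (LinearMap.toMatrixOrthonormal b P)
    (LinearMap.toMatrixOrthonormal b Q) (LinearMap.toMatrixOrthonormal b T),
    corr_mem_convexHull_normalizedCorrSet (hP.isProjn_toMatrixOrthonormal b)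
      (hQ.isProjn_toMatrixOrthonormal b) ?_, ?_⟩
  · rw [hdiag]
    exact diagonal_mem_convexHull_isProjn (hT.nonneg_eigenvalues _) h1
  · rw [← corr_toMatrixOrthonormal b]
    have : (n : ℝ) ≠ 0 := by exact_mod_cast hV
    ext i
    fin_cases i <;> simp [corr, ← hn] <;> field_simp

theorem exists_invariant_finrank_le_two [Nontrivial V] {ρ P Q : V →ₗ[ℂ] V} (hρ : ρ.IsSymmetric)
    (hP : P.IsSymmetricProjection) (hQ : Q.IsSymmetricProjection) (hρP : Commute ρ P)
    (hρQ : Commute ρ Q) :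
    ∃ (W : Submodule ℂ V) (μ : ℝ), W ≠ ⊥ ∧ Module.finrank ℂ W ≤ 2 ∧ (∀ x ∈ W, P x ∈ W) ∧
      (∀ x ∈ W, Q x ∈ W) ∧ ∀ x ∈ W, ρ x = (μ : ℂ) • x := by
  have hPP := hP.isIdempotentElem.eq
  have hQQ := hQ.isIdempotentElem.eq
  set z := (P - Q) * (P - Q) with hz
  have hzsymm : z.IsSymmetric := fun x y ↦ by
    have h := hP.isSymmetric.sub hQ.isSymmetric
    rw [hz, Module.End.mul_apply, Module.End.mul_apply, h, h]
  have hρz : Commute ρ z := (hρP.sub_right hρQ).mul_right (hρP.sub_right hρQ)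
  have hPz : Commute P z := by
    rw [commute_iff_eq, hz]
    simp only [mul_sub, sub_mul, mul_assoc, hPP]
    simp only [← mul_assoc, hPP, hQQ]
    abel
  have hcomm : Pairwise (Function.onFun Commute ![ρ, z, P]) := by
    intro i j hij
    fin_cases i <;> fin_cases j
    exacts [absurd rfl hij, hρz, hρP, hρz.symm, absurd rfl hij, hPz.symm, hρP.symm, hPz,
      absurd rfl hij]
  have hsymm (i : Fin 3) : (![ρ, z, P] i).IsSymmetric := by
    fin_cases i
    exacts [hρ, hzsymm, hP.isSymmetric]
  have htop := LinearMap.IsSymmetric.iSup_iInf_eq_top_of_commute hsymm hcomm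
  obtain ⟨χ, hχ⟩ : ∃ χ : Fin 3 → ℂ, ⨅ i, Module.End.eigenspace (![ρ, z, P] i) (χ i) ≠ ⊥ := by
    by_contra! h
    simp [h] at htop
  obtain ⟨v, hv, hv0⟩ := Submodule.exists_mem_ne_zero_of_ne_bot hχ
  rw [Submodule.mem_iInf] at hv
  have hρv : ρ v = χ 0 • v := Module.End.mem_eigenspace_iff.1 (hv 0)
  have hzv : z v = χ 1 • v := Module.End.mem_eigenspace_iff.1 (hv 1)
  have hPv : P v = χ 2 • v := Module.End.mem_eigenspace_iff.1 (hv 2)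
  have hμ : ((χ 0).re : ℂ) = χ 0 := Complex.conj_eq_iff_re.1 <|
    hρ.conj_eigenvalue_eq_self (Module.End.hasEigenvalue_of_hasEigenvector ⟨hv 0, hv0⟩)
  have hQQv : Q (Q v) = Q v := DFunLike.congr_fun hQQ v
  have hPQv : P (Q v) = χ 2 • v + Q v - χ 2 • Q v - χ 1 • v := by
    have hPPv : P (P v) = P v := DFunLike.congr_fun hPP v
    have h : P (P v) - P (Q v) - (Q (P v) - Q (Q v)) = χ 1 • v := by
      rw [← hzv, hz]; simp
    rw [hPPv, hQQv, hPv, map_smul] at h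
    rw [← h]; abel
  refine ⟨Submodule.span ℂ {v, Q v}, (χ 0).re, fun h ↦ hv0 ?_, ?_, ?_, ?_, ?_⟩
  · exact (Submodule.eq_bot_iff _).1 h v (Submodule.subset_span (by simp))
  · classical
    have := finrank_span_finset_le_card (R := ℂ) ({v, Q v} : Finset V)
    rw [Finset.coe_pair] at this
    exact this.trans Finset.card_le_two
  all_goals
    intro x hx
    obtain ⟨a, b, rfl⟩ := Submodule.mem_span_pair.1 hx
  · refine Submodule.mem_span_pair.2 ⟨a * χ 2 + b * χ 2 - b * χ 1, b - b * χ 2, ?_⟩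
    rw [map_add, map_smul, map_smul, hPv, hPQv]
    module
  · refine Submodule.mem_span_pair.2 ⟨0, a + b, ?_⟩
    rw [map_add, map_smul, map_smul, hQQv]
    module
  · have : ρ (Q v) = χ 0 • Q v := by
      rw [← map_smul, ← hρv]; exact DFunLike.congr_fun hρQ.eq v
    rw [map_add, map_smul, map_smul, this, hρv, hμ]
    module

theorem opCorr_compression_add_orthogonal {W : Submodule ℂ V} {ρ P Q : V →ₗ[ℂ] V}
    (T : V →ₗ[ℂ] V) (hρ : ∀ x ∈ W, ρ x ∈ W) (hP : ∀ x ∈ W, P x ∈ W) (hQ : ∀ x ∈ W, Q x ∈ W)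
    (hρ' : ∀ x ∈ Wᗮ, ρ x ∈ Wᗮ) (hP' : ∀ x ∈ Wᗮ, P x ∈ Wᗮ) (hQ' : ∀ x ∈ Wᗮ, Q x ∈ Wᗮ) :
    opCorr (compression W ρ) (compression W P) (compression W Q) (compression W T) +
      opCorr (compression Wᗮ ρ) (compression Wᗮ P) (compression Wᗮ Q) (compression Wᗮ T) =
      opCorr ρ P Q T := by
  rw [← W.orthogonal_orthogonal] at hρ hP hQ
  simp [opCorr, ← trace_compression_add_orthogonal W,
    fun g ↦ compression_mul W ρ g hρ', fun g ↦ compression_mul W P g hP',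
    fun g ↦ compression_mul W Q g hQ', fun g ↦ compression_mul Wᗮ ρ g hρ,
    fun g ↦ compression_mul Wᗮ P g hP, fun g ↦ compression_mul Wᗮ Q g hQ]

theorem LinearMap.IsSymmetricProjection.compression {P : V →ₗ[ℂ] V}
    (hP : P.IsSymmetricProjection) {W : Submodule ℂ V} (h : ∀ x ∈ Wᗮ, P x ∈ Wᗮ) :
    (compression W P).IsSymmetricProjection :=
  ⟨by rw [IsIdempotentElem, ← compression_mul W P P h, hP.isIdempotentElem.eq],
    hP.isSymmetric.compression W⟩

theorem Commute.compression {f g : V →ₗ[ℂ] V} (hfg : Commute f g) {W : Submodule ℂ V}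
    (hf : ∀ x ∈ Wᗮ, f x ∈ Wᗮ) (hg : ∀ x ∈ Wᗮ, g x ∈ Wᗮ) :
    Commute (compression W f) (compression W g) := by
  rw [commute_iff_eq, ← compression_mul W f g hf, ← compression_mul W g f hg, hfg.eq]

end Operators

theorem opCorr_mem_trace_smul {K : Set (Fin 6 → ℝ)} (hK : Convex ℝ K) (hne : K.Nonempty)
    (h1 : normalizedCorrSet 1 ⊆ K) (h2 : normalizedCorrSet 2 ⊆ K)
    {V : Type*} [NormedAddCommGroup V] [InnerProductSpace ℂ V] [FiniteDimensional ℂ V]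
    {ρ P Q T : V →ₗ[ℂ] V} (hρ : ρ.IsPositive) (hP : P.IsSymmetricProjection)
    (hQ : Q.IsSymmetricProjection) (hT : T.IsPositive) (hT' : (1 - T).IsPositive)
    (hρP : Commute ρ P) (hρQ : Commute ρ Q) :
    opCorr ρ P Q T ∈ (LinearMap.trace ℂ V ρ).re • K := by
  induction hn : Module.finrank ℂ V using Nat.strong_induction_on generalizing V with
  | _ n ih =>
  subst hn
  rcases subsingleton_or_nontrivial V with hV | hV
  · have h0 (f : V →ₗ[ℂ] V) : LinearMap.trace ℂ V f = 0 := by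
      rw [Subsingleton.elim f 0, map_zero]
    rw [h0, Complex.zero_re, Set.zero_smul_set hne, Set.mem_zero]
    ext i
    fin_cases i <;> simp [opCorr, h0]
  obtain ⟨W, μ, hW, hW2, hPW, hQW, hρW⟩ :=
    exists_invariant_finrank_le_two hρ.isSymmetric hP hQ hρP hρQ
  have hρW' : ∀ x ∈ W, ρ x ∈ W := fun x hx ↦ hρW x hx ▸ W.smul_mem _ hx
  have hPo := hP.isSymmetric.mem_orthogonal_of_invariant hPW
  have hQo := hQ.isSymmetric.mem_orthogonal_of_invariant hQW
  have hρo := hρ.isSymmetric.mem_orthogonal_of_invariant hρW'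
  have hcW : compression W ρ = (μ : ℂ) • 1 := by
    ext x
    simp [compression, hρW x x.2]
  have hcompl {U : Submodule ℂ V} : (1 - compression U T).IsPositive := by
    rw [← compression_one, ← compression_sub]
    exact hT'.compression U
  have hWpos : Module.finrank ℂ W ≠ 0 := by
    rwa [Ne, Submodule.finrank_eq_zero]
  rw [← opCorr_compression_add_orthogonal T hρW' hPW hQW hρo hPo hQo,
    ← trace_compression_add_orthogonal W, Complex.add_re, hK.add_smul
      (Complex.nonneg_iff.1 (hρ.compression W).trace_nonneg).1
      (Complex.nonneg_iff.1 (hρ.compression Wᗮ).trace_nonneg).1]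
  refine Set.add_mem_add ?_ (ih _ ?_ (hρ.compression _) (hP.compression ?_) (hQ.compression ?_)
    (hT.compression _) hcompl (hρP.compression ?_ ?_) (hρQ.compression ?_ ?_) rfl)
  · rw [hcW]
    refine Set.smul_set_mono (convexHull_min ?_ hK) (opCorr_smul_one_mem (hP.compression hPo)
      (hQ.compression hQo) (hT.compression W) hcompl hWpos μ)
    obtain h | h : Module.finrank ℂ W = 1 ∨ Module.finrank ℂ W = 2 := by omega
    · rwa [h]
    · rwa [h]
  · have := W.finrank_add_finrank_orthogonal
    omega
  all_goals rwa [W.orthogonal_orthogonal]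

theorem setOf_syncTriple_eq_convexHull :
    {v : Fin 6 → ℝ | SyncTriple (v 0) (v 1) (v 2) (v 3, v 4, v 5)} =
      convexHull ℝ (normalizedCorrSet 1 ∪ normalizedCorrSet 2) := by
  refine subset_antisymm (fun v hv ↦ ?_) (convexHull_min (Set.union_subset
    (normalizedCorrSet_subset one_ne_zero) (normalizedCorrSet_subset two_ne_zero))
    convex_setOf_syncTriple)
  obtain ⟨d, P, Q, R, ρ, hP, hQ, hR, hρ, htr, hρP, hρQ, -, rfl⟩ :=
    (syncTriple_iff_exists_corr v).1 hv
  let b := EuclideanSpace.basisFun (Fin d) ℂ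
  let e := LinearMap.toMatrixOrthonormal b
  have hproj {A : Matrix (Fin d) (Fin d) ℂ} (hA : IsProjn A) :
      (e.symm A).IsSymmetricProjection := by
    constructor
    · rw [IsIdempotentElem, ← map_mul, hA.2]
    · rw [LinearMap.isSymmetric_iff_isSelfAdjoint, IsSelfAdjoint, ← map_star,
        star_eq_conjTranspose, hA.1]
  have hρe : (e.symm ρ).IsPositive := by
    rw [← LinearMap.posSemidef_toMatrix_iff b]
    change (e (e.symm ρ)).PosSemidef
    rwa [e.apply_symm_apply]
  have hcomm {A : Matrix (Fin d) (Fin d) ℂ} (hA : Commute ρ A) :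
      Commute (e.symm ρ) (e.symm A) := hA.map e.symm
  have hne : (convexHull ℝ (normalizedCorrSet 1 ∪ normalizedCorrSet 2)).Nonempty := by
    have h0 : IsProjn (0 : Matrix (Fin 1) (Fin 1) ℂ) := ⟨by simp, by simp⟩
    exact ⟨_, subset_convexHull ℝ _ (Or.inl ⟨0, 0, 0, h0, h0, h0, rfl⟩)⟩
  have hR' : (1 - e.symm R).IsPositive := by
    rw [← map_one e.symm, ← map_sub]
    refine (hproj ⟨?_, ?_⟩).isPositive
    · exact Matrix.isHermitian_one.sub hR.1
    · rw [mul_sub, sub_mul, sub_mul, hR.2]; simp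
  have hmem := opCorr_mem_trace_smul (convex_convexHull ℝ _) hne
    (Set.subset_union_left.trans (subset_convexHull ℝ _))
    (Set.subset_union_right.trans (subset_convexHull ℝ _)) hρe (hproj hP) (hproj hQ)
    (hproj hR).isPositive hR' (hcomm hρP) (hcomm hρQ)
  rw [← trace_toMatrixOrthonormal b, ← corr_toMatrixOrthonormal b] at hmem
  simpa [e, htr] using hmem

/-- Closedness conclusion of Theorem 3.16: the set of all tuples
`(r₁, r₂, r₃, w₁₂, w₁₃, w₂₃) ∈ ℝ⁶` such that `(w₁₂, w₁₃, w₂₃)` is a synchronous quantum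
correlation triple with marginals `(r₁, r₂, r₃)` is closed. -/
theorem syncTriple_isClosed :
    IsClosed {v : Fin 6 → ℝ | SyncTriple (v 0) (v 1) (v 2) (v 3, v 4, v 5)} := by
  rw [setOf_syncTriple_eq_convexHull]
  exact ((isCompact_normalizedCorrSet 1).union
    (isCompact_normalizedCorrSet 2)).convexHull_of_finiteDimensional.isClosed
end

section
/- There exists a positive integer d ≤ 16 with the following property: for every synchronous quantum correlation triple (w₁₂, w₁₃, w₂₃) with marginals (r₁, r₂, r₃), there exist 16×16 complex matrices P₁, P₂, P₃ that are orthogonal projections and a positive semidefinite 16×16 complex matrix ρ with Tr ρ = 1 commuting with each Pᵢ, such that Re Tr(ρPᵢ) = rᵢ for i = 1,2,3 and w₁₂ = Re Tr(ρP₁P₂), w₁₃ = Re Tr(ρP₁P₃), w₂₃ = Re Tr(ρP₂P₃). In other words, every synchronous quantum correlation triple is realizable on a Hilbert space of dimension 16. -/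
open Matrix
open scoped Pointwise ComplexOrder

/-- The real-linear functional `X ↦ Re Tr(σX)`. -/
noncomputable def reTrace {n : Type*} [Fintype n] (σ : Matrix n n ℂ) :
    Matrix n n ℂ →ₗ[ℝ] ℝ where
  toFun X := (σ * X).trace.re
  map_add' X Y := by simp [Matrix.mul_add]
  map_smul' c X := by simp

section reTrace

variable {n : Type*} [Fintype n] {σ X Y : Matrix n n ℂ}

lemma reTrace_apply (σ X : Matrix n n ℂ) : reTrace σ X = (σ * X).trace.re := rfl

lemma Commute.reTrace_mul_comm (h : Commute σ X) (Y : Matrix n n ℂ) :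
    reTrace σ (X * Y) = reTrace σ (Y * X) := by
  rw [reTrace_apply, reTrace_apply, ← Matrix.mul_assoc, h.eq, Matrix.mul_assoc,
    Matrix.trace_mul_comm, Matrix.mul_assoc]

lemma reTrace_sum_left {ι : Type*} (s : Finset ι) (f : ι → Matrix n n ℂ) (X : Matrix n n ℂ) :
    reTrace (∑ i ∈ s, f i) X = ∑ i ∈ s, reTrace (f i) X := by
  simp [reTrace_apply, Finset.sum_mul]

lemma Matrix.PosSemidef.reTrace_mul_conjTranspose_nonneg (hσ : σ.PosSemidef)
    (Y : Matrix n n ℂ) : 0 ≤ reTrace σ (Y * Yᴴ) := by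
  have h := (hσ.conjTranspose_mul_mul_same Y).trace_nonneg
  rw [Matrix.mul_assoc, Matrix.trace_mul_comm, Matrix.mul_assoc] at h
  exact (Complex.le_def.mp h).1

lemma Matrix.PosSemidef.reTrace_mul_self_nonneg (hσ : σ.PosSemidef) (hY : Y.IsHermitian) :
    0 ≤ reTrace σ (Y * Y) := by
  simpa [hY.eq] using hσ.reTrace_mul_conjTranspose_nonneg Y

/-- If `A` and, relative to the support of `σ`, also `X` are nonnegative multiples of
projections, and `X` commutes with `σ`, then `Re Tr(σAX)` is nonnegative. -/
lemma Matrix.PosSemidef.reTrace_mul_nonneg (hσ : σ.PosSemidef) {A : Matrix n n ℂ}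
    (hA : A.IsHermitian) (hAA : A * A = (2 : ℝ) • A) (hX : X.IsHermitian)
    (hσX : Commute σ X) {c : ℝ} (hc : 0 < c) (hXX : σ * (X * X) = c • (σ * X)) :
    0 ≤ reTrace σ (A * X) := by
  have h := hσ.reTrace_mul_conjTranspose_nonneg (X * A)
  have e : reTrace σ (X * A * (X * A)ᴴ) = 2 * c * reTrace σ (A * X) := by
    rw [conjTranspose_mul, hA.eq, hX.eq, Matrix.mul_assoc, ← Matrix.mul_assoc A A X, hAA]
    rw [smul_mul_assoc, mul_smul_comm, map_smul, ← Matrix.mul_assoc,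
      ← (hσX.reTrace_mul_comm (X * A)), ← Matrix.mul_assoc, reTrace_apply, ← Matrix.mul_assoc,
      hXX, smul_mul_assoc, trace_smul, Matrix.mul_assoc, ← (hσX.reTrace_mul_comm A),
      reTrace_apply]
    simp
    ring
  rw [e] at h
  by_contra! hn
  nlinarith

lemma Matrix.PosSemidef.reTrace_eq_zero (hσ : σ.PosSemidef) [DecidableEq n]
    (h : reTrace σ 1 = 0) (X : Matrix n n ℂ) : reTrace σ X = 0 := by
  have h0 : σ = 0 := by
    rw [← hσ.trace_eq_zero_iff]
    apply Complex.ext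
    · simpa [reTrace_apply] using h
    · exact (Complex.le_def.mp hσ.trace_nonneg).2.symm
  simp [h0, reTrace_apply]

end reTrace

/-- Self-adjoint unitary matrices. -/
def IsReflection {n : Type*} [Fintype n] [DecidableEq n] (U : Matrix n n ℂ) : Prop :=
  U.IsHermitian ∧ U * U = 1

/-- The sign `±1` encoded by a Boolean. -/
def boolSign (b : Bool) : ℝ := cond b 1 (-1)

/-- The sign vectors in `{±1}³`. -/
def signVector (v : Bool × Bool × Bool) : Fin 3 → ℝ :=
  ![boolSign v.1, boolSign v.2.1, boolSign v.2.2]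

/-- The cone generated by the pairs `(ε, εεᵀ)`, `ε ∈ {±1}³`, and by the pairs `(0, G)` with `G` in
the elliptope of `3 × 3` correlation matrices. -/
def IsQubitMoment (m : Fin 3 → ℝ) (C : Matrix (Fin 3) (Fin 3) ℝ) : Prop :=
  ∃ (μ : Bool × Bool × Bool → ℝ) (G : Matrix (Fin 3) (Fin 3) ℝ),
    (∀ v, 0 ≤ μ v) ∧ G.PosSemidef ∧ (∀ i, G i i = G 0 0) ∧
    m = ∑ v, μ v • signVector v ∧
    C = ∑ v, μ v • Matrix.vecMulVec (signVector v) (signVector v) + G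

lemma IsQubitMoment.zero : IsQubitMoment 0 0 :=
  ⟨0, 0, by simp, .zero, by simp, by simp, by simp⟩

lemma IsQubitMoment.add {m m' : Fin 3 → ℝ} {C C' : Matrix (Fin 3) (Fin 3) ℝ}
    (h : IsQubitMoment m C) (h' : IsQubitMoment m' C') : IsQubitMoment (m + m') (C + C') := by
  obtain ⟨μ, G, hμ, hG, hd, rfl, rfl⟩ := h
  obtain ⟨μ', G', hμ', hG', hd', rfl, rfl⟩ := h'
  refine ⟨μ + μ', G + G', fun v ↦ add_nonneg (hμ v) (hμ' v), hG.add hG',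
    fun i ↦ by simp [hd i, hd' i], ?_, ?_⟩
  · simp [add_smul, Finset.sum_add_distrib]
  · simp only [Pi.add_apply, add_smul, Finset.sum_add_distrib]
    abel

lemma IsQubitMoment.sum {ι : Type*} (s : Finset ι) {m : ι → Fin 3 → ℝ}
    {C : ι → Matrix (Fin 3) (Fin 3) ℝ} (h : ∀ i ∈ s, IsQubitMoment (m i) (C i)) :
    IsQubitMoment (∑ i ∈ s, m i) (∑ i ∈ s, C i) := by
  classical
  induction s using Finset.induction_on with
  | empty => simpa using IsQubitMoment.zero
  | insert a s ha ih =>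
    rw [Finset.sum_insert ha, Finset.sum_insert ha]
    exact (h a (by simp)).add (ih fun i hi ↦ h i (by simp [hi]))

lemma isQubitMoment_of_isotropic {s m t a b : ℝ} (ht : t ^ 2 ≤ 1)
    (h : ∀ x y : ℝ, |x * a + y * b| ≤ (s - |m|) * √(x ^ 2 + y ^ 2 + 2 * x * y * t))
    (hs : |m| ≤ s) :
    IsQubitMoment ![m, 0, 0] !![s, a, b; a, s, t * s; b, t * s, s] := by
  have ht' := abs_le_one_iff_mul_self_le_one.mpr (by simpa [sq] using ht)
  obtain ⟨ht1, ht2⟩ := abs_le.mp ht'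
  refine ⟨fun v ↦ (|m| + boolSign v.1 * m) / 2 * ((1 + boolSign v.2.1 * boolSign v.2.2 * t) / 4),
    !![s - |m|, a, b; a, s - |m|, t * (s - |m|); b, t * (s - |m|), s - |m|], ?_, ?_, ?_, ?_, ?_⟩
  · have h1 := neg_abs_le m
    have h2 := le_abs_self m
    rintro ⟨_ | _, _ | _, _ | _⟩ <;> simp only [boolSign, cond] <;>
      apply mul_nonneg <;> linarith
  · refine .of_dotProduct_mulVec_nonneg ?_ fun x ↦ ?_
    · ext i j
      fin_cases i <;> fin_cases j <;> simp
    · have hq := h (x 1) (x 2)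
      set z := √(x 1 ^ 2 + x 2 ^ 2 + 2 * x 1 * x 2 * t)
      have hz : z ^ 2 = x 1 ^ 2 + x 2 ^ 2 + 2 * x 1 * x 2 * t :=
        Real.sq_sqrt (by nlinarith [sq_nonneg (x 1 + x 2), sq_nonneg (x 1 - x 2)])
      have hp : -((s - |m|) * (|x 0| * z)) ≤ x 0 * (x 1 * a + x 2 * b) := by
        have := neg_abs_le (x 0 * (x 1 * a + x 2 * b))
        rw [abs_mul] at this
        nlinarith [mul_le_mul_of_nonneg_left hq (abs_nonneg (x 0))]
      have hsq : 0 ≤ (s - |m|) * (|x 0| - z) ^ 2 := mul_nonneg (by linarith) (sq_nonneg _)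
      have e : star x ⬝ᵥ (!![s - |m|, a, b; a, s - |m|, t * (s - |m|);
          b, t * (s - |m|), s - |m|] *ᵥ x) =
          (s - |m|) * x 0 ^ 2 + 2 * (x 0 * (x 1 * a + x 2 * b)) +
            (s - |m|) * (x 1 ^ 2 + x 2 ^ 2 + 2 * x 1 * x 2 * t) := by
        simp [dotProduct, mulVec, Fin.sum_univ_three]
        ring
      rw [e, ← hz, ← sq_abs (x 0)]
      nlinarith
  · intro i
    fin_cases i <;> simp
  · ext i
    fin_cases i <;> simp [Fintype.sum_prod_type, boolSign, signVector]
    ring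
  · ext i j
    fin_cases i <;> fin_cases j <;>
      simp [Fintype.sum_prod_type, boolSign, signVector] <;> ring

lemma isQubitMoment_of_parallel {s m₁ m₂ t c : ℝ} (ht : t ^ 2 = 1)
    (h : ∀ p q : Bool,
      0 ≤ s + boolSign p * m₁ + boolSign q * m₂ + boolSign p * boolSign q * c) :
    IsQubitMoment ![m₁, m₂, t * m₂] !![s, c, t * c; c, s, t * s; t * c, t * s, s] := by
  refine ⟨fun v ↦ (s + boolSign v.1 * m₁ + boolSign v.2.1 * m₂ +
    boolSign v.1 * boolSign v.2.1 * c) / 4 * ((1 + boolSign v.2.1 * boolSign v.2.2 * t) / 2),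
    0, ?_, .zero, by simp, ?_, ?_⟩
  · intro v
    refine mul_nonneg (by linarith [h v.1 v.2.1]) ?_
    rcases sq_eq_sq_iff_eq_or_eq_neg.mp (ht.trans (one_pow 2).symm) with rfl | rfl <;>
      rcases v with ⟨_, _ | _, _ | _⟩ <;> simp [boolSign]
  · ext i
    fin_cases i <;> simp [Fintype.sum_prod_type, boolSign, signVector] <;> ring
  · ext i j
    fin_cases i <;> fin_cases j <;>
      simp [Fintype.sum_prod_type, boolSign, signVector] <;> ring

section reflections

variable {n : Type*} [Fintype n] [DecidableEq n]

lemma IsReflection.one_add_smul {U : Matrix n n ℂ} (h : IsReflection U) {ε : ℝ}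
    (hε : ε ^ 2 = 1) :
    (1 + ε • U).IsHermitian ∧ (1 + ε • U) * (1 + ε • U) = (2 : ℝ) • (1 + ε • U) := by
  refine ⟨Matrix.isHermitian_one.add (h.1.smul (IsSelfAdjoint.all ε)), ?_⟩
  simp only [add_mul, mul_add, one_mul, mul_one, smul_mul_assoc, mul_smul_comm, h.2, smul_add]
  rw [smul_smul ε ε, ← sq, hε]
  module

lemma boolSign_sq (b : Bool) : boolSign b ^ 2 = 1 := by cases b <;> simp [boolSign]

variable {σ U₁ U₂ U₃ : Matrix n n ℂ} {t : ℝ}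

lemma reTrace_eq_mul_of_anticommutator (h₂ : IsReflection U₂) (h₃ : IsReflection U₃)
    (hσ₂ : Commute σ U₂) (hσ₃ : Commute σ U₃)
    (ht : σ * (U₂ * U₃ + U₃ * U₂) = (2 * t) • σ) :
    reTrace σ U₂ = t * reTrace σ U₃ ∧ reTrace σ U₃ = t * reTrace σ U₂ := by
  have key (X : Matrix n n ℂ) :
      reTrace σ ((U₂ * U₃ + U₃ * U₂) * X) = 2 * t * reTrace σ X := by
    rw [reTrace_apply, ← Matrix.mul_assoc, ht]
    simp [reTrace_apply]
  constructor
  · have h := key U₃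
    rw [add_mul, map_add, Matrix.mul_assoc U₃, hσ₃.reTrace_mul_comm, Matrix.mul_assoc, h₃.2,
      mul_one] at h
    linarith
  · have h := key U₂
    rw [add_mul, map_add, Matrix.mul_assoc U₂, hσ₂.reTrace_mul_comm, Matrix.mul_assoc, h₂.2,
      mul_one] at h
    linarith

lemma abs_reTrace_add_le (hσ : σ.PosSemidef) (h₁ : IsReflection U₁) (h₂ : IsReflection U₂)
    (h₃ : IsReflection U₃) (hσ₂ : Commute σ U₂) (hσ₃ : Commute σ U₃)
    (ht : σ * (U₂ * U₃ + U₃ * U₂) = (2 * t) • σ) (ht1 : t ^ 2 < 1)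
    (hψ₂ : reTrace σ U₂ = 0) (hψ₃ : reTrace σ U₃ = 0) (x y : ℝ) :
    |x * reTrace σ (U₁ * U₂) + y * reTrace σ (U₁ * U₃)| ≤
      (reTrace σ 1 - |reTrace σ U₁|) * √(x ^ 2 + y ^ 2 + 2 * x * y * t) := by
  have hsum : x ^ 2 + y ^ 2 + 2 * x * y * t = (x + t * y) ^ 2 + (1 - t ^ 2) * y ^ 2 := by ring
  have hnn : 0 ≤ x ^ 2 + y ^ 2 + 2 * x * y * t := by
    rw [hsum]
    have : 0 ≤ 1 - t ^ 2 := by linarith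
    positivity
  set z := √(x ^ 2 + y ^ 2 + 2 * x * y * t)
  have hz : z ^ 2 = x ^ 2 + y ^ 2 + 2 * x * y * t := Real.sq_sqrt hnn
  have hz0 : 0 ≤ z := Real.sqrt_nonneg _
  rcases hz0.eq_or_lt with h0 | hpos
  · rw [← h0, hsum] at hz
    have hy : y = 0 := by
      by_contra hy
      have : 0 < (1 - t ^ 2) * y ^ 2 := mul_pos (by linarith) (by positivity)
      nlinarith [sq_nonneg (x + t * y)]
    have hx : x = 0 := by
      subst hy
      simpa using hz.symm
    simp [hx, hy, ← h0]
  have key (p q : Bool) : 0 ≤ reTrace σ 1 * z + boolSign p * (reTrace σ U₁ * z) +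
      boolSign p * boolSign q * (x * reTrace σ (U₁ * U₂) + y * reTrace σ (U₁ * U₃)) := by
    obtain ⟨hA, hAA⟩ := h₁.one_add_smul (boolSign_sq p)
    set Z := x • U₂ + y • U₃ with hZ
    have hZZ : σ * (Z * Z) = z ^ 2 • σ := by
      have e : Z * Z = (x ^ 2 + y ^ 2) • (1 : Matrix n n ℂ) +
          (x * y) • (U₂ * U₃ + U₃ * U₂) := by
        simp only [hZ, add_mul, mul_add, smul_mul_assoc, mul_smul_comm, h₂.2, h₃.2]
        module
      rw [e, mul_add, mul_smul_comm, mul_smul_comm, ht, mul_one, hz]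
      module
    have hXh : (z • (1 : Matrix n n ℂ) + boolSign q • Z).IsHermitian :=
      (Matrix.isHermitian_one.smul (IsSelfAdjoint.all z)).add
        (((h₂.1.smul (IsSelfAdjoint.all x)).add (h₃.1.smul (IsSelfAdjoint.all y))).smul
          (IsSelfAdjoint.all _))
    have hXc : Commute σ (z • (1 : Matrix n n ℂ) + boolSign q • Z) :=
      ((Commute.one_right σ).smul_right z).add_right
        (((hσ₂.smul_right x).add_right (hσ₃.smul_right y)).smul_right _)
    have hXX : σ * ((z • (1 : Matrix n n ℂ) + boolSign q • Z) * (z • 1 + boolSign q • Z)) =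
        (2 * z) • (σ * (z • 1 + boolSign q • Z)) := by
      have e : (z • (1 : Matrix n n ℂ) + boolSign q • Z) * (z • 1 + boolSign q • Z) =
          z ^ 2 • (1 : Matrix n n ℂ) + (2 * z * boolSign q) • Z + boolSign q ^ 2 • (Z * Z) := by
        simp only [add_mul, mul_add, smul_mul_assoc, mul_smul_comm, one_mul, mul_one]
        module
      rw [e, boolSign_sq]
      simp only [mul_add, mul_smul_comm, mul_one, hZZ]
      module
    have h := hσ.reTrace_mul_nonneg hA hAA hXh hXc (by positivity) hXX
    have e : (1 + boolSign p • U₁) * (z • 1 + boolSign q • Z) = z • (1 : Matrix n n ℂ) +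
        (boolSign q * x) • U₂ + (boolSign q * y) • U₃ + (boolSign p * z) • U₁ +
        (boolSign p * boolSign q * x) • (U₁ * U₂) +
        (boolSign p * boolSign q * y) • (U₁ * U₃) := by
      simp only [hZ, add_mul, mul_add, smul_mul_assoc, mul_smul_comm, one_mul, mul_one]
      module
    rw [e] at h
    simp only [map_add, map_smul, smul_eq_mul, hψ₂, hψ₃] at h
    linarith
  have k1 := key true true
  have k2 := key true false
  have k3 := key false true
  have k4 := key false false
  simp only [boolSign, cond] at k1 k2 k3 k4
  rw [abs_le, sub_mul]
  rcases abs_cases (reTrace σ U₁) with ⟨h, -⟩ | ⟨h, -⟩ <;> rw [h] <;> constructor <;> linarith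

/-- The moments of three reflections with respect to a positive semidefinite matrix `σ` that
commutes with two of them and relative to which their anticommutator is a scalar. -/
lemma isQubitMoment_of_anticommutator (hσ : σ.PosSemidef) (h₁ : IsReflection U₁)
    (h₂ : IsReflection U₂) (h₃ : IsReflection U₃) (hσ₂ : Commute σ U₂) (hσ₃ : Commute σ U₃)
    (ht : σ * (U₂ * U₃ + U₃ * U₂) = (2 * t) • σ) :
    IsQubitMoment (fun i ↦ reTrace σ (![U₁, U₂, U₃] i))
      (Matrix.of fun i j ↦ reTrace σ (![U₁, U₂, U₃] i * ![U₁, U₂, U₃] j)) := by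
  have h23 : reTrace σ (U₂ * U₃) = t * reTrace σ 1 := by
    have h : reTrace σ (U₂ * U₃ + U₃ * U₂) = 2 * t * reTrace σ 1 := by
      rw [reTrace_apply, ht]
      simp [reTrace_apply]
    rw [map_add, hσ₃.reTrace_mul_comm] at h
    linarith
  have hm : (fun i ↦ reTrace σ (![U₁, U₂, U₃] i)) =
      ![reTrace σ U₁, reTrace σ U₂, reTrace σ U₃] := by
    ext i
    fin_cases i <;> rfl
  have hC : (Matrix.of fun i j ↦ reTrace σ (![U₁, U₂, U₃] i * ![U₁, U₂, U₃] j)) =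
      !![reTrace σ 1, reTrace σ (U₁ * U₂), reTrace σ (U₁ * U₃);
        reTrace σ (U₁ * U₂), reTrace σ 1, t * reTrace σ 1;
        reTrace σ (U₁ * U₃), t * reTrace σ 1, reTrace σ 1] := by
    ext i j
    fin_cases i <;> fin_cases j <;>
      simp [h₁.2, h₂.2, h₃.2, h23, hσ₂.reTrace_mul_comm U₁, hσ₃.reTrace_mul_comm U₁,
        hσ₃.reTrace_mul_comm U₂]
  rw [hm, hC]
  obtain ⟨e2, e3⟩ := reTrace_eq_mul_of_anticommutator h₂ h₃ hσ₂ hσ₃ ht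
  have hs : 0 ≤ reTrace σ 1 := by
    simpa using hσ.reTrace_mul_self_nonneg (Y := 1) Matrix.isHermitian_one
  rcases hs.eq_or_lt with hs0 | hspos
  · have h0 := hσ.reTrace_eq_zero hs0.symm
    simp only [h0, mul_zero]
    convert IsQubitMoment.zero using 1
    · ext i
      fin_cases i <;> rfl
    · ext i j
      fin_cases i <;> fin_cases j <;> rfl
  have expand (x : ℝ) : reTrace σ ((x • U₁ + (U₃ - t • U₂)) * (x • U₁ + (U₃ - t • U₂))) =
      x ^ 2 * reTrace σ 1 + 2 * x * (reTrace σ (U₁ * U₃) - t * reTrace σ (U₁ * U₂)) +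
        (1 - t ^ 2) * reTrace σ 1 := by
    have e : (x • U₁ + (U₃ - t • U₂)) * (x • U₁ + (U₃ - t • U₂)) =
        x ^ 2 • (1 : Matrix n n ℂ) + x • (U₁ * U₃) + x • (U₃ * U₁) - (x * t) • (U₁ * U₂) -
          (x * t) • (U₂ * U₁) + (1 + t ^ 2) • (1 : Matrix n n ℂ) - t • (U₂ * U₃) -
          t • (U₃ * U₂) := by
      simp only [add_mul, mul_add, sub_mul, mul_sub, smul_mul_assoc, mul_smul_comm, h₁.2, h₂.2,
        h₃.2]
      module
    rw [e]
    simp only [map_add, map_sub, map_smul, smul_eq_mul, hσ₂.reTrace_mul_comm U₁,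
      hσ₃.reTrace_mul_comm U₁, hσ₃.reTrace_mul_comm U₂, h23]
    ring
  have hherm (x : ℝ) : (x • U₁ + (U₃ - t • U₂)).IsHermitian :=
    (h₁.1.smul (IsSelfAdjoint.all x)).add (h₃.1.sub (h₂.1.smul (IsSelfAdjoint.all t)))
  have hquad (x : ℝ) := (hσ.reTrace_mul_self_nonneg (hherm x)).trans_eq (expand x)
  have ht1 : t ^ 2 ≤ 1 := by
    have := hquad 0
    by_contra! h
    nlinarith
  rcases ht1.eq_or_lt with ht2 | ht2
  · have h13 : reTrace σ (U₁ * U₃) = t * reTrace σ (U₁ * U₂) := by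
      set D := reTrace σ (U₁ * U₃) - t * reTrace σ (U₁ * U₂) with hD
      have h := hquad (-D / reTrace σ 1)
      rw [ht2, sub_self, zero_mul, add_zero] at h
      have e : (-D / reTrace σ 1) ^ 2 * reTrace σ 1 + 2 * (-D / reTrace σ 1) * D =
          -(D ^ 2 / reTrace σ 1) := by
        field_simp
        ring
      rw [e] at h
      have h' : D ^ 2 / reTrace σ 1 = 0 := le_antisymm (by linarith) (by positivity)
      have : D = 0 := by simpa [hspos.ne'] using h'
      linarith
    rw [h13, e3]
    refine isQubitMoment_of_parallel ht2 fun p q ↦ ?_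
    obtain ⟨hA, hAA⟩ := h₁.one_add_smul (boolSign_sq p)
    obtain ⟨hB, hBB⟩ := h₂.one_add_smul (boolSign_sq q)
    have h := hσ.reTrace_mul_nonneg hA hAA hB
      ((Commute.one_right σ).add_right (hσ₂.smul_right _)) two_pos
      (by rw [hBB, mul_smul_comm])
    have e : (1 + boolSign p • U₁) * (1 + boolSign q • U₂) = 1 + boolSign p • U₁ +
        boolSign q • U₂ + (boolSign p * boolSign q) • (U₁ * U₂) := by
      simp only [add_mul, mul_add, smul_mul_assoc, mul_smul_comm, one_mul, mul_one]
      module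
    rw [e] at h
    simpa only [map_add, map_smul, smul_eq_mul] using h
  · have z2 : reTrace σ U₂ = 0 := by
      have : (1 - t ^ 2) * reTrace σ U₂ = 0 := by
        rw [e3] at e2
        linear_combination e2
      exact (mul_eq_zero.mp this).resolve_left (by linarith)
    have z3 : reTrace σ U₃ = 0 := by rw [e3, z2, mul_zero]
    have hle : |reTrace σ U₁| ≤ reTrace σ 1 := by
      have (p : Bool) : 0 ≤ reTrace σ 1 + boolSign p * reTrace σ U₁ := by
        obtain ⟨hA, hAA⟩ := h₁.one_add_smul (boolSign_sq p)
        have h := hσ.reTrace_mul_self_nonneg hA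
        rw [hAA] at h
        simp only [map_add, map_smul, smul_eq_mul] at h
        linarith
      have k1 := this true
      have k2 := this false
      simp only [boolSign, cond] at k1 k2
      exact abs_le.mpr ⟨by linarith, by linarith⟩
    rw [z2, z3]
    exact isQubitMoment_of_isotropic ht1
      (abs_reTrace_add_le hσ h₁ h₂ h₃ hσ₂ hσ₃ ht ht2 z2 z3) hle

end reflections

section spectral

variable {n : Type*} [Fintype n] [DecidableEq n]

lemma Matrix.IsHermitian.exists_spectral_projections {T : Matrix n n ℂ} (hT : T.IsHermitian) :
    ∃ (S : Finset ℝ) (E : ℝ → Matrix n n ℂ), ∑ t ∈ S, E t = 1 ∧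
      ∀ t, (E t).IsHermitian ∧ E t * E t = E t ∧ E t * T = t • E t ∧
        ∀ X, Commute T X → Commute (E t) X := by
  have hfin := T.finite_real_spectrum
  have hsa : IsSelfAdjoint T := hT
  have hc (f : ℝ → ℝ) : ContinuousOn f (spectrum ℝ T) := hfin.continuousOn f
  refine ⟨hfin.toFinset, fun t ↦ cfc (fun x ↦ if x = t then (1 : ℝ) else 0) T, ?_, fun t ↦
    ⟨cfc_predicate _ T, ?_, ?_, fun X hX ↦ hX.cfc_real _⟩⟩
  · rw [← cfc_sum _ _ _ fun i _ ↦ hc _, ← cfc_one ℝ T]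
    refine cfc_congr fun x hx ↦ ?_
    simpa using hx
  · rw [← cfc_mul _ _ T (hc _) (hc _)]
    refine cfc_congr fun x _ ↦ ?_
    simp
  · nth_rw 2 [← cfc_id' ℝ T]
    rw [← cfc_mul _ _ T (hc _) (hc _), ← cfc_smul _ _ T (hc _)]
    refine cfc_congr fun x _ ↦ ?_
    by_cases h : x = t <;> simp [h]

/-- Second moments of three reflections in a tracial state are already attained by mixtures of
qubit models and deterministic models. -/
theorem isQubitMoment_of_commute {ρ U₁ U₂ U₃ : Matrix n n ℂ} (hρ : ρ.PosSemidef)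
    (h₁ : IsReflection U₁) (h₂ : IsReflection U₂) (h₃ : IsReflection U₃)
    (hρ₂ : Commute ρ U₂) (hρ₃ : Commute ρ U₃) :
    IsQubitMoment (fun i ↦ reTrace ρ (![U₁, U₂, U₃] i))
      (Matrix.of fun i j ↦ reTrace ρ (![U₁, U₂, U₃] i * ![U₁, U₂, U₃] j)) := by
  have hT : (U₂ * U₃ + U₃ * U₂).IsHermitian := by
    rw [Matrix.IsHermitian, conjTranspose_add, conjTranspose_mul, conjTranspose_mul, h₂.1.eq,
      h₃.1.eq, add_comm]
  obtain ⟨S, E, hsum, hE⟩ := hT.exists_spectral_projections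
  have hρS : ρ = ∑ t ∈ S, ρ * E t := by rw [← Finset.mul_sum, hsum, mul_one]
  have hT₂ : Commute (U₂ * U₃ + U₃ * U₂) U₂ := by
    simp only [commute_iff_eq, add_mul, mul_add, Matrix.mul_assoc, h₂.2, mul_one]
    rw [← Matrix.mul_assoc U₂ U₂, h₂.2, one_mul, add_comm]
  have hT₃ : Commute (U₂ * U₃ + U₃ * U₂) U₃ := by
    simp only [commute_iff_eq, add_mul, mul_add, Matrix.mul_assoc, h₃.2, mul_one]
    rw [← Matrix.mul_assoc U₃ U₃, h₃.2, one_mul, add_comm]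
  have hTρ : Commute (U₂ * U₃ + U₃ * U₂) ρ :=
    ((hρ₂.mul_right hρ₃).add_right (hρ₃.mul_right hρ₂)).symm
  have hblock : ∀ t ∈ S, IsQubitMoment (fun i ↦ reTrace (ρ * E t) (![U₁, U₂, U₃] i))
      (Matrix.of fun i j ↦ reTrace (ρ * E t) (![U₁, U₂, U₃] i * ![U₁, U₂, U₃] j)) := by
    intro t _
    obtain ⟨hEh, hEE, hET, hEc⟩ := hE t
    have hpos : (ρ * E t).PosSemidef := by
      have h := hρ.conjTranspose_mul_mul_same (E t)
      rwa [hEh.eq, (hEc ρ hTρ).eq, Matrix.mul_assoc, hEE] at h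
    refine isQubitMoment_of_anticommutator (t := t / 2) hpos h₁ h₂ h₃
      (hρ₂.mul_left (hEc _ hT₂)) (hρ₃.mul_left (hEc _ hT₃)) ?_
    rw [Matrix.mul_assoc, hET, mul_smul_comm, mul_div_cancel₀ t two_ne_zero]
  convert IsQubitMoment.sum S hblock using 1
  · ext i
    rw [Finset.sum_apply, ← reTrace_sum_left, ← hρS]
  · ext i j
    rw [Matrix.sum_apply]
    simp only [Matrix.of_apply]
    rw [← reTrace_sum_left, ← hρS]

end spectral

section realization

lemma trace_fromBlocks_diag {m n : Type*} [Fintype m] [Fintype n] (A : Matrix m m ℂ)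
    (B : Matrix m n ℂ) (C : Matrix n m ℂ) (D : Matrix n n ℂ) :
    (fromBlocks A B C D).trace = A.trace + D.trace := by
  simp [Matrix.trace]

/-- The linear combination of the Pauli matrices with coefficient vector `x`. -/
noncomputable def pauliCombination (x : Fin 3 → ℝ) : Matrix (Fin 2) (Fin 2) ℂ :=
  !![(x 2 : ℂ), x 0 - x 1 * Complex.I; x 0 + x 1 * Complex.I, -x 2]

lemma isReflection_pauliCombination {x : Fin 3 → ℝ} (hx : x ⬝ᵥ x = 1) :
    IsReflection (pauliCombination x) := by
  have hx' : (x 0 : ℂ) * x 0 + x 1 * x 1 + x 2 * x 2 = 1 := by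
    simp only [dotProduct, Fin.sum_univ_three] at hx
    exact_mod_cast hx
  constructor
  · ext i j
    fin_cases i <;> fin_cases j <;> simp [pauliCombination, sub_eq_add_neg]
  · ext i j
    fin_cases i <;> fin_cases j <;> simp [pauliCombination, Matrix.mul_apply]
    · linear_combination hx' - (x 1 : ℂ) ^ 2 * Complex.I_sq
    · ring
    · ring
    · linear_combination hx' - (x 1 : ℂ) ^ 2 * Complex.I_sq

lemma trace_pauliCombination (x : Fin 3 → ℝ) : (pauliCombination x).trace = 0 := by
  simp [pauliCombination, Matrix.trace]

lemma re_trace_pauliCombination_mul (x y : Fin 3 → ℝ) :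
    (pauliCombination x * pauliCombination y).trace.re = 2 * x ⬝ᵥ y := by
  simp [pauliCombination, Matrix.trace, dotProduct, Fin.sum_univ_three]
  ring

open scoped MatrixOrder in
lemma exists_reflections_of_posSemidef {G : Matrix (Fin 3) (Fin 3) ℝ} (hG : G.PosSemidef)
    (hd : ∀ i, G i i = G 0 0) :
    ∃ V : Fin 3 → Matrix (Fin 2) (Fin 2) ℂ, (∀ i, IsReflection (V i)) ∧
      (∀ i, reTrace ((G 0 0 / 2) • 1) (V i) = 0) ∧
      ∀ i j, reTrace ((G 0 0 / 2) • 1) (V i * V j) = G i j := by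
  obtain ⟨B, hB⟩ := CStarAlgebra.nonneg_iff_eq_star_mul_self.mp hG.nonneg
  have hGB (i j) : G i j = B.col i ⬝ᵥ B.col j := by
    rw [hB]
    simp [Matrix.mul_apply, dotProduct, Matrix.star_eq_conjTranspose]
  have hnn : 0 ≤ G 0 0 := hG.diag_nonneg
  rcases hnn.eq_or_lt with h0 | hpos
  · have hcol (i) : B.col i = 0 := by
      rw [← dotProduct_self_eq_zero, ← hGB, hd, ← h0]
    refine ⟨fun _ ↦ 1, fun _ ↦ ⟨Matrix.isHermitian_one, mul_one 1⟩, fun i ↦ ?_, fun i j ↦ ?_⟩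
    · simp [reTrace_apply, ← h0]
    · simp [reTrace_apply, ← h0, hGB, hcol]
  · refine ⟨fun i ↦ pauliCombination ((√(G 0 0))⁻¹ • B.col i), fun i ↦ ?_, fun i ↦ ?_,
      fun i j ↦ ?_⟩
    · apply isReflection_pauliCombination
      rw [smul_dotProduct, dotProduct_smul, ← hGB, hd i, smul_smul, smul_eq_mul, ← mul_inv,
        Real.mul_self_sqrt hnn, inv_mul_cancel₀ hpos.ne']
    · simp [reTrace_apply, trace_pauliCombination]
    · have e := re_trace_pauliCombination_mul ((√(G 0 0))⁻¹ • B.col i) ((√(G 0 0))⁻¹ • B.col j)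
      rw [smul_dotProduct, dotProduct_smul, ← hGB, smul_smul, smul_eq_mul, ← mul_inv,
        Real.mul_self_sqrt hnn] at e
      rw [reTrace_apply, smul_mul_assoc, one_mul, trace_smul, Complex.smul_re, e, smul_eq_mul]
      field_simp

/-- Moments in the cone are realized by three reflections and a commuting density matrix on the
sum of a qubit and a classical system with eight states. -/
lemma IsQubitMoment.exists_realization {m : Fin 3 → ℝ} {C : Matrix (Fin 3) (Fin 3) ℝ}
    (h : IsQubitMoment m C) (hC : C 0 0 = 1) :
    ∃ (U : Fin 3 → Matrix (Fin 2 ⊕ Bool × Bool × Bool) (Fin 2 ⊕ Bool × Bool × Bool) ℂ)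
      (ρ : Matrix (Fin 2 ⊕ Bool × Bool × Bool) (Fin 2 ⊕ Bool × Bool × Bool) ℂ),
      (∀ i, IsReflection (U i)) ∧ ρ.PosSemidef ∧ ρ.trace = 1 ∧ (∀ i, Commute ρ (U i)) ∧
      (∀ i, reTrace ρ (U i) = m i) ∧ ∀ i j, reTrace ρ (U i * U j) = C i j := by
  obtain ⟨μ, G, hμ, hG, hd, rfl, rfl⟩ := h
  obtain ⟨V, hV, hV1, hV2⟩ := exists_reflections_of_posSemidef hG hd
  have hsq (v i) : signVector v i * signVector v i = 1 := by
    rcases v with ⟨_ | _, _ | _, _ | _⟩ <;> fin_cases i <;> simp [signVector, boolSign]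
  have hnn : 0 ≤ G 0 0 := hG.diag_nonneg
  have hblock (A : Matrix (Fin 2) (Fin 2) ℂ) (f : Bool × Bool × Bool → ℝ) :
      reTrace (fromBlocks ((G 0 0 / 2) • 1) 0 0 (diagonal fun v ↦ (μ v : ℂ)))
        (fromBlocks A 0 0 (diagonal fun v ↦ (f v : ℂ))) =
      reTrace ((G 0 0 / 2) • 1) A + ∑ v, μ v * f v := by
    simp [reTrace_apply, fromBlocks_multiply, trace_fromBlocks_diag, ← Complex.ofReal_mul,
      ← Complex.ofReal_sum, trace_diagonal]
  refine ⟨fun i ↦ fromBlocks (V i) 0 0 (diagonal fun v ↦ (signVector v i : ℂ)),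
    fromBlocks ((G 0 0 / 2) • 1) 0 0 (diagonal fun v ↦ (μ v : ℂ)), fun i ↦ ⟨?_, ?_⟩, ?_, ?_,
    fun i ↦ ?_, fun i ↦ ?_, fun i j ↦ ?_⟩
  · refine (hV i).1.fromBlocks (by simp) (isHermitian_diagonal_of_self_adjoint _ ?_)
    ext v
    simp
  · rw [fromBlocks_multiply, ← fromBlocks_one]
    simp [(hV i).2, ← Complex.ofReal_mul, hsq]
  · have : (fromBlocks ((G 0 0 / 2) • 1) 0 0 (diagonal fun v ↦ (μ v : ℂ)) :
        Matrix (Fin 2 ⊕ Bool × Bool × Bool) _ ℂ) =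
        diagonal (Sum.elim (fun _ ↦ ((G 0 0 / 2 : ℝ) : ℂ)) fun v ↦ (μ v : ℂ)) := by
      rw [← fromBlocks_diagonal]
      congr 1
      ext i j
      simp [Matrix.one_apply, Matrix.diagonal_apply]
    rw [this, posSemidef_diagonal_iff]
    rintro (i | v)
    · exact Complex.zero_le_real.mpr (by positivity)
    · exact Complex.zero_le_real.mpr (hμ v)
  · simp only [Matrix.add_apply, Matrix.sum_apply, Matrix.smul_apply, vecMulVec_apply, hsq,
      smul_eq_mul, mul_one] at hC
    rw [trace_fromBlocks_diag, trace_diagonal, ← Complex.ofReal_one, ← hC]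
    simp [trace_smul]
    ring
  · rw [commute_iff_eq, fromBlocks_multiply, fromBlocks_multiply]
    simp [mul_comm]
  · rw [hblock, hV1]
    simp
  · have e : (fromBlocks (V i) 0 0 (diagonal fun v ↦ (signVector v i : ℂ)) *
        fromBlocks (V j) 0 0 (diagonal fun v ↦ (signVector v j : ℂ))) =
        fromBlocks (V i * V j) 0 0
          (diagonal fun v ↦ ((signVector v i * signVector v j : ℝ) : ℂ)) := by
      simp [fromBlocks_multiply]
    rw [e, hblock, hV2]
    simp [Matrix.sum_apply, vecMulVec_apply, add_comm]

end realization

section projections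

variable {d : ℕ}

lemma IsProjn.isReflection {P : Matrix (Fin d) (Fin d) ℂ} (hP : IsProjn P) :
    IsReflection ((2 : ℝ) • P - 1) := by
  refine ⟨(hP.1.smul (IsSelfAdjoint.all _)).sub Matrix.isHermitian_one, ?_⟩
  simp only [sub_mul, mul_sub, smul_mul_assoc, mul_smul_comm, hP.2, one_mul, mul_one]
  module

lemma IsReflection.isProjn {U : Matrix (Fin d) (Fin d) ℂ} (hU : IsReflection U) :
    IsProjn ((1 / 2 : ℝ) • (1 + U)) := by
  refine ⟨(Matrix.isHermitian_one.add hU.1).smul (IsSelfAdjoint.all _), ?_⟩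
  simp only [add_mul, mul_add, smul_mul_assoc, mul_smul_comm, hU.2, one_mul, mul_one]
  module

lemma IsReflection.submatrix {n m : Type*} [Fintype n] [DecidableEq n] [Fintype m]
    [DecidableEq m] {U : Matrix n n ℂ} (hU : IsReflection U) (e : m ≃ n) :
    IsReflection (U.submatrix e e) :=
  ⟨hU.1.submatrix e, by rw [submatrix_mul_equiv, hU.2, submatrix_one_equiv]⟩

lemma trace_submatrix_equiv {n m : Type*} [Fintype n] [Fintype m] (A : Matrix n n ℂ)
    (e : m ≃ n) : (A.submatrix e e).trace = A.trace :=
  e.sum_comp fun i ↦ A i i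

lemma reTrace_submatrix_equiv {n m : Type*} [Fintype n] [Fintype m] (σ X : Matrix n n ℂ)
    (e : m ≃ n) : reTrace (σ.submatrix e e) (X.submatrix e e) = reTrace σ X := by
  rw [reTrace_apply, reTrace_apply, submatrix_mul_equiv, trace_submatrix_equiv]

lemma IsQubitMoment.exists_projections {m : Fin 3 → ℝ} {C : Matrix (Fin 3) (Fin 3) ℝ}
    (h : IsQubitMoment m C) (hC : C 0 0 = 1) :
    ∃ (P : Fin 3 → Matrix (Fin 10) (Fin 10) ℂ) (ρ : Matrix (Fin 10) (Fin 10) ℂ),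
      (∀ i, IsProjn (P i)) ∧ ρ.PosSemidef ∧ ρ.trace = 1 ∧ (∀ i, Commute ρ (P i)) ∧
      (∀ i, (ρ * P i).trace.re = (1 + m i) / 2) ∧
      ∀ i j, (ρ * (P i * P j)).trace.re = (1 + m i + m j + C i j) / 4 := by
  obtain ⟨U, ρ, hU, hρ, htr, hc, hm, hCC⟩ := h.exists_realization hC
  let e : Fin 10 ≃ Fin 2 ⊕ Bool × Bool × Bool := (Fintype.equivFinOfCardEq (by simp)).symm
  have h1 : reTrace (ρ.submatrix e e) 1 = 1 := by
    rw [← submatrix_one_equiv e, reTrace_submatrix_equiv, reTrace_apply, mul_one, htr,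
      Complex.one_re]
  have hm' (i) : reTrace (ρ.submatrix e e) ((U i).submatrix e e) = m i := by
    rw [reTrace_submatrix_equiv, hm]
  refine ⟨fun i ↦ (1 / 2 : ℝ) • (1 + (U i).submatrix e e), ρ.submatrix e e,
    fun i ↦ ((hU i).submatrix e).isProjn, hρ.submatrix e, ?_, fun i ↦ ?_, fun i ↦ ?_,
    fun i j ↦ ?_⟩
  · rw [trace_submatrix_equiv, htr]
  · refine ((Commute.one_right _).add_right ?_).smul_right _
    rw [commute_iff_eq, submatrix_mul_equiv, submatrix_mul_equiv, (hc i).eq]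
  · rw [← reTrace_apply, map_smul, map_add, h1, hm', smul_eq_mul]
    ring
  · have hprod : (1 / 2 : ℝ) • (1 + (U i).submatrix e e) *
        (1 / 2 : ℝ) • (1 + (U j).submatrix e e) = (1 / 4 : ℝ) •
          (1 + (U i).submatrix e e + (U j).submatrix e e + (U i * U j).submatrix e e) := by
      rw [← submatrix_mul_equiv (U i) (U j) e e e]
      simp only [add_mul, mul_add, smul_mul_assoc, mul_smul_comm, one_mul, mul_one]
      module
    rw [hprod, ← reTrace_apply, map_smul, map_add, map_add, map_add, h1, hm', hm',
      reTrace_submatrix_equiv, hCC, smul_eq_mul]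
    ring

end projections

/-- Corollary 3.17: there is a dimension `d ≤ 16` such that every synchronous quantum
correlation triple is realizable using projections and a commuting density matrix on a
Hilbert space of dimension `d` (in fact `d = 16` works). -/
theorem syncTriple_dimension_sixteen :
    ∃ d : ℕ, 0 < d ∧ d ≤ 16 ∧
      ∀ (r₁ r₂ r₃ w₁₂ w₁₃ w₂₃ : ℝ), SyncTriple r₁ r₂ r₃ (w₁₂, w₁₃, w₂₃) →
        ∃ P₁ P₂ P₃ ρ : Matrix (Fin d) (Fin d) ℂ,
          IsProjn P₁ ∧ IsProjn P₂ ∧ IsProjn P₃ ∧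
          ρ.PosSemidef ∧ ρ.trace = 1 ∧
          Commute ρ P₁ ∧ Commute ρ P₂ ∧ Commute ρ P₃ ∧
          ((ρ * P₁).trace).re = r₁ ∧ ((ρ * P₂).trace).re = r₂ ∧
          ((ρ * P₃).trace).re = r₃ ∧
          ((ρ * (P₁ * P₂)).trace).re = w₁₂ ∧ ((ρ * (P₁ * P₃)).trace).re = w₁₃ ∧
          ((ρ * (P₂ * P₃)).trace).re = w₂₃ := by
  refine ⟨10, by norm_num, by norm_num, ?_⟩
  rintro r₁ r₂ r₃ w₁₂ w₁₃ w₂₃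
    ⟨d, _, P₁, P₂, P₃, ρ, hP₁, hP₂, hP₃, hρ, htr, -, hc₂, hc₃, rfl, rfl, rfl, hw⟩
  obtain ⟨rfl, rfl, rfl⟩ : w₁₂ = _ ∧ w₁₃ = _ ∧ w₂₃ = _ := by simpa using hw
  have hc {P : Matrix (Fin d) (Fin d) ℂ} (h : Commute ρ P) : Commute ρ ((2 : ℝ) • P - 1) :=
    (h.smul_right _).sub_right (Commute.one_right ρ)
  have h1 : reTrace ρ 1 = 1 := by rw [reTrace_apply, mul_one, htr, Complex.one_re]
  have hm (P : Matrix (Fin d) (Fin d) ℂ) :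
      (1 + reTrace ρ ((2 : ℝ) • P - 1)) / 2 = reTrace ρ P := by
    rw [map_sub, map_smul, h1, smul_eq_mul]
    ring
  have hC (P Q : Matrix (Fin d) (Fin d) ℂ) :
      (1 + reTrace ρ ((2 : ℝ) • P - 1) + reTrace ρ ((2 : ℝ) • Q - 1) +
        reTrace ρ (((2 : ℝ) • P - 1) * ((2 : ℝ) • Q - 1))) / 4 = reTrace ρ (P * Q) := by
    simp only [sub_mul, mul_sub, smul_mul_assoc, mul_smul_comm, one_mul, mul_one, map_sub,
      map_smul, h1, smul_eq_mul]
    ring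
  have key := isQubitMoment_of_commute hρ hP₁.isReflection hP₂.isReflection hP₃.isReflection
    (hc hc₂) (hc hc₃)
  obtain ⟨Q, τ, hQ, hτ, hτ1, hτQ, hτm, hτC⟩ :=
    key.exists_projections (by simp [hP₁.isReflection.2, h1])
  exact ⟨Q 0, Q 1, Q 2, τ, hQ 0, hQ 1, hQ 2, hτ, hτ1, hτQ 0, hτQ 1, hτQ 2,
    (hτm 0).trans (hm P₁), (hτm 1).trans (hm P₂), (hτm 2).trans (hm P₃),
    (hτC 0 1).trans (hC P₁ P₂), (hτC 0 2).trans (hC P₁ P₃), (hτC 1 2).trans (hC P₂ P₃)⟩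
end
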